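/- arXiv:1509.08859 — 2 statements merged into one kernel-verified Lean document; each statement's English description precedes it below -/
import Mathlib

section
/- Let d ≥ 2, set m = ⌊d/2⌋ and M = ⌈d/2⌉, and let p₁,…,p_{d+2} be d+2 points in EuclideanSpace ℝ (Fin d), each of norm 1. Then vol(convexHull ℝ {p₁,…,p_{d+2}}) ≤ (1/d!) · (m+1)^{(m+1)/2} · (M+1)^{(M+1)/2} / (m^{m/2} · M^{M/2}). (The maximum is attained exactly by the convex hull of two regular simplices of dimensions m and M, inscribed in the unit sphere and contained in orthogonal linear subspaces.) -/
open MeasureTheory Real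

lemma aux_orthant_measure (d : ℕ) :
    volume {x : Fin d → ℝ | (∀ i, 0 < x i) ∧ ∑ i, |x i| < 1}
      ≤ ENNReal.ofReal (1 / (d.factorial : ℝ)) := by
  classical
  set T : (Fin d → Bool) → Set (Fin d → ℝ) := fun σ =>
    {x | (∀ i, 0 < (if σ i then -x i else x i)) ∧ ∑ i, |x i| < 1} with hT
  set B : Set (Fin d → ℝ) := {x | ∑ i, |x i| < 1} with hB
  have hopen : ∀ σ, IsOpen (T σ) := by
    intro σ
    simp only [hT, Set.ofPred_and, Set.ofPred_forall]
    refine IsOpen.inter (isOpen_iInter_of_finite fun i => ?_) ?_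
    · cases σ i
      · simpa using isOpen_lt continuous_const (continuous_apply i)
      · simpa using isOpen_lt (continuous_apply i) continuous_const
    · exact isOpen_lt (by fun_prop) continuous_const
  have hvol : ∀ σ, volume (T σ) = volume (T fun _ => false) := by
    intro σ
    have hmp : MeasurePreserving
        (fun (x : Fin d → ℝ) i => (fun y : ℝ => if σ i then -y else y) (x i)) volume volume := by
      refine volume_preserving_pi (β' := fun _ : Fin d => ℝ)
        (α' := fun _ : Fin d => ℝ) (f := fun i (y : ℝ) => if σ i then -y else y) fun i => ?_
      cases σ i
      · simp only [Bool.false_eq_true, if_false]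
        exact MeasurePreserving.id (volume : Measure ℝ)
      · simpa using Measure.measurePreserving_neg _
    rw [← hmp.measure_preimage (hopen _).measurableSet.nullMeasurableSet]
    congr 1
    ext x
    simp only [hT, Set.mem_ofPred_eq, Set.mem_preimage]
    have : ∀ i, |if σ i then - x i else x i| = |x i| := by
      intro i; split_ifs <;> simp
    have h2 : ∀ i, (0 < if σ i = true then -(if σ i = true then -x i else x i)
        else (if σ i = true then -x i else x i)) ↔ 0 < x i := by
      intro i; split_ifs <;> simp
    simp [this, h2]
  have hdis : Pairwise (Function.onFun Disjoint T) := by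
    intro σ τ hst
    rw [Function.onFun, Set.disjoint_left]
    rintro x ⟨h1, -⟩ ⟨h2, -⟩
    apply hst
    funext i
    have a := h1 i
    have b := h2 i
    cases hσ : σ i <;> cases hτ : τ i <;> simp [hσ, hτ] at a b ⊢ <;> linarith
  have hsub : (⋃ σ, T σ) ⊆ B := Set.iUnion_subset fun σ x hx => hx.2
  have h1 : volume (⋃ σ, T σ) = 2 ^ d * volume (T fun _ => false) := by
    rw [measure_iUnion hdis fun σ => (hopen σ).measurableSet, tsum_fintype]
    simp [hvol]
  have h2 : volume B = 2 ^ d * ENNReal.ofReal (1 / (d.factorial : ℝ)) := by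
    have := MeasureTheory.volume_sum_rpow_lt_one (Fin d) (p := 1) le_rfl
    simp only [Real.rpow_one] at this
    rw [hB, this]
    simp only [Fintype.card_fin, div_one, one_add_one_eq_two, Real.Gamma_two, mul_one,
      Real.Gamma_nat_eq_factorial]
    rw [div_eq_mul_one_div, ENNReal.ofReal_mul (by positivity), ENNReal.ofReal_pow (by norm_num)]
    simp
  have h3 := measure_mono (μ := volume) hsub
  rw [h1, h2] at h3
  have h4 := (ENNReal.mul_le_mul_iff_right (by simp) (by simp)).1 h3
  simpa [hT] using h4

lemma aux_simplex_pi (d : ℕ) :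
    volume {x : Fin d → ℝ | (∀ i, 0 ≤ x i) ∧ ∑ i, x i ≤ 1}
      ≤ ENNReal.ofReal (1 / (d.factorial : ℝ)) := by
  set S : Set (Fin d → ℝ) := {x | (∀ i, 0 < x i) ∧ ∑ i, |x i| < 1} with hS
  have hc : Convex ℝ S := by
    intro x hx y hy a b ha hb hab
    refine ⟨fun i => ?_, ?_⟩
    · have := hx.1 i
      have := hy.1 i
      simp only [Pi.add_apply, Pi.smul_apply, smul_eq_mul]
      rcases ha.eq_or_lt with rfl | ha
      · have : b = 1 := by linarith
        subst this; simpa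
      · positivity
    · calc ∑ i, |(a • x + b • y) i| ≤ ∑ i, (a * |x i| + b * |y i|) := by
            refine Finset.sum_le_sum fun i _ => ?_
            simp only [Pi.add_apply, Pi.smul_apply, smul_eq_mul]
            refine (abs_add_le _ _).trans ?_
            rw [abs_mul, abs_mul, abs_of_nonneg ha, abs_of_nonneg hb]
        _ = a * ∑ i, |x i| + b * ∑ i, |y i| := by
            rw [Finset.sum_add_distrib, Finset.mul_sum, Finset.mul_sum]
        _ < 1 := by
            have h1 := hx.2
            have h2 := hy.2
            rcases ha.eq_or_lt with rfl | ha
            · have : b = 1 := by linarith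
              subst this; simpa using h2
            · nlinarith
  have hsub : {x : Fin d → ℝ | (∀ i, 0 ≤ x i) ∧ ∑ i, x i ≤ 1} ⊆ closure S := by
    rintro x ⟨h0, h1⟩
    set c : ℝ := 1 / (d + 1) with hcdef
    have hcpos : 0 < c := by positivity
    have hlim : Filter.Tendsto (fun t : ℝ => fun i => (1 - t) * x i + t * c)
        (nhdsWithin 0 (Set.Ioi 0)) (nhds x) := by
      have : Filter.Tendsto (fun t : ℝ => fun i => (1 - t) * x i + t * c)
        (nhds 0) (nhds (fun i => (1 - 0) * x i + 0 * c)) := by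
        apply Continuous.tendsto
        fun_prop
      simp only [sub_zero, one_mul, zero_mul, add_zero] at this
      exact this.mono_left nhdsWithin_le_nhds
    refine mem_closure_of_tendsto hlim ?_
    filter_upwards [Ioo_mem_nhdsGT (show (0 : ℝ) < 1 by norm_num)] with t ht
    have ht1 : 0 < 1 - t := by linarith [ht.2]
    have ht0 : 0 < t := ht.1
    have hpos : ∀ i, 0 < (1 - t) * x i + t * c := fun i => by
      have := h0 i
      positivity
    refine ⟨hpos, ?_⟩
    simp only [abs_of_pos (hpos _)]
    rw [Finset.sum_add_distrib, ← Finset.mul_sum]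
    simp only [Finset.sum_const, Finset.card_univ, Fintype.card_fin, nsmul_eq_mul]
    have hdc : (d : ℝ) * c < 1 := by
      rw [hcdef, mul_one_div, div_lt_one (by positivity)]; linarith
    nlinarith
  calc _ ≤ volume (closure S) := measure_mono hsub
    _ = volume S := by
        refine le_antisymm ?_ (measure_mono subset_closure)
        rw [closure_eq_self_union_frontier]
        exact (measure_union_le _ _).trans (by simp [hc.addHaar_frontier volume])
    _ ≤ _ := aux_orthant_measure d
lemma aux_mem_hull {ι E : Type*} [Fintype ι] [AddCommGroup E] [Module ℝ E] (v : ι → E) (x : E)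
    (hx : x ∈ convexHull ℝ (Set.range v)) :
    ∃ w : ι → ℝ, (∀ i, 0 ≤ w i) ∧ ∑ i, w i = 1 ∧ ∑ i, w i • v i = x := by
  classical
  have : convexHull ℝ (Set.range v) ⊆
      {x | ∃ w : ι → ℝ, (∀ i, 0 ≤ w i) ∧ ∑ i, w i = 1 ∧ ∑ i, w i • v i = x} := by
    refine convexHull_min ?_ ?_
    · rintro _ ⟨i, rfl⟩
      refine ⟨Pi.single i 1, fun j => ?_, by simp, by simp [Pi.single_apply, ite_smul]⟩
      by_cases h : j = i
      · subst h; simp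
      · simp [h]
    · rintro x ⟨w, h1, h2, rfl⟩ y ⟨u, k1, k2, rfl⟩ a b ha hb hab
      refine ⟨fun i => a * w i + b * u i, fun i => ?_, ?_, ?_⟩
      · have := h1 i
        have := k1 i
        positivity
      · rw [Finset.sum_add_distrib, ← Finset.mul_sum, ← Finset.mul_sum, h2, k2]; linarith
      · simp only [add_smul, Finset.sum_add_distrib, mul_smul, Finset.smul_sum]
  exact this hx

lemma aux_cover {n : ℕ} {E : Type*} [AddCommGroup E] [Module ℝ E] (p : Fin (n + 1) → E)
    (l : Fin (n + 1) → ℝ) (hne : l ≠ 0) (h0 : ∑ i, l i = 0) (h1 : ∑ i, l i • p i = 0) :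
    convexHull ℝ (Set.range p) ⊆
      ⋃ i ∈ Finset.univ.filter (fun i => 0 < l i),
        convexHull ℝ (Set.range (fun j => p (i.succAbove j))) := by
  intro x hx
  obtain ⟨w, hw, hw1, rfl⟩ := aux_mem_hull p x hx
  obtain ⟨i0, hi0⟩ : ∃ i, l i ≠ 0 := Function.ne_iff.1 hne
  obtain ⟨k, -, hk⟩ := Finset.exists_pos_of_sum_zero_of_exists_nonzero l h0
    ⟨i0, Finset.mem_univ _, hi0⟩
  obtain ⟨i, hi, hmin⟩ := Finset.exists_min_image (Finset.univ.filter (fun i => 0 < l i))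
    (fun i => w i / l i) ⟨k, by simpa using hk⟩
  refine Set.mem_iUnion₂.2 ⟨i, hi, ?_⟩
  have hli : 0 < l i := by simpa using hi
  set t := w i / l i with ht
  have htn : 0 ≤ t := div_nonneg (hw i) hli.le
  set u : Fin (n + 1) → ℝ := fun j => w j - t * l j with hu
  have hui : u i = 0 := by simp only [hu, ht]; field_simp; ring
  have hun : ∀ j, 0 ≤ u j := by
    intro j
    by_cases hj : 0 < l j
    · have := hmin j (by simpa using hj)
      rw [le_div_iff₀ hj] at this
      simp only [hu]; linarith
    · have := hw j
      simp only [hu]; nlinarith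
  have hus : ∑ j, u j = 1 := by
    simp only [hu, Finset.sum_sub_distrib, ← Finset.mul_sum, hw1, h0]; ring
  have hup : ∑ j, u j • p j = ∑ j, w j • p j := by
    simp only [hu, sub_smul, mul_smul, Finset.sum_sub_distrib, ← Finset.smul_sum, h1]
    simp
  rw [← hup, Fin.sum_univ_succAbove _ i, hui, zero_smul, zero_add]
  rw [Fin.sum_univ_succAbove _ i, hui, zero_add] at hus
  exact (convex_convexHull ℝ _).sum_mem (fun j _ => hun _) hus
    (fun j _ => subset_convexHull ℝ _ ⟨j, rfl⟩)

lemma aux_hadamard {n : ℕ} (A : Matrix (Fin n) (Fin n) ℝ) :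
    A.det ^ 2 ≤ ∏ i, ∑ j, A i j ^ 2 := by
  set b := EuclideanSpace.basisFun (Fin n) ℝ
  have : Fact (Module.finrank ℝ (EuclideanSpace ℝ (Fin n)) = n) := ⟨by simp⟩
  set o := b.toBasis.orientation
  have h := o.abs_volumeForm_apply_le (fun i => WithLp.toLp 2 (A i))
  rw [o.volumeForm_robust' b, Module.Basis.det_apply] at h
  have h2 : b.toBasis.toMatrix (fun i => WithLp.toLp 2 (A i)) = A.transpose := by
    ext i j
    simp [Module.Basis.toMatrix_apply, b]
  rw [h2, Matrix.det_transpose] at h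
  have h3 := pow_le_pow_left₀ (abs_nonneg _) h 2
  rw [sq_abs, ← Finset.prod_pow] at h3
  simpa [EuclideanSpace.norm_sq_eq] using h3

noncomputable def auxBord {d : ℕ} {ι : Type*} (q : ι → EuclideanSpace ℝ (Fin d)) :
    Matrix ι (Fin (d + 1)) ℝ :=
  Matrix.of fun i => Fin.cons 1 (fun k => q i k)

lemma aux_det_bord {d : ℕ} (q : Fin (d + 1) → EuclideanSpace ℝ (Fin d)) :
    (auxBord q).det = (Matrix.of fun i j : Fin d => q j.succ i - q 0 i).det := by
  have h : (auxBord q).det =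
      (Matrix.of fun i j => (auxBord q i j - if i = 0 then 0 else auxBord q 0 j)).det := by
    symm
    refine Matrix.det_eq_of_forall_row_eq_smul_add_const (fun i => if i = 0 then 0 else -1) 0
      (by simp) ?_
    intro i j
    by_cases hi : i = 0 <;> simp [hi, sub_eq_add_neg]
  rw [h, Matrix.det_succ_column_zero, Fin.sum_univ_succ, Finset.sum_eq_zero]
  · simp only [auxBord]
    rw [← Matrix.det_transpose]
    simp only [Fin.val_zero, pow_zero, Matrix.of_apply, Fin.cons_zero, if_true, sub_zero, mul_one,
      one_mul, add_zero]
    congr 1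
  · intro i _
    simp [auxBord]

lemma aux_simplex_vol {d : ℕ} (q : Fin (d + 1) → EuclideanSpace ℝ (Fin d)) :
    volume (convexHull ℝ (Set.range q)) ≤
      ENNReal.ofReal (|(auxBord q).det| / (d.factorial : ℝ)) := by
  set A : Matrix (Fin d) (Fin d) ℝ := Matrix.of fun i j : Fin d => q j.succ i - q 0 i with hA
  set T : Set (EuclideanSpace ℝ (Fin d)) := {x | (∀ i, 0 ≤ x i) ∧ ∑ i, x i ≤ 1} with hT
  have hTv : volume T ≤ ENNReal.ofReal (1 / (d.factorial : ℝ)) := by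
    refine le_trans (le_of_eq ?_) (aux_simplex_pi d)
    exact (EuclideanSpace.volume_preserving_symm_measurableEquiv_toLp (Fin d)).measure_preimage_equiv
      {x : Fin d → ℝ | (∀ i, 0 ≤ x i) ∧ ∑ i, x i ≤ 1}
  set L := Matrix.toLpLin 2 2 A with hL
  have hsub : convexHull ℝ (Set.range q) ⊆ (fun x => q 0 + x) '' (L '' T) := by
    intro x hx
    obtain ⟨w, hw, hw1, rfl⟩ := aux_mem_hull q x hx
    rw [Fin.sum_univ_succ] at hw1
    refine ⟨_, ⟨WithLp.toLp 2 (fun i => w i.succ), ⟨fun i => hw _, ?_⟩, rfl⟩, ?_⟩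
    · have := hw 0
      simp only; linarith
    · ext k
      have hw0 : w 0 = 1 - ∑ i : Fin d, w i.succ := by linarith
      simp [hL, hA, Fin.sum_univ_succ, hw0, Matrix.mulVec, dotProduct, mul_comm]
      simp only [mul_sub, Finset.sum_sub_distrib, ← Finset.sum_mul]
      ring
  calc volume (convexHull ℝ (Set.range q)) ≤ volume ((fun x => q 0 + x) '' (L '' T)) :=
        measure_mono hsub
    _ = volume (L '' T) := by rw [Set.image_add_left, measure_preimage_add]
    _ = ENNReal.ofReal |A.det| * volume T := by
        rw [Measure.addHaar_image_linearMap, hL, LinearMap.det_toLpLin]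
    _ ≤ ENNReal.ofReal |A.det| * ENNReal.ofReal (1 / (d.factorial : ℝ)) := by gcongr
    _ = _ := by
        rw [← ENNReal.ofReal_mul (abs_nonneg _), aux_det_bord, mul_one_div]

noncomputable def auxFull {d : ℕ} (p : Fin (d + 2) → EuclideanSpace ℝ (Fin d))
    (c : Fin (d + 2) → ℝ) : Matrix (Fin (d + 2)) (Fin (d + 2)) ℝ :=
  Matrix.of fun i => Fin.cons (c i) (auxBord p i)

lemma aux_full_det {d : ℕ} (p : Fin (d + 2) → EuclideanSpace ℝ (Fin d)) (c : Fin (d + 2) → ℝ) :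
    (auxFull p c).det =
      ∑ i, c i * ((-1) ^ (i : ℕ) * (auxBord (fun j => p (i.succAbove j))).det) := by
  rw [Matrix.det_succ_column_zero]
  refine Finset.sum_congr rfl fun i _ => ?_
  have : (auxFull p c).submatrix i.succAbove Fin.succ = auxBord (fun j => p (i.succAbove j)) := by
    ext a b
    simp [auxFull, auxBord]
  rw [this]
  simp only [auxFull, Matrix.of_apply, Fin.cons_zero]
  ring

lemma aux_core {d : ℕ} (p : Fin (d + 2) → EuclideanSpace ℝ (Fin d)) :
    ∃ I : Finset (Fin (d + 2)), (volume (convexHull ℝ (Set.range p))).toReal ≤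
      1 / (d.factorial : ℝ) * |(auxFull p (fun i => if i ∈ I then 1 else 0)).det| := by
  set D : Fin (d + 2) → ℝ := fun i => (auxBord (fun j => p (i.succAbove j))).det with hD
  set mu : Fin (d + 2) → ℝ := fun i => (-1) ^ (i : ℕ) * D i with hmu
  have hdet : ∀ c, (auxFull p c).det = ∑ i, c i * mu i := aux_full_det p
  have habs : ∀ i, |D i| = |mu i| := by
    intro i; simp [hmu, abs_mul]
  -- volume bound from a dependence
  have key : ∀ l : Fin (d + 2) → ℝ, l ≠ 0 → (∀ j, ∑ i, l i * auxBord p i j = 0) →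
      (volume (convexHull ℝ (Set.range p))).toReal ≤
        1 / (d.factorial : ℝ) * ∑ i with 0 < l i, |mu i| := by
    intro l hl hj
    have h0 : ∑ i, l i = 0 := by simpa [auxBord] using hj 0
    have h1 : ∑ i, l i • p i = 0 := by
      ext k
      simpa [auxBord] using hj k.succ
    have h2 := aux_cover p l hl h0 h1
    refine ENNReal.toReal_le_of_le_ofReal (by positivity) ?_
    refine (measure_mono h2).trans ((measure_biUnion_finset_le _ _).trans ?_)
    refine (Finset.sum_le_sum fun i _ => aux_simplex_vol _).trans ?_
    rw [← ENNReal.ofReal_sum_of_nonneg (fun i _ => by positivity)]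
    refine ENNReal.ofReal_le_ofReal (le_of_eq ?_)
    rw [Finset.mul_sum]
    refine Finset.sum_congr rfl fun i _ => ?_
    rw [← habs i]
    simp only [hD]
    ring
  by_cases h : mu = 0
  · have hz : (auxFull p 0).det = 0 := by rw [hdet]; simp
    obtain ⟨l, hl, hl0⟩ := Matrix.exists_vecMul_eq_zero_iff.2 hz
    refine ⟨∅, (key l hl fun j => ?_).trans ?_⟩
    · have := congrFun hl0 j.succ
      simpa [Matrix.vecMul, dotProduct, auxFull] using this
    · rw [h]; simp only [Pi.zero_apply, abs_zero, Finset.sum_const_zero, mul_zero]; positivity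
  · refine ⟨Finset.univ.filter (fun i => 0 < mu i), (key mu h fun j => ?_).trans ?_⟩
    · have h1 := hdet (fun i => auxBord p i j)
      rw [Matrix.det_zero_of_column_eq (i := 0) (j := j.succ) (Fin.succ_ne_zero j).symm] at h1
      · rw [h1]
        exact Finset.sum_congr rfl fun i _ => mul_comm _ _
      · intro k
        simp [auxFull]
    · gcongr
      rw [hdet]
      refine le_trans (le_of_eq ?_) (le_abs_self _)
      simp only [Finset.mem_filter, Finset.mem_univ, true_and, ite_mul, one_mul, zero_mul]
      rw [← Finset.sum_filter]
      exact Finset.sum_congr rfl fun i hi => abs_of_pos (by simpa using hi)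

lemma aux_det_bound {d : ℕ} (p : Fin (d + 2) → EuclideanSpace ℝ (Fin d)) (hp : ∀ i, ‖p i‖ = 1)
    (I : Finset (Fin (d + 2))) (s t : ℝ) :
    (s ^ 2 * t ^ 2) * (auxFull p (fun i => if i ∈ I then 1 else 0)).det ^ 2 ≤
      (1 + s ^ 2) ^ I.card * (1 + t ^ 2) ^ (Iᶜ).card := by
  set c : Fin (d + 2) → ℝ := fun i => if i ∈ I then 1 else 0 with hc
  set N : Matrix (Fin (d + 2)) (Fin (d + 2)) ℝ :=
    Matrix.of fun i => Fin.cons (c i) (Fin.cons (1 - c i) (fun k => p i k)) with hN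
  have h1 : (auxFull p c).det = N.det := by
    rw [← Matrix.det_transpose, ← Matrix.det_transpose N]
    symm
    refine Matrix.det_eq_of_forall_row_eq_smul_add_const (Fin.cons 0 (Fin.cons (-1) 0)) 0
      (by simp) ?_
    intro i j
    refine Fin.cases ?_ (fun i => Fin.cases ?_ (fun i => ?_) i) i
    · simp [hN, auxFull, auxBord]
    · simp [hN, auxFull, auxBord]
      ring
    · simp [hN, auxFull, auxBord]
  set v : Fin (d + 2) → ℝ := Fin.cons s (Fin.cons t 1) with hv
  have h2 := Matrix.det_mul_row v N
  have h3 := aux_hadamard (Matrix.of fun i j => v j * N i j)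
  have hprod : ∏ i, v i = s * t := by
    simp [Fin.prod_univ_succ, hv]
  rw [h2, hprod, ← h1] at h3
  have hrow : ∀ i, ∑ j, (Matrix.of fun i j => v j * N i j) i j ^ 2 =
      if i ∈ I then 1 + s ^ 2 else 1 + t ^ 2 := by
    intro i
    have hn : ∑ k, (p i k) ^ 2 = 1 := by
      have := EuclideanSpace.norm_sq_eq (p i)
      rw [hp i] at this
      simpa using this.symm
    simp only [Fin.sum_univ_succ, hv, hN, hc, Matrix.of_apply, Fin.cons_zero, Fin.cons_succ,
      Pi.one_apply, one_mul, hn]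
    split_ifs <;> ring
  rw [Finset.prod_congr rfl fun i _ => hrow i, Finset.prod_ite, Finset.prod_const,
    Finset.prod_const] at h3
  have e1 : Finset.univ.filter (fun i => i ∈ I) = I := by ext; simp
  have e2 : Finset.univ.filter (fun i => i ∉ I) = Iᶜ := by ext; simp
  rw [e1, e2] at h3
  calc _ = (s * t * (auxFull p c).det) ^ 2 := by ring
    _ ≤ _ := h3

/-- one-variable optimisation -/
lemma aux_opt (k : ℕ) (D C : ℝ) (h : ∀ u : ℝ, 0 < u → u * D ≤ (1 + u) ^ (k + 1) * C) :
    D * (k : ℝ) ^ k ≤ ((k : ℝ) + 1) ^ (k + 1) * C := by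
  rcases Nat.eq_zero_or_pos k with rfl | hk
  · simp only [zero_add, pow_one] at h
    simp only [Nat.cast_zero, pow_zero, mul_one, zero_add, pow_one, one_mul]
    by_contra! hlt
    have hpos : 0 < D - C := by linarith
    have h1 := h ((|C| + 1) / (D - C)) (by positivity)
    have h2 : (|C| + 1) / (D - C) * (D - C) = |C| + 1 := by field_simp
    have := le_abs_self C
    nlinarith
  · have hk' : (0 : ℝ) < k := by exact_mod_cast hk
    have h1 := h (1 / k) (by positivity)
    have h2 : (1 + 1 / (k : ℝ)) ^ (k + 1) = ((k : ℝ) + 1) ^ (k + 1) / (k : ℝ) ^ (k + 1) := by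
      rw [← div_pow]; congr 1; field_simp
    rw [h2] at h1
    have h3 := mul_le_mul_of_nonneg_right h1 (show (0 : ℝ) ≤ (k : ℝ) ^ (k + 1) by positivity)
    have e1 : 1 / (k : ℝ) * D * (k : ℝ) ^ (k + 1) = D * (k : ℝ) ^ k := by
      rw [pow_succ]; field_simp
    have e2 : ((k : ℝ) + 1) ^ (k + 1) / (k : ℝ) ^ (k + 1) * C * (k : ℝ) ^ (k + 1) =
      ((k : ℝ) + 1) ^ (k + 1) * C := by field_simp
    rwa [e1, e2] at h3

noncomputable def auxG (x : ℝ) : ℝ := (x + 1) * log (x + 1) - x * log x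

lemma aux_concave : ConcaveOn ℝ (Set.Ici 0) auxG := by
  have hd : ∀ x : ℝ, 0 < x → HasDerivAt auxG (log (x + 1) - log x) x := by
    intro x hx
    have h1 := (Real.hasDerivAt_mul_log (show x + 1 ≠ 0 by positivity)).comp_add_const x 1
    have h2 := Real.hasDerivAt_mul_log hx.ne'
    have h3 := h1.sub h2
    convert! h3 using 1
    ring
  refine AntitoneOn.concaveOn_of_deriv (convex_Ici 0) ?_ ?_ ?_
  · have h := Real.continuous_mul_log
    have h2 : Continuous auxG := (h.comp (continuous_id.add continuous_const)).sub h
    exact h2.continuousOn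
  · rw [interior_Ici]
    exact fun x hx => (hd x hx).differentiableAt.differentiableWithinAt
  · rw [interior_Ici]
    intro x hx y hy hxy
    have hx' : 0 < x := hx
    have hy' : 0 < y := hy
    rw [(hd x hx).deriv, (hd y hy).deriv, ← Real.log_div (by positivity) (by positivity),
      ← Real.log_div (by positivity) (by positivity)]
    apply Real.log_le_log (by positivity)
    rw [div_le_div_iff₀ hy' hx']
    nlinarith

lemma aux_balance (a b m M : ℝ) (ha : 0 ≤ a) (h1 : a ≤ m) (h2 : m ≤ b) (hs : a + b = m + M) :
    auxG a + auxG b ≤ auxG m + auxG M := by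
  rcases (h1.trans h2).eq_or_lt with h | h
  · have : m = a := by linarith
    have : M = b := by linarith
    subst_vars; linarith
  · have hb : 0 ≤ b := by linarith
    have hba : 0 < b - a := by linarith
    set t := (b - m) / (b - a) with ht
    have ht0 : 0 ≤ t := div_nonneg (by linarith) hba.le
    have ht1 : 0 ≤ 1 - t := by
      rw [ht, sub_nonneg, div_le_one hba]; linarith
    have htm : t * (b - a) = b - m := by rw [ht]; field_simp
    have c1 := aux_concave.2 (show a ∈ Set.Ici 0 from ha) (show b ∈ Set.Ici 0 from hb) ht0 ht1
      (by ring)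
    have c2 := aux_concave.2 (show a ∈ Set.Ici 0 from ha) (show b ∈ Set.Ici 0 from hb) ht1 ht0
      (by ring)
    simp only [smul_eq_mul] at c1 c2
    rw [show t * a + (1 - t) * b = m by linarith] at c1
    rw [show (1 - t) * a + t * b = M by linarith] at c2
    linarith

lemma aux_logF (k : ℕ) :
    Real.exp (auxG k) = ((k : ℝ) + 1) ^ (k + 1) / (k : ℝ) ^ k := by
  have e1 : Real.exp (((k : ℝ) + 1) * log ((k : ℝ) + 1)) = ((k : ℝ) + 1) ^ (k + 1) := by
    have := Real.exp_nat_mul (log ((k : ℝ) + 1)) (k + 1)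
    rw [Real.exp_log (by positivity)] at this
    rw [← this]; push_cast; rfl
  have e2 : Real.exp ((k : ℝ) * log (k : ℝ)) = (k : ℝ) ^ k := by
    rcases Nat.eq_zero_or_pos k with rfl | hk
    · simp
    · rw [Real.exp_nat_mul, Real.exp_log (by exact_mod_cast hk)]
  rw [auxG, Real.exp_sub, e1, e2]

lemma aux_final {d : ℕ} (p : Fin (d + 2) → EuclideanSpace ℝ (Fin d)) (hp : ∀ i, ‖p i‖ = 1)
    (I : Finset (Fin (d + 2))) (m M : ℕ) (hmM : m + M = d) (h1 : m ≤ M) (h2 : M ≤ m + 1) :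
    (auxFull p (fun i => if i ∈ I then 1 else 0)).det ^ 2 ≤
      Real.exp (auxG m) * Real.exp (auxG M) := by
  set D := (auxFull p (fun i => if i ∈ I then 1 else 0)).det ^ 2 with hD
  have hb : ∀ u w : ℝ, 0 < u → 0 < w → u * (w * D) ≤ (1 + u) ^ I.card * (1 + w) ^ (Iᶜ).card := by
    intro u w hu hw
    have := aux_det_bound p hp I (√u) (√w)
    rw [Real.sq_sqrt hu.le, Real.sq_sqrt hw.le] at this
    linarith
  have hcard : I.card + (Iᶜ).card = d + 2 := by
    rw [Finset.card_add_card_compl]; simp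
  have hpos : 0 ≤ Real.exp (auxG m) * Real.exp (auxG M) := by positivity
  -- degenerate partitions
  rcases Nat.eq_zero_or_pos I.card with hI | hI
  · have : I = ∅ := Finset.card_eq_zero.1 hI
    have h0 : D = 0 := by
      rw [hD, aux_full_det, this]; simp
    rw [h0]; exact hpos
  rcases Nat.eq_zero_or_pos (Iᶜ).card with hJ | hJ
  · have hu : I = Finset.univ := by
      rw [Finset.card_eq_zero] at hJ
      simpa using hJ
    have h0 : D = 0 := by
      rw [hD, Matrix.det_zero_of_column_eq (i := 0) (j := 1) (by simp)]
      · simp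
      · intro k
        have : (1 : Fin (d + 2)) = Fin.succ 0 := rfl
        rw [this]
        simp [auxFull, auxBord, hu]
    rw [h0]; exact hpos
  obtain ⟨a, ha⟩ : ∃ a, I.card = a + 1 := ⟨I.card - 1, by omega⟩
  obtain ⟨b, hbb⟩ : ∃ b, (Iᶜ).card = b + 1 := ⟨(Iᶜ).card - 1, by omega⟩
  rw [ha, hbb] at hb hcard
  have hab : a + b = d := by omega
  have hpp : ∀ k : ℕ, (0 : ℝ) < (k : ℝ) ^ k := by
    intro k
    rcases Nat.eq_zero_or_pos k with rfl | hk
    · simp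
    · positivity
  have s1 : ∀ w : ℝ, 0 < w → w * (D * (a : ℝ) ^ a) ≤
      (1 + w) ^ (b + 1) * ((a : ℝ) + 1) ^ (a + 1) := by
    intro w hw
    have := aux_opt a (w * D) ((1 + w) ^ (b + 1)) (fun u hu => hb u w hu hw)
    linarith
  have s2 := aux_opt b _ _ s1
  have s3 : D ≤ Real.exp (auxG a) * Real.exp (auxG b) := by
    rw [aux_logF, aux_logF, div_mul_div_comm, le_div_iff₀ (mul_pos (hpp a) (hpp b))]
    linarith
  refine s3.trans ?_
  rw [← Real.exp_add, ← Real.exp_add]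
  apply Real.exp_le_exp.2
  rcases le_total a b with h | h
  · refine aux_balance a b m M (by positivity) ?_ ?_ ?_
    · exact_mod_cast (by omega : a ≤ m)
    · exact_mod_cast (by omega : m ≤ b)
    · exact_mod_cast (by omega : a + b = m + M)
  · rw [add_comm]
    refine aux_balance b a m M (by positivity) ?_ ?_ ?_
    · exact_mod_cast (by omega : b ≤ m)
    · exact_mod_cast (by omega : m ≤ a)
    · exact_mod_cast (by omega : b + a = m + M)

lemma aux_sqrtF (k : ℕ) :
    √(Real.exp (auxG k)) = ((k : ℝ) + 1) ^ (((k : ℝ) + 1) / 2) / (k : ℝ) ^ ((k : ℝ) / 2) := by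
  have h : ∀ (x : ℝ) (n : ℕ), 0 ≤ x → √(x ^ n) = x ^ ((n : ℝ) / 2) := by
    intro x n hx
    rw [Real.sqrt_eq_rpow, ← Real.rpow_natCast, ← Real.rpow_mul hx, mul_one_div]
  rw [aux_logF, Real.sqrt_div (by positivity), h _ _ (by positivity), h _ _ (by positivity)]
  push_cast
  rfl

theorem max_volume_d_plus_two_vertices (d : ℕ) (hd : 2 ≤ d) (m M : ℕ)
    (hm : (m : ℤ) = ⌊(d : ℝ) / 2⌋) (hM : (M : ℤ) = ⌈(d : ℝ) / 2⌉)
    (p : Fin (d + 2) → EuclideanSpace ℝ (Fin d)) (hp : ∀ i, ‖p i‖ = 1) :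
    (volume (convexHull ℝ (Set.range p))).toReal ≤
      (1 / (d.factorial : ℝ)) *
        (((m : ℝ) + 1) ^ (((m : ℝ) + 1) / 2) * ((M : ℝ) + 1) ^ (((M : ℝ) + 1) / 2) /
          ((m : ℝ) ^ ((m : ℝ) / 2) * (M : ℝ) ^ ((M : ℝ) / 2))) := by
  have hm2 : 2 * m ≤ d ∧ d < 2 * m + 2 := by
    have h := Int.floor_eq_iff.1 hm.symm
    push_cast at h
    constructor
    · have : (2 * m : ℝ) ≤ d := by linarith [h.1]
      exact_mod_cast this
    · have : (d : ℝ) < 2 * m + 2 := by linarith [h.2]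
      exact_mod_cast this
  have hM2 : d ≤ 2 * M ∧ 2 * M < d + 2 := by
    have h := Int.ceil_eq_iff.1 hM.symm
    push_cast at h
    constructor
    · have : (d : ℝ) ≤ 2 * M := by linarith [h.2]
      exact_mod_cast this
    · have : (2 * M : ℝ) < d + 2 := by linarith [h.1]
      exact_mod_cast this
  obtain ⟨I, hI⟩ := aux_core p
  refine hI.trans ?_
  gcongr
  have h := aux_final p hp I m M (by omega) (by omega) (by omega)
  have h2 := Real.abs_le_sqrt h
  rw [Real.sqrt_mul (Real.exp_pos _).le, aux_sqrtF, aux_sqrtF, div_mul_div_comm] at h2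
  exact h2
end

section
/- Let d ≥ 3 be odd, and let k₁, k₂, k₃ be natural numbers with k₁ + k₂ + k₃ = d and each kᵢ ∈ {⌊d/3⌋, ⌈d/3⌉}. For any d+3 points p₁,…,p_{d+3} in EuclideanSpace ℝ (Fin d), each of norm 1, the volume of their convex hull satisfies vol(convexHull ℝ {p₁,…,p_{d+3}}) ≤ (1/d!) · ∏_{i=1}^{3} (kᵢ+1)^{(kᵢ+1)/2} / kᵢ^{kᵢ/2}. (The maximum is attained by the convex hull of three regular simplices of dimensions k₁, k₂, k₃ inscribed in the unit sphere and contained in three mutually orthogonal linear subspaces.) -/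
open MeasureTheory Real


/-- Frobenius form of the Hadamard inequality. -/
theorem det_sq_le_frob {n : ℕ} (hn : 0 < n) (A : Matrix (Fin n) (Fin n) ℝ) :
    A.det ^ 2 ≤ ((∑ i, ∑ j, A i j ^ 2) / n) ^ n := by
  have hP : (A.transpose * A).PosSemidef := by
    have := Matrix.posSemidef_conjTranspose_mul_self A
    rwa [Matrix.conjTranspose_eq_transpose_of_trivial] at this
  have hH := hP.isHermitian
  have h1 : A.det ^ 2 = ∏ i, hH.eigenvalues i := by
    have := hH.det_eq_prod_eigenvalues
    rw [Matrix.det_mul, Matrix.det_transpose] at this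
    rw [pow_two, this]; simp
  have h2 : ∑ i, ∑ j, A i j ^ 2 = ∑ i, hH.eigenvalues i := by
    have := hH.trace_eq_sum_eigenvalues
    simp only [RCLike.ofReal_real_eq_id, id] at this
    rw [← this, Matrix.trace, Finset.sum_comm]
    refine Finset.sum_congr rfl fun j _ => ?_
    simp [Matrix.mul_apply, pow_two]
  rw [h1, h2]
  have hn' : (0:ℝ) < n := by exact_mod_cast hn
  have key := Real.geom_mean_le_arith_mean_weighted Finset.univ (fun _ : Fin n => 1 / (n:ℝ))
    hH.eigenvalues (fun _ _ => by positivity) (by simp; field_simp)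
    (fun i _ => hP.eigenvalues_nonneg i)
  have hpos : 0 ≤ ∏ i, hH.eigenvalues i := Finset.prod_nonneg fun i _ => hP.eigenvalues_nonneg i
  rw [Real.finsetProd_rpow _ _ (fun i _ => hP.eigenvalues_nonneg i)] at key
  have h4 : (∏ i, hH.eigenvalues i) = ((∏ i, hH.eigenvalues i) ^ (1 / (n:ℝ))) ^ n := by
    rw [← Real.rpow_natCast, ← Real.rpow_mul hpos]
    field_simp; simp
  rw [h4]
  refine pow_le_pow_left₀ (by positivity) (key.trans (le_of_eq ?_)) n
  rw [← Finset.mul_sum]; ring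


theorem cornerSimplex_pos_volume (d : ℕ) (hd : 0 < d) :
    volume {x : Fin d → ℝ | (∀ i, 0 < x i) ∧ ∑ i, x i ≤ 1} ≤
      ENNReal.ofReal (1 / (d.factorial : ℝ)) := by
  set S : Set (Fin d → ℝ) := {x : Fin d → ℝ | (∀ i, 0 < x i) ∧ ∑ i, x i ≤ 1} with hS
  have hSm : MeasurableSet S := by
    have h1 : MeasurableSet {x : Fin d → ℝ | ∀ i, 0 < x i} := by
      rw [Set.ofPred_forall]
      exact MeasurableSet.iInter fun i => measurableSet_lt measurable_const (measurable_pi_apply i)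
    have h2 : MeasurableSet {x : Fin d → ℝ | ∑ i, x i ≤ 1} :=
      measurableSet_le (by fun_prop) measurable_const
    exact h1.inter h2
  have : Nonempty (Fin d) := ⟨⟨0, hd⟩⟩
  let sg : Bool → ℝ := fun b => if b then 1 else -1
  have hsg : ∀ b, sg b * sg b = 1 := by intro b; cases b <;> simp [sg]
  let f : (Fin d → Bool) → (Fin d → ℝ) → (Fin d → ℝ) := fun s x i => sg (s i) * x i
  let T : (Fin d → Bool) → Set (Fin d → ℝ) := fun s => f s ⁻¹' S
  have hvol : ∀ s, volume (T s) = volume S := by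
    intro s
    have hlin : f s = Matrix.toLin' (Matrix.diagonal fun i => sg (s i)) := by
      funext x i; simp [f, Matrix.mulVec_diagonal]
    have hdet : (LinearMap.det (Matrix.toLin' (Matrix.diagonal fun i => sg (s i)))) ^ 2 = 1 := by
      rw [LinearMap.det_toLin', Matrix.det_diagonal, ← Finset.prod_pow]
      exact Finset.prod_eq_one fun i _ => by rw [pow_two, hsg]
    have hne : LinearMap.det (Matrix.toLin' (Matrix.diagonal fun i => sg (s i))) ≠ 0 := by
      intro h; rw [h] at hdet; norm_num at hdet
    have habs : |(LinearMap.det (Matrix.toLin' (Matrix.diagonal fun i => sg (s i))))| = 1 := by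
      exact (pow_eq_one_iff_of_nonneg (abs_nonneg _) two_ne_zero).mp (by rw [sq_abs]; exact hdet)
    show volume (f s ⁻¹' S) = _
    rw [hlin, Measure.addHaar_preimage_linearMap _ hne, abs_inv, habs]; simp
  have hTm : ∀ s, MeasurableSet (T s) := by
    intro s
    refine measurableSet_preimage ?_ hSm
    exact measurable_pi_lambda _ fun i => (measurable_pi_apply i).const_mul _
  have hdisj : Pairwise (Function.onFun Disjoint T) := by
    intro s t hst
    rw [Function.onFun, Set.disjoint_left]
    intro x hx hy
    apply hst
    funext i
    have h1 : 0 < sg (s i) * x i := hx.1 i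
    have h2 : 0 < sg (t i) * x i := hy.1 i
    cases hs : s i <;> cases ht : t i <;> simp [sg, hs, ht] at h1 h2 ⊢ <;> linarith
  have hsub : (⋃ s, T s) ⊆ {x : Fin d → ℝ | (∑ i, |x i| ^ (1:ℝ)) ^ (1 / (1:ℝ)) ≤ 1} := by
    intro x hx
    obtain ⟨s, hs⟩ := Set.mem_iUnion.mp hx
    simp only [Set.mem_ofPred_eq, Real.rpow_one, div_one]
    refine le_trans (le_of_eq (Finset.sum_congr rfl fun i _ => ?_)) hs.2
    have h1 : 0 < sg (s i) * x i := hs.1 i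
    show |x i| = sg (s i) * x i
    cases h : s i
    · simp [sg, h] at h1 ⊢; linarith [abs_of_neg h1]
    · simp [sg, h] at h1 ⊢; linarith [abs_of_pos h1]
  have h1 := measure_mono (μ := volume) hsub
  rw [measure_iUnion hdisj hTm, volume_sum_rpow_le (Fin d) le_rfl] at h1
  simp only [hvol, tsum_fintype, Finset.sum_const, Finset.card_univ, Fintype.card_fun,
    Fintype.card_bool, Fintype.card_fin, nsmul_eq_mul, ENNReal.ofReal_one, one_pow, one_mul] at h1
  have h2 : (2 * Gamma (1 / 1 + 1)) ^ d / Gamma ((d:ℝ) / 1 + 1) = 2 ^ d * (1 / (d.factorial : ℝ)) := by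
    rw [div_one (d:ℝ), Real.Gamma_nat_eq_factorial]
    norm_num
    ring
  rw [h2, ENNReal.ofReal_mul (by positivity), ENNReal.ofReal_pow (by norm_num)] at h1
  norm_num at h1 ⊢
  rwa [ENNReal.mul_le_mul_iff_right (by positivity) (by finiteness)] at h1

theorem cornerSimplex_volume (d : ℕ) (hd : 0 < d) :
    volume {x : Fin d → ℝ | (∀ i, 0 ≤ x i) ∧ ∑ i, x i ≤ 1} ≤
      ENNReal.ofReal (1 / (d.factorial : ℝ)) := by
  refine le_trans ?_ (cornerSimplex_pos_volume d hd)
  have hnull : volume (⋃ i : Fin d, {x : Fin d → ℝ | x i = 0}) = 0 := by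
    rw [measure_iUnion_null_iff]
    intro i
    exact Measure.pi_hyperplane (fun _ => volume) i 0
  calc volume {x : Fin d → ℝ | (∀ i, 0 ≤ x i) ∧ ∑ i, x i ≤ 1}
      ≤ volume ({x : Fin d → ℝ | (∀ i, 0 < x i) ∧ ∑ i, x i ≤ 1} ∪
          ⋃ i : Fin d, {x : Fin d → ℝ | x i = 0}) := by
        apply measure_mono
        rintro x ⟨hx, hx2⟩
        by_cases h : ∀ i, 0 < x i
        · exact Or.inl ⟨h, hx2⟩
        · push Not at h
          obtain ⟨i, hi⟩ := h
          exact Or.inr (Set.mem_iUnion.mpr ⟨i, le_antisymm hi (hx i)⟩)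
    _ ≤ _ := (measure_union_le _ _).trans (by rw [hnull, add_zero])

/-- A simplex in coordinates. -/
theorem simplex_volume (d : ℕ) (hd : 0 < d) (q0 : Fin d → ℝ) (q : Fin d → Fin d → ℝ)
    (s : Set (Fin d → ℝ))
    (hs : ∀ y ∈ s, ∃ x : Fin d → ℝ, (∀ i, 0 ≤ x i) ∧ ∑ i, x i ≤ 1 ∧
      y = q0 + ∑ i, x i • (q i - q0)) :
    volume s ≤ ENNReal.ofReal (|(Matrix.of fun i j => q i j - q0 j).det| / d.factorial) := by
  set A : Matrix (Fin d) (Fin d) ℝ := Matrix.of fun i j => q i j - q0 j with hA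
  set L := Matrix.toLin' A.transpose with hL
  have hLx : ∀ x : Fin d → ℝ, L x = ∑ i, x i • (q i - q0) := by
    intro x; funext j
    simp [hL, hA, Matrix.mulVec, dotProduct, Finset.sum_apply, mul_comm]
  have hsub : s ⊆ (fun y => q0 + y) '' (L '' {x : Fin d → ℝ | (∀ i, 0 ≤ x i) ∧ ∑ i, x i ≤ 1}) := by
    intro y hy
    obtain ⟨x, h1, h2, h3⟩ := hs y hy
    exact ⟨L x, ⟨x, ⟨h1, h2⟩, rfl⟩, by simp [hLx, h3]⟩
  refine (measure_mono hsub).trans ?_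
  rw [Set.image_add_left, measure_preimage_add, Measure.addHaar_image_linearMap, hL,
    LinearMap.det_toLin', Matrix.det_transpose, div_eq_mul_one_div, ENNReal.ofReal_mul (abs_nonneg _)]
  gcongr
  exact cornerSimplex_volume d hd


/-- The square matrix with columns: coordinates of the points, `1`, `u`, `v`. -/
def bigMat {d : ℕ} (q : Fin (d + 3) → Fin d → ℝ) (u v : Fin (d + 3) → ℝ) :
    Matrix (Fin (d + 3)) (Fin (d + 3)) ℝ :=
  Matrix.of fun i j => Sum.elim (q i) ![1, u i, v i] (finSumFinEquiv.symm j)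

theorem bigMat_update_u {d : ℕ} (q : Fin (d + 3) → Fin d → ℝ) (u v : Fin (d + 3) → ℝ) :
    bigMat q u v = (bigMat q 0 v).updateCol (finSumFinEquiv (Sum.inr 1)) u := by
  ext i j
  obtain ⟨j, rfl⟩ := finSumFinEquiv.surjective j
  rcases j with j | j
  · rw [Matrix.updateCol_ne (finSumFinEquiv.injective.ne (by simp))]; simp [bigMat]
  · by_cases h : j = 1
    · subst h; simp [bigMat]
    · rw [Matrix.updateCol_ne (by simpa using h)]
      fin_cases j <;> simp [bigMat] at h ⊢

theorem bigMat_update_v {d : ℕ} (q : Fin (d + 3) → Fin d → ℝ) (u v : Fin (d + 3) → ℝ) :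
    bigMat q u v = (bigMat q u 0).updateCol (finSumFinEquiv (Sum.inr 2)) v := by
  ext i j
  obtain ⟨j, rfl⟩ := finSumFinEquiv.surjective j
  rcases j with j | j
  · rw [Matrix.updateCol_ne (finSumFinEquiv.injective.ne (by simp))]; simp [bigMat]
  · by_cases h : j = 2
    · subst h; simp [bigMat]
    · rw [Matrix.updateCol_ne (by simpa using h)]
      fin_cases j <;> simp [bigMat] at h ⊢

/-- The determinant as a bilinear form. -/
noncomputable def bigDet {d : ℕ} (q : Fin (d + 3) → Fin d → ℝ) :
    (Fin (d + 3) → ℝ) →ₗ[ℝ] (Fin (d + 3) → ℝ) →ₗ[ℝ] ℝ :=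
  LinearMap.mk₂ ℝ (fun u v => (bigMat q u v).det)
    (by intro u u' v
        rw [bigMat_update_u, Matrix.det_updateCol_add, ← bigMat_update_u, ← bigMat_update_u])
    (by intro c u v
        rw [bigMat_update_u, Matrix.det_updateCol_smul, ← bigMat_update_u, smul_eq_mul])
    (by intro u v v'
        rw [bigMat_update_v, Matrix.det_updateCol_add, ← bigMat_update_v, ← bigMat_update_v])
    (by intro c u v
        rw [bigMat_update_v, Matrix.det_updateCol_smul, ← bigMat_update_v, smul_eq_mul])

theorem bigDet_apply {d : ℕ} (q : Fin (d + 3) → Fin d → ℝ) (u v : Fin (d + 3) → ℝ) :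
    bigDet q u v = (bigMat q u v).det := rfl

theorem bigDet_self {d : ℕ} (q : Fin (d + 3) → Fin d → ℝ) (u : Fin (d + 3) → ℝ) :
    bigDet q u u = 0 := by
  rw [bigDet_apply]
  refine Matrix.det_zero_of_column_eq (i := finSumFinEquiv (Sum.inr 1))
    (j := finSumFinEquiv (Sum.inr 2)) (by simp) ?_
  intro i; simp [bigMat]

theorem bigDet_swap {d : ℕ} (q : Fin (d + 3) → Fin d → ℝ) (u v : Fin (d + 3) → ℝ) :
    bigDet q u v = - bigDet q v u := by
  have := bigDet_self q (u + v)
  simp only [map_add, LinearMap.add_apply, bigDet_self] at this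
  linarith

/-- column span of the matrix `[q | 1]` as a range. -/
def colComb {d : ℕ} (q : Fin (d + 3) → Fin d → ℝ) (c : Fin d → ℝ) (c0 : ℝ) : Fin (d + 3) → ℝ :=
  fun i => ∑ j, c j * q i j + c0

theorem bigDet_colComb {d : ℕ} (q : Fin (d + 3) → Fin d → ℝ) (c : Fin d → ℝ) (c0 : ℝ)
    (v : Fin (d + 3) → ℝ) : bigDet q (colComb q c c0) v = 0 := by
  have h : colComb q c c0 = ∑ j, c j • (fun i => q i j) + c0 • (fun _ => (1:ℝ)) := by
    funext i; simp [colComb, Finset.sum_apply]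
  have h1 : bigDet q (fun _ => (1:ℝ)) v = 0 := by
    rw [bigDet_apply]
    refine Matrix.det_zero_of_column_eq (i := finSumFinEquiv (Sum.inr 1))
      (j := finSumFinEquiv (Sum.inr 0)) (by simp) ?_
    intro i; simp [bigMat]
  have h2 : ∀ j, bigDet q (fun i => q i j) v = 0 := by
    intro j
    rw [bigDet_apply]
    refine Matrix.det_zero_of_column_eq (i := finSumFinEquiv (Sum.inr 1))
      (j := finSumFinEquiv (Sum.inl j)) (finSumFinEquiv.injective.ne (by simp)) ?_
    intro i; simp [bigMat]
  rw [h]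
  simp [map_add, map_sum, LinearMap.add_apply, LinearMap.sum_apply, h1, h2]

/-- Representation of the bilinear form through a Gale transform. -/
theorem bigDet_gale {d : ℕ} (q : Fin (d + 3) → Fin d → ℝ) (g0 g1 : Fin (d + 3) → ℝ)
    (hdec : ∀ u : Fin (d + 3) → ℝ, ∃ c c0, u = colComb q c c0 +
      (∑ i, g0 i * u i) • g0 + (∑ i, g1 i * u i) • g1) (u v : Fin (d + 3) → ℝ) :
    bigDet q u v = bigDet q g0 g1 *
      ((∑ i, g0 i * u i) * (∑ i, g1 i * v i) - (∑ i, g1 i * u i) * (∑ i, g0 i * v i)) := by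
  obtain ⟨c, c0, hu⟩ := hdec u
  obtain ⟨c', c0', hv⟩ := hdec v
  set a0 := ∑ i, g0 i * u i
  set a1 := ∑ i, g1 i * u i
  set b0 := ∑ i, g0 i * v i
  set b1 := ∑ i, g1 i * v i
  have hr : ∀ w, bigDet q w (colComb q c' c0') = 0 := fun w => by
    rw [bigDet_swap, bigDet_colComb, neg_zero]
  rw [hu, hv]
  simp only [map_add, LinearMap.add_apply, bigDet_colComb, hr, map_smul, LinearMap.smul_apply,
    bigDet_self, smul_eq_mul]
  rw [bigDet_swap q g1 g0]
  ring

theorem bigDet_single {d : ℕ} (q : Fin (d + 3) → Fin d → ℝ) (σ : Fin d ⊕ Fin 3 ≃ Fin (d + 3)) :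
    |bigDet q (Pi.single (σ (Sum.inr 1)) 1) (Pi.single (σ (Sum.inr 2)) 1)| =
      |(Matrix.of fun i j => q (σ (Sum.inl i)) j - q (σ (Sum.inr 0)) j).det| := by
  rw [bigDet_apply, ← Matrix.abs_det_submatrix_equiv_equiv σ finSumFinEquiv]
  set B := Matrix.submatrix (bigMat q (Pi.single (σ (Sum.inr 1)) 1) (Pi.single (σ (Sum.inr 2)) 1))
    σ finSumFinEquiv with hB
  have hD : IsUnit (!![1, 0, 0; 1, 1, 0; 1, 0, 1] : Matrix (Fin 3) (Fin 3) ℝ).det := by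
    simp [Matrix.det_fin_three]
  let : Invertible (!![1, 0, 0; 1, 1, 0; 1, 0, 1] : Matrix (Fin 3) (Fin 3) ℝ) :=
    Matrix.invertibleOfIsUnitDet _ hD
  have hinv : ⅟(!![1, 0, 0; 1, 1, 0; 1, 0, 1] : Matrix (Fin 3) (Fin 3) ℝ) =
      !![1, 0, 0; -1, 1, 0; -1, 0, 1] := by
    apply invOf_eq_right_inv
    ext i j; fin_cases i <;> fin_cases j <;> simp [Matrix.mul_apply, Fin.sum_univ_three]
  have hblk : B = Matrix.fromBlocks (Matrix.of fun i j => q (σ (Sum.inl i)) j)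
      (Matrix.of fun _ => ![1, 0, 0]) (Matrix.of fun k j => q (σ (Sum.inr k)) j)
      !![1, 0, 0; 1, 1, 0; 1, 0, 1] := by
    ext i j
    rcases i with i | i <;> rcases j with j | j
    · simp [hB, bigMat]
    · fin_cases j <;> simp [hB, bigMat, Pi.single_apply]
    · simp [hB, bigMat]
    · fin_cases i <;> fin_cases j <;> simp [hB, bigMat, Pi.single_apply]
  rw [hblk, Matrix.det_fromBlocks₂₂, hinv]
  have : (!![1, 0, 0; 1, 1, 0; 1, 0, 1] : Matrix (Fin 3) (Fin 3) ℝ).det = 1 := by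
    simp [Matrix.det_fin_three]
  rw [this, one_mul]
  congr 2
  ext i j
  simp [Matrix.mul_apply, Fin.sum_univ_three]


theorem exists_between_finsets (A B : Finset ℝ) (h : ∀ x ∈ A, ∀ y ∈ B, x ≤ y) :
    ∃ s, (∀ x ∈ A, x ≤ s) ∧ ∀ y ∈ B, s ≤ y := by
  by_cases hA : A.Nonempty
  · exact ⟨A.max' hA, fun x hx => A.le_max' x hx, fun y hy => h _ (A.max'_mem hA) y hy⟩
  · rw [Finset.not_nonempty_iff_eq_empty] at hA
    subst hA
    by_cases hB : B.Nonempty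
    · exact ⟨B.min' hB, by simp, fun y hy => B.min'_le y hy⟩
    · rw [Finset.not_nonempty_iff_eq_empty] at hB
      subst hB
      exact ⟨0, by simp, by simp⟩

/-- Linear programming step behind the regular triangulation. -/
theorem gale_cover {ι : Type*} [Fintype ι] (g0 g1 : ι → ℝ)
    (hg0 : ∑ i, g0 i = 0) (hg1 : ∑ i, g1 i = 0)
    (hg : ∀ x0 x1 : ℝ, x0 ^ 2 + x1 ^ 2 ≤ ∑ i, (g0 i * x0 + g1 i * x1) ^ 2)
    (l0 l1 : ℝ) (hl : 0 < l0 ^ 2 + l1 ^ 2)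
    (hgen : ∀ i, g0 i * l1 - g1 i * l0 = 0 → g0 i = 0 ∧ g1 i = 0)
    (lam : ι → ℝ) (hlam : ∀ i, 0 ≤ lam i) :
    ∃ x0 x1 : ℝ, ∃ a b : ι, (∀ i, 0 ≤ lam i + (g0 i * x0 + g1 i * x1)) ∧
      lam a + (g0 a * x0 + g1 a * x1) = 0 ∧ lam b + (g0 b * x0 + g1 b * x1) = 0 ∧
      0 < g0 a * l1 - g1 a * l0 ∧ 0 < l0 * g1 b - l1 * g0 b ∧ 0 < g0 a * g1 b - g1 a * g0 b := by
  classical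
  set K : Set (ℝ × ℝ) := {x | ∀ i, 0 ≤ lam i + (g0 i * x.1 + g1 i * x.2)} with hK
  have hKc : IsClosed K := by
    rw [hK, Set.ofPred_forall]
    exact isClosed_iInter fun i => isClosed_le continuous_const (by fun_prop)
  set S := ∑ i, lam i with hS
  have hbound : ∀ x ∈ K, x.1 ^ 2 + x.2 ^ 2 ≤ Fintype.card ι * S ^ 2 := by
    intro x hx
    have hsum : ∑ i, (lam i + (g0 i * x.1 + g1 i * x.2)) = S := by
      simp only [Finset.sum_add_distrib, ← Finset.sum_mul, hg0, hg1]; simp [hS]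
    have hle : ∀ i, lam i + (g0 i * x.1 + g1 i * x.2) ≤ S := by
      intro i; rw [← hsum]
      exact Finset.single_le_sum (f := fun i => lam i + (g0 i * x.1 + g1 i * x.2))
        (fun j _ => hx j) (Finset.mem_univ i)
    have hlle : ∀ i, lam i ≤ S := fun i =>
      Finset.single_le_sum (f := lam) (fun j _ => hlam j) (Finset.mem_univ i)
    refine (hg x.1 x.2).trans ?_
    calc ∑ i, (g0 i * x.1 + g1 i * x.2) ^ 2 ≤ ∑ i : ι, S ^ 2 := by
          refine Finset.sum_le_sum fun i _ => ?_
          have h1 := hx i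
          have h2 := hle i
          have h3 := hlle i
          have h4 := hlam i
          apply sq_le_sq'
          · linarith
          · linarith
      _ = _ := by simp
  have hKb : Bornology.IsBounded K := by
    rw [isBounded_iff_forall_norm_le]
    refine ⟨Fintype.card ι * S ^ 2 + 1, fun x hx => ?_⟩
    have h := hbound x hx
    rw [Prod.norm_def, max_le_iff, Real.norm_eq_abs, Real.norm_eq_abs]
    constructor <;> apply abs_le_of_sq_le_sq' _ _ |> abs_le.mpr <;> nlinarith [sq_nonneg x.1, sq_nonneg x.2]
  have hcomp : IsCompact K := Metric.isCompact_of_isClosed_isBounded hKc hKb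
  have h0 : (0 : ℝ × ℝ) ∈ K := fun i => by simpa using hlam i
  obtain ⟨x, hxK, hmin⟩ := hcomp.exists_isMinOn ⟨0, h0⟩
    (f := fun x : ℝ × ℝ => l0 * x.1 + l1 * x.2) (by fun_prop)
  by_contra hcon
  push Not at hcon
  have hcon' := hcon x.1 x.2
  let act : Finset ι := Finset.univ.filter fun i => lam i + (g0 i * x.1 + g1 i * x.2) = 0
  let rat : ι → ℝ := fun i => (g0 i * l0 + g1 i * l1) / (g0 i * l1 - g1 i * l0)
  obtain ⟨s, hsA, hsB⟩ := exists_between_finsets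
    ((act.filter fun i => 0 < g0 i * l1 - g1 i * l0).image rat)
    ((act.filter fun i => g0 i * l1 - g1 i * l0 < 0).image rat) (by
      intro y hy z hz
      simp only [Finset.mem_image, Finset.mem_filter, act, Finset.mem_univ, true_and] at hy hz
      obtain ⟨a, ⟨ha, ha'⟩, rfl⟩ := hy
      obtain ⟨b, ⟨hb, hb'⟩, rfl⟩ := hz
      have hw := hcon' a b hxK ha hb ha' (by linarith)
      simp only [rat]
      rw [← neg_div_neg_eq (g0 b * l0 + g1 b * l1), div_le_div_iff₀ ha' (by linarith)]
      nlinarith [mul_nonneg hl.le (neg_nonneg.mpr hw)])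
  have hdir : ∀ i ∈ act, 0 ≤ g0 i * (-l0 + s * l1) + g1 i * (-l1 - s * l0) := by
    intro i hi
    rcases lt_trichotomy (g0 i * l1 - g1 i * l0) 0 with h | h | h
    · have := hsB (rat i) (Finset.mem_image_of_mem _ (Finset.mem_filter.mpr ⟨hi, h⟩))
      simp only [rat] at this
      rw [le_div_iff_of_neg h] at this
      nlinarith
    · obtain ⟨h1, h2⟩ := hgen i h
      simp [h1, h2]
    · have := hsA (rat i) (Finset.mem_image_of_mem _ (Finset.mem_filter.mpr ⟨hi, h⟩))
      simp only [rat] at this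
      rw [div_le_iff₀ h] at this
      nlinarith
  have hev : ∀ᶠ t in nhdsWithin (0:ℝ) (Set.Ioi 0), ∀ i, 0 ≤ lam i +
      (g0 i * (x.1 + t * (-l0 + s * l1)) + g1 i * (x.2 + t * (-l1 - s * l0))) := by
    rw [Filter.eventually_all]
    intro i
    by_cases hi : i ∈ act
    · filter_upwards [self_mem_nhdsWithin] with t ht
      have h1 := hdir i hi
      have h2 : lam i + (g0 i * x.1 + g1 i * x.2) = 0 := (Finset.mem_filter.mp hi).2
      have h3 := mul_nonneg (le_of_lt (Set.mem_Ioi.mp ht)) h1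
      nlinarith
    · have h2 : lam i + (g0 i * x.1 + g1 i * x.2) ≠ 0 := fun h =>
        hi (Finset.mem_filter.mpr ⟨Finset.mem_univ _, h⟩)
      have h3 : 0 < lam i + (g0 i * x.1 + g1 i * x.2) := lt_of_le_of_ne (hxK i) h2.symm
      have hc : Continuous fun t : ℝ => lam i +
        (g0 i * (x.1 + t * (-l0 + s * l1)) + g1 i * (x.2 + t * (-l1 - s * l0))) := by fun_prop
      have := (hc.continuousAt (x := (0:ℝ))).eventually_const_lt (u := 0) (by simpa using h3)
      exact (this.filter_mono nhdsWithin_le_nhds).mono fun t ht => ht.le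
  obtain ⟨t, ht, htpos⟩ := (hev.and self_mem_nhdsWithin).exists
  have htpos : 0 < t := htpos
  have := hmin (show (x.1 + t * (-l0 + s * l1), x.2 + t * (-l1 - s * l0)) ∈ K from ht)
  simp only [Set.mem_ofPred_eq] at this
  nlinarith [mul_pos htpos hl]


theorem convexHull_range_sub {d n : ℕ} (q : Fin n → Fin d → ℝ) :
    convexHull ℝ (Set.range q) ⊆ {y | ∃ μ : Fin n → ℝ, (∀ i, 0 ≤ μ i) ∧ ∑ i, μ i = 1 ∧
      y = ∑ i, μ i • q i} := by
  refine convexHull_min ?_ ?_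
  · rintro _ ⟨i, rfl⟩
    refine ⟨Pi.single i 1, fun j => ?_, by simp, ?_⟩
    · by_cases h : j = i
      · subst h; simp
      · simp [h]
    · rw [Finset.sum_eq_single i] <;> simp +contextual
  · rintro x ⟨μ, h1, h2, rfl⟩ y ⟨ν, h3, h4, rfl⟩ a b ha hb hab
    refine ⟨fun i => a * μ i + b * ν i, fun i => ?_, ?_, ?_⟩
    · have := h1 i; have := h3 i; positivity
    · rw [Finset.sum_add_distrib, ← Finset.mul_sum, ← Finset.mul_sum, h2, h4]; linarith
    · rw [Finset.smul_sum, Finset.smul_sum, ← Finset.sum_add_distrib]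
      exact Finset.sum_congr rfl fun i _ => by rw [add_smul, mul_smul, mul_smul]

theorem exists_sigma {d : ℕ} (a b : Fin (d + 3)) (hab : a ≠ b) :
    ∃ σ : Fin d ⊕ Fin 3 ≃ Fin (d + 3), σ (Sum.inr 1) = a ∧ σ (Sum.inr 2) = b := by
  let e : Fin d ⊕ Fin 3 ≃ Fin (d + 3) := finSumFinEquiv
  let e1 := e.trans (Equiv.swap (e (Sum.inr 1)) a)
  have h1 : e1 (Sum.inr 1) = a := by simp [e1]
  refine ⟨e1.trans (Equiv.swap (e1 (Sum.inr 2)) b), ?_, by simp⟩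
  rw [Equiv.trans_apply, h1, Equiv.swap_apply_of_ne_of_ne _ hab]
  intro h
  rw [← h1] at h
  have := e1.injective h
  simp at this

theorem face_volume {d : ℕ} (hd : 0 < d) (q : Fin (d + 3) → Fin d → ℝ) (a b : Fin (d + 3))
    (hab : a ≠ b) :
    volume {y : Fin d → ℝ | ∃ μ : Fin (d + 3) → ℝ, (∀ i, 0 ≤ μ i) ∧ ∑ i, μ i = 1 ∧
      μ a = 0 ∧ μ b = 0 ∧ y = ∑ i, μ i • q i} ≤
    ENNReal.ofReal (|bigDet q (Pi.single a 1) (Pi.single b 1)| / d.factorial) := by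
  obtain ⟨σ, rfl, rfl⟩ := exists_sigma a b hab
  rw [bigDet_single]
  refine simplex_volume d hd (q (σ (Sum.inr 0))) (fun i => q (σ (Sum.inl i))) _ ?_
  rintro y ⟨μ, h0, h1, ha, hb, rfl⟩
  rw [← σ.sum_comp, Fintype.sum_sum_type, Fin.sum_univ_three, ha, hb] at h1
  refine ⟨fun i => μ (σ (Sum.inl i)), fun i => h0 _, ?_, ?_⟩
  · have := h0 (σ (Sum.inr 0)); linarith
  · rw [← σ.sum_comp, Fintype.sum_sum_type, Fin.sum_univ_three, ha, hb]
    have h2 : μ (σ (Sum.inr 0)) = 1 - ∑ i, μ (σ (Sum.inl i)) := by linarith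
    simp only [smul_sub, Finset.sum_sub_distrib, ← Finset.sum_smul, h2, zero_smul, sub_smul, one_smul]
    abel

/-- Volume bound through the regular triangulation given by a generic vector `l`. -/
theorem volume_bound {d : ℕ} (hd : 0 < d) (q : Fin (d + 3) → Fin d → ℝ) (g0 g1 : Fin (d + 3) → ℝ)
    (hdec : ∀ u : Fin (d + 3) → ℝ, ∃ c c0, u = colComb q c c0 +
      (∑ i, g0 i * u i) • g0 + (∑ i, g1 i * u i) • g1)
    (hg0 : ∑ i, g0 i = 0) (hg1 : ∑ i, g1 i = 0)
    (hq0 : ∑ i, g0 i • q i = 0) (hq1 : ∑ i, g1 i • q i = 0)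
    (hg : ∀ x0 x1 : ℝ, x0 ^ 2 + x1 ^ 2 ≤ ∑ i, (g0 i * x0 + g1 i * x1) ^ 2)
    (l0 l1 : ℝ) (hl : 0 < l0 ^ 2 + l1 ^ 2)
    (hgen : ∀ i, g0 i * l1 - g1 i * l0 = 0 → g0 i = 0 ∧ g1 i = 0) :
    (volume (convexHull ℝ (Set.range q))).toReal * d.factorial ≤ |bigDet q g0 g1| *
      ∑ a, ∑ b, (if 0 < g0 a * l1 - g1 a * l0 ∧ 0 < l0 * g1 b - l1 * g0 b ∧
        0 < g0 a * g1 b - g1 a * g0 b then g0 a * g1 b - g1 a * g0 b else 0) := by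
  classical
  let F : Fin (d + 3) × Fin (d + 3) → Set (Fin d → ℝ) := fun ab =>
    {y : Fin d → ℝ | ∃ μ : Fin (d + 3) → ℝ, (∀ i, 0 ≤ μ i) ∧ ∑ i, μ i = 1 ∧
      μ ab.1 = 0 ∧ μ ab.2 = 0 ∧ y = ∑ i, μ i • q i}
  let P : Finset (Fin (d + 3) × Fin (d + 3)) := Finset.univ.filter fun ab =>
    0 < g0 ab.1 * l1 - g1 ab.1 * l0 ∧ 0 < l0 * g1 ab.2 - l1 * g0 ab.2 ∧
        0 < g0 ab.1 * g1 ab.2 - g1 ab.1 * g0 ab.2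
  have hcov : convexHull ℝ (Set.range q) ⊆ ⋃ ab ∈ P, F ab := by
    intro y hy
    obtain ⟨lam, h1, h2, rfl⟩ := convexHull_range_sub q hy
    obtain ⟨x0, x1, a, b, hpos, ha, hb, hc⟩ := gale_cover g0 g1 hg0 hg1 hg l0 l1 hl hgen lam h1
    simp only [Set.mem_iUnion]
    refine ⟨(a, b), Finset.mem_filter.mpr ⟨Finset.mem_univ _, hc⟩, fun i => lam i + (g0 i * x0 + g1 i * x1), hpos, ?_, ha, hb, ?_⟩
    · simp only [Finset.sum_add_distrib, ← Finset.sum_mul, hg0, hg1, h2]; ring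
    · have e0 : ∑ i, (g0 i * x0) • q i = 0 := by
        simp only [mul_comm _ x0, mul_smul, ← Finset.smul_sum, hq0, smul_zero]
      have e1 : ∑ i, (g1 i * x1) • q i = 0 := by
        simp only [mul_comm _ x1, mul_smul, ← Finset.smul_sum, hq1, smul_zero]
      simp only [add_smul, Finset.sum_add_distrib, e0, e1, add_zero]
  have hvol : ∀ ab ∈ P, volume (F ab) ≤ ENNReal.ofReal (|bigDet q g0 g1| *
      (g0 ab.1 * g1 ab.2 - g1 ab.1 * g0 ab.2) / d.factorial) := by
    rintro ⟨a, b⟩ hab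
    have hw : 0 < g0 a * g1 b - g1 a * g0 b := (Finset.mem_filter.mp hab).2.2.2
    have hne : a ≠ b := by
      rintro rfl
      have : g0 a * g1 a - g1 a * g0 a = 0 := by ring
      linarith
    refine (face_volume hd q a b hne).trans (le_of_eq ?_)
    rw [bigDet_gale q g0 g1 hdec, abs_mul]
    congr 3
    simp only [Pi.single_apply, mul_ite, mul_one, mul_zero, Finset.sum_ite_eq', Finset.mem_univ, if_true]
    exact abs_of_pos hw
  have hnn : ∀ ab ∈ P, 0 ≤ |bigDet q g0 g1| *
      (g0 ab.1 * g1 ab.2 - g1 ab.1 * g0 ab.2) / d.factorial := by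
    rintro ⟨a, b⟩ hab
    have hw : 0 < g0 a * g1 b - g1 a * g0 b := (Finset.mem_filter.mp hab).2.2.2
    positivity
  have h1 : volume (convexHull ℝ (Set.range q)) ≤ ENNReal.ofReal (∑ ab ∈ P, |bigDet q g0 g1| *
      (g0 ab.1 * g1 ab.2 - g1 ab.1 * g0 ab.2) / d.factorial) := by
    rw [ENNReal.ofReal_sum_of_nonneg hnn]
    exact (measure_mono hcov).trans ((measure_biUnion_finset_le _ _).trans
      (Finset.sum_le_sum hvol))
  have h2 := ENNReal.toReal_le_of_le_ofReal (Finset.sum_nonneg hnn) h1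
  have hf : (0:ℝ) < d.factorial := by positivity
  rw [← Finset.sum_div, ← Finset.mul_sum, le_div_iff₀ hf] at h2
  refine h2.trans (le_of_eq ?_)
  rw [Finset.sum_filter, Fintype.sum_prod_type]


theorem hyperplane_null {d : ℕ} (c : Fin d → ℝ) (c0 : ℝ) (hc : c ≠ 0) :
    volume {y : Fin d → ℝ | ∑ j, c j * y j + c0 = 0} = 0 := by
  let f : (Fin d → ℝ) →ₗ[ℝ] ℝ := ∑ j, c j • LinearMap.proj j
  have hf : ∀ y, f y = ∑ j, c j * y j := by intro y; simp [f, LinearMap.sum_apply]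
  by_cases hne : ∃ y0 : Fin d → ℝ, ∑ j, c j * y0 j + c0 = 0
  · obtain ⟨y0, hy0⟩ := hne
    have hsub : {y : Fin d → ℝ | ∑ j, c j * y j + c0 = 0} =
        (fun y => -y0 + y) ⁻¹' (LinearMap.ker f : Set (Fin d → ℝ)) := by
      ext y
      simp only [Set.mem_ofPred_eq, Set.mem_preimage, SetLike.mem_coe, LinearMap.mem_ker]
      rw [map_add, map_neg, hf, hf]
      constructor <;> intro h <;> linarith
    rw [hsub, measure_preimage_add]
    apply Measure.addHaar_submodule
    intro htop
    apply hc
    funext j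
    have : f (Pi.single j 1) = 0 := by
      have : Pi.single j 1 ∈ LinearMap.ker f := by rw [htop]; trivial
      exact this
    rw [hf] at this
    simpa [Pi.single_apply] using this
  · have : {y : Fin d → ℝ | ∑ j, c j * y j + c0 = 0} = ∅ := by
      ext y; simp only [Set.mem_ofPred_eq, Set.mem_empty_iff_false, iff_false]
      exact fun h => hne ⟨y, h⟩
    rw [this, measure_empty]

theorem degenerate_volume {d : ℕ} (q : Fin (d + 3) → Fin d → ℝ) (c : Fin d → ℝ) (c0 : ℝ)
    (hc : ¬ (c = 0 ∧ c0 = 0)) (h : colComb q c c0 = 0) :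
    volume (convexHull ℝ (Set.range q)) = 0 := by
  have hi : ∀ i, ∑ j, c j * q i j + c0 = 0 := fun i => congrFun h i
  have hc' : c ≠ 0 := by
    rintro rfl
    have := hi 0
    simp at this
    exact hc ⟨rfl, this⟩
  refine measure_mono_null (convexHull_min ?_ ?_) (hyperplane_null c c0 hc')
  · rintro _ ⟨i, rfl⟩; exact hi i
  · intro x hx y hy a b ha hb hab
    simp only [Set.mem_ofPred_eq] at hx hy ⊢
    have : ∑ j, c j * (a • x + b • y) j + c0 = a * (∑ j, c j * x j + c0) +
        b * (∑ j, c j * y j + c0) := by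
      simp only [mul_add, Finset.mul_sum, Pi.add_apply, Pi.smul_apply, smul_eq_mul,
        Finset.sum_add_distrib]
      have h1 : ∑ j, c j * (a * x j) = ∑ j, a * (c j * x j) :=
        Finset.sum_congr rfl fun j _ => by ring
      have h2 : ∑ j, c j * (b * y j) = ∑ j, b * (c j * y j) :=
        Finset.sum_congr rfl fun j _ => by ring
      rw [h1, h2]
      linear_combination (-c0) * hab
    rw [this, hx, hy]; ring

theorem exists_gale {d : ℕ} (q : Fin (d + 3) → Fin d → ℝ)
    (hnd : ∀ c c0, colComb q c c0 = 0 → c = 0 ∧ c0 = 0) :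
    ∃ g0 g1 : Fin (d + 3) → ℝ,
      (∀ u : Fin (d + 3) → ℝ, ∃ c c0, u = colComb q c c0 +
        (∑ i, g0 i * u i) • g0 + (∑ i, g1 i * u i) • g1) ∧
      (∑ i, g0 i = 0) ∧ (∑ i, g1 i = 0) ∧ (∑ i, g0 i • q i = 0) ∧ (∑ i, g1 i • q i = 0) ∧
      (∑ i, g0 i ^ 2 = 1) ∧ (∑ i, g1 i ^ 2 = 1) ∧ (∑ i, g0 i * g1 i = 0) := by
  let W := EuclideanSpace ℝ (Fin (d + 3))
  let M : ((Fin d → ℝ) × ℝ) →ₗ[ℝ] W :=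
    { toFun := fun c => WithLp.toLp 2 (colComb q c.1 c.2)
      map_add' := by
        intro x y
        rw [← WithLp.toLp_add]
        congr 1
        funext i
        simp [colComb, add_mul, Finset.sum_add_distrib]; ring
      map_smul' := by
        intro a x
        rw [RingHom.id_apply, ← WithLp.toLp_smul]
        congr 1
        funext i
        simp [colComb, mul_add, Finset.mul_sum, mul_assoc] }
  have hMa : ∀ c c0, M (c, c0) = WithLp.toLp 2 (colComb q c c0) := fun _ _ => rfl
  have hinj : Function.Injective M := by
    rw [← LinearMap.ker_eq_bot, LinearMap.ker_eq_bot']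
    rintro ⟨c, c0⟩ h
    rw [hMa, WithLp.toLp_eq_zero] at h
    obtain ⟨h1, h2⟩ := hnd c c0 h
    rw [h1, h2]; rfl
  let R := LinearMap.range M
  have hR : Module.finrank ℝ R = d + 1 := by
    rw [LinearMap.finrank_range_of_inj hinj]; simp
  have hRo : Module.finrank ℝ Rᗮ = 2 := by
    have := Submodule.finrank_add_finrank_orthogonal R
    rw [hR, finrank_euclideanSpace, Fintype.card_fin] at this
    omega
  let b : OrthonormalBasis (Fin 2) ℝ Rᗮ := (stdOrthonormalBasis ℝ Rᗮ).reindex (finCongr hRo)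
  have hinner : ∀ x y : W, inner ℝ x y = ∑ i, x i * y i := by
    intro x y
    rw [PiLp.inner_apply]
    exact Finset.sum_congr rfl fun i _ => by simp [mul_comm]
  have horth : ∀ k, ∀ c c0, ∑ i, (b k : W) i * colComb q c c0 i = 0 := by
    intro k c c0
    have := (b k).2
    rw [Submodule.mem_orthogonal'] at this
    have := this (M (c, c0)) ⟨_, rfl⟩
    rwa [hinner] at this
  have h1 : ∀ k, ∑ i, (b k : W) i = 0 := by
    intro k
    have := horth k 0 1
    simpa [colComb] using this
  have h2 : ∀ k, ∑ i, (b k : W) i • q i = 0 := by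
    intro k
    funext j
    have := horth k (Pi.single j 1) 0
    simpa [colComb, Pi.single_apply, Finset.sum_apply] using this
  have h3 : ∀ k l, ∑ i, (b k : W) i * (b l : W) i = if k = l then 1 else 0 := by
    intro k l
    have := orthonormal_iff_ite.mp b.orthonormal k l
    rwa [Submodule.coe_inner, hinner] at this
  refine ⟨fun i => (b 0 : W) i, fun i => (b 1 : W) i, ?_, h1 0, h1 1, h2 0, h2 1, ?_, ?_, ?_⟩
  · intro u
    let u' : W := WithLp.toLp 2 u
    have hdec := Submodule.starProjection_add_starProjection_orthogonal (K := R) u'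
    obtain ⟨⟨c, c0⟩, hc⟩ : R.starProjection u' ∈ R := Submodule.starProjection_apply_mem _ _
    refine ⟨c, c0, ?_⟩
    have hp : Rᗮ.starProjection u' = ∑ k, (∑ i, (b k : W) i * u i) • (b k : W) := by
      have := b.sum_repr' (Rᗮ.orthogonalProjectionOnto u')
      rw [Submodule.starProjection_apply, ← this]
      rw [Submodule.coe_sum]
      refine Finset.sum_congr rfl fun k _ => ?_
      rw [Submodule.coe_smul]
      congr 1
      rw [Submodule.coe_inner, ← Submodule.starProjection_apply,
        ← Submodule.inner_starProjection_left_eq_right,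
        Submodule.starProjection_eq_self_iff.mpr (b k).2, hinner]
    rw [hp, Fin.sum_univ_two, ← hc, hMa] at hdec
    funext i
    have := congrArg (fun w : W => w i) hdec
    simp only at this
    simp only [Pi.add_apply, Pi.smul_apply]
    rw [add_assoc]
    exact this.symm
  · have := h3 0 0; simpa [pow_two] using this
  · have := h3 1 1; simpa [pow_two] using this
  · have := h3 0 1; simpa using this


theorem sum_split {d : ℕ} (f : Fin (d + 3) → ℝ) :
    ∑ j, f j = ∑ j : Fin d, f (finSumFinEquiv (Sum.inl j)) + (f (finSumFinEquiv (Sum.inr 0)) +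
      f (finSumFinEquiv (Sum.inr 1)) + f (finSumFinEquiv (Sum.inr 2))) := by
  rw [← (finSumFinEquiv (m := d) (n := 3)).sum_comp, Fintype.sum_sum_type, Fin.sum_univ_three]

theorem prod_split {d : ℕ} (f : Fin (d + 3) → ℝ) :
    ∏ j, f j = (∏ j : Fin d, f (finSumFinEquiv (Sum.inl j))) * (f (finSumFinEquiv (Sum.inr 0)) *
      f (finSumFinEquiv (Sum.inr 1)) * f (finSumFinEquiv (Sum.inr 2))) := by
  rw [← (finSumFinEquiv (m := d) (n := 3)).prod_comp, Fintype.prod_sum_type, Fin.prod_univ_three]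

theorem kappa_bound {d : ℕ} (hd : 0 < d) (q : Fin (d + 3) → Fin d → ℝ)
    (hq : ∀ i, ∑ j, q i j ^ 2 = 1) (g0 g1 : Fin (d + 3) → ℝ)
    (h0 : ∑ i, g0 i ^ 2 = 1) (h1 : ∑ i, g1 i ^ 2 = 1) :
    bigDet q g0 g1 ^ 2 * ((1 / d) * (((d:ℝ) + 3) / d) ^ 2) ≤ (((d:ℝ) + 3) / d) ^ (d + 3) := by
  have hd' : (0:ℝ) < d := by exact_mod_cast hd
  set c := √(1 / (d:ℝ)) with hc
  set s := √(((d:ℝ) + 3) / d) with hs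
  have hc2 : c ^ 2 = 1 / d := Real.sq_sqrt (by positivity)
  have hs2 : s ^ 2 = ((d:ℝ) + 3) / d := Real.sq_sqrt (by positivity)
  set w : Fin (d + 3) → ℝ := fun j => Sum.elim (fun _ : Fin d => (1:ℝ)) ![c, s, s]
    (finSumFinEquiv.symm j) with hw
  have hprod : ∏ j, w j = c * s * s := by
    rw [prod_split]; simp [hw]
  have key := det_sq_le_frob (n := d + 3) (by omega) (bigMat q g0 g1 * Matrix.diagonal w)
  rw [Matrix.det_mul, Matrix.det_diagonal, hprod] at key
  have hfrob : ∑ i, ∑ j, (bigMat q g0 g1 * Matrix.diagonal w) i j ^ 2 =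
      ((d:ℝ) + 3) * (((d:ℝ) + 3) / d) := by
    have hrow : ∀ i, ∑ j, (bigMat q g0 g1 * Matrix.diagonal w) i j ^ 2 =
        1 + c ^ 2 + s ^ 2 * g0 i ^ 2 + s ^ 2 * g1 i ^ 2 := by
      intro i
      rw [sum_split]
      simp only [Matrix.mul_diagonal, bigMat, hw, Matrix.of_apply, Equiv.symm_apply_apply,
        Sum.elim_inl, Sum.elim_inr, mul_one, hq]
      simp
      ring
    simp only [hrow, Finset.sum_add_distrib, ← Finset.mul_sum, h0, h1]
    simp [hc2, hs2]
    field_simp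
    ring
  rw [hfrob] at key
  push_cast at key
  have e1 : ((d:ℝ) + 3) * (((d:ℝ) + 3) / d) / ((d:ℝ) + 3) = ((d:ℝ) + 3) / d := by
    field_simp
  rw [e1] at key
  rw [bigDet_apply]
  refine le_trans (le_of_eq ?_) key
  rw [← hc2, ← hs2]; ring

/-- Matrix with the class indicator columns. -/
def classMat {d : ℕ} (q : Fin (d + 3) → Fin d → ℝ) (cls : Fin (d + 3) → Fin 3) :
    Matrix (Fin (d + 3)) (Fin (d + 3)) ℝ :=
  Matrix.of fun i j => Sum.elim (q i) (fun k => if cls i = k then 1 else 0) (finSumFinEquiv.symm j)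

theorem bigDet_class {d : ℕ} (q : Fin (d + 3) → Fin d → ℝ) (cls : Fin (d + 3) → Fin 3) :
    bigDet q (fun i => if cls i = 1 then 1 else 0) (fun i => if cls i = 2 then 1 else 0) =
      (classMat q cls).det := by
  set u : Fin (d + 3) → ℝ := fun i => if cls i = 1 then 1 else 0 with hu
  set v : Fin (d + 3) → ℝ := fun i => if cls i = 2 then 1 else 0 with hv
  rw [bigDet_apply]
  let j0 : Fin (d + 3) := finSumFinEquiv (Sum.inr 0)
  let j1 : Fin (d + 3) := finSumFinEquiv (Sum.inr 1)
  let j2 : Fin (d + 3) := finSumFinEquiv (Sum.inr 2)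
  have h01 : j0 ≠ j1 := finSumFinEquiv.injective.ne (by simp)
  have h02 : j0 ≠ j2 := finSumFinEquiv.injective.ne (by simp)
  rw [← Matrix.det_updateCol_add_smul_self (bigMat q u v) h01 (-1)]
  rw [← Matrix.det_updateCol_add_smul_self _ h02 (-1)]
  congr 1
  ext i j
  obtain ⟨j, rfl⟩ := finSumFinEquiv.surjective j
  by_cases hj : finSumFinEquiv j = j0
  · have : j = Sum.inr 0 := finSumFinEquiv.injective hj
    subst this
    show Matrix.updateCol _ j0 _ i j0 = _
    rw [Matrix.updateCol_self, Matrix.updateCol_self, Matrix.updateCol_ne h02.symm]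
    simp only [bigMat, classMat, Matrix.of_apply, j0, j1, j2, Equiv.symm_apply_apply, Sum.elim_inr, hu, hv]
    generalize cls i = k
    fin_cases k <;> simp
  · rw [Matrix.updateCol_ne hj, Matrix.updateCol_ne hj]
    rcases j with j | j
    · simp [bigMat, classMat]
    · fin_cases j
      · exact absurd rfl hj
      · simp [bigMat, classMat, hu]
      · simp [bigMat, classMat, hv]

theorem class_bound {d : ℕ} (q : Fin (d + 3) → Fin d → ℝ)
    (hq : ∀ i, ∑ j, q i j ^ 2 = 1) (cls : Fin (d + 3) → Fin 3) (x y : Fin 3 → ℝ)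
    (hx : ∀ k, 0 < x k) (hy : ∀ k, 0 < y k) (hxy : ∀ k, x k ^ 2 + y k ^ 2 = 1) (K : Fin 3 → ℕ)
    (hK : ∀ k, (Finset.univ.filter fun i => cls i = k).card = K k + 1) :
    |bigDet q (fun i => if cls i = 1 then 1 else 0) (fun i => if cls i = 2 then 1 else 0)| *
      ∏ k, (x k ^ K k * y k) ≤ 1 := by
  rw [bigDet_class]
  set w : Fin (d + 3) → ℝ := fun j => Sum.elim (fun _ : Fin d => (1:ℝ)) (fun k => y k / x k)
    (finSumFinEquiv.symm j) with hw
  set B := Matrix.diagonal (fun i => x (cls i)) * classMat q cls * Matrix.diagonal w with hB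
  have hrow : ∀ i, ∑ j, B i j ^ 2 = 1 := by
    intro i
    rw [← hxy (cls i), ← mul_one (x (cls i) ^ 2), ← hq i, sum_split, Finset.mul_sum]
    simp only [hB, Matrix.mul_diagonal, Matrix.diagonal_mul, classMat, hw, Matrix.of_apply,
      Equiv.symm_apply_apply, Sum.elim_inl, Sum.elim_inr, mul_one, mul_pow]
    congr 1
    have h0 := (hx 0).ne'
    have h1 := (hx 1).ne'
    have h2 := (hx 2).ne'
    generalize cls i = k at *
    fin_cases k <;> simp <;> field_simp
  have key := det_sq_le_frob (n := d + 3) (by omega) B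
  simp only [hrow, Finset.sum_const, Finset.card_univ, Fintype.card_fin, nsmul_eq_mul, mul_one] at key
  rw [div_self (by positivity), one_pow, sq_le_one_iff_abs_le_one] at key
  refine le_trans (le_of_eq ?_) key
  rw [hB, Matrix.det_mul, Matrix.det_mul, Matrix.det_diagonal, Matrix.det_diagonal, abs_mul, abs_mul]
  have hwp : ∏ j, w j = ∏ k, y k / x k := by
    rw [prod_split, Fin.prod_univ_three]; simp [hw]
  have hxp : ∏ i, x (cls i) = ∏ k, x k ^ (K k + 1) := by
    rw [← Finset.prod_fiberwise Finset.univ cls]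
    refine Finset.prod_congr rfl fun k _ => ?_
    rw [Finset.prod_congr rfl (g := fun _ => x k), Finset.prod_const, hK]
    intro i hi
    rw [(Finset.mem_filter.mp hi).2]
  rw [hwp, hxp, abs_of_pos (Finset.prod_pos fun k _ => pow_pos (hx k) _),
    abs_of_pos (Finset.prod_pos fun k _ => div_pos (hy k) (hx k)), mul_comm (∏ k, x k ^ (K k + 1)),
    mul_assoc, ← Finset.prod_mul_distrib]
  congr 1
  refine Finset.prod_congr rfl fun k _ => ?_
  have := (hx k).ne'
  field_simp
  ring


/-- Five of the vectors form a pentagonal star (winding number two). -/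
def StarData {ι : Type*} (g0 g1 : ι → ℝ) : Prop :=
  ∃ (e : Fin 5 → ι) (v : Fin 6 → ℝ), Function.Injective e ∧
    (∀ j : Fin 5, g0 (e j) = √(g0 (e j) ^ 2 + g1 (e j) ^ 2) * cos (v j.castSucc) ∧
      g1 (e j) = √(g0 (e j) ^ 2 + g1 (e j) ^ 2) * sin (v j.castSucc)) ∧
    (∀ j : Fin 5, 0 ≤ v j.succ - v j.castSucc ∧ v j.succ - v j.castSucc ≤ π) ∧
    v 5 = v 0 + 4 * π

theorem sin_nonneg_le_pi {x : ℝ} (h0 : 0 < x) (h2 : x < 2 * π) (hs : 0 ≤ sin x) : x ≤ π := by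
  by_contra h
  push Not at h
  have : sin (x - π) > 0 := sin_pos_of_pos_of_lt_pi (by linarith) (by linarith)
  rw [sin_sub_pi] at this
  linarith

theorem star_of_angles {ι : Type*} (g0 g1 : ι → ℝ) (φ : ι → ℝ) (lam : ℝ)
    (hφ : ∀ i, g0 i = √(g0 i ^ 2 + g1 i ^ 2) * cos (φ i + lam) ∧
      g1 i = √(g0 i ^ 2 + g1 i ^ 2) * sin (φ i + lam))
    (hne : ∀ i, 0 < φ i ∨ φ i < 0 → 0 < √(g0 i ^ 2 + g1 i ^ 2))
    (x a1 b2 a2 b1 : ι) (hx : -(π / 2) < φ x) (hx' : φ x < 0)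
    (ha1 : 0 < φ a1) (ha1' : φ a1 < π) (ha2 : 0 < φ a2) (ha2' : φ a2 < π)
    (hb1 : -π < φ b1) (hb1' : φ b1 < 0) (hb2 : -π < φ b2) (hb2' : φ b2 < 0)
    (hinj : Function.Injective ![x, a1, b2, a2, b1])
    (h1 : 0 ≤ g0 x * g1 a1 - g1 x * g0 a1) (h2 : 0 ≤ g0 a1 * g1 b2 - g1 a1 * g0 b2)
    (h3 : 0 ≤ g0 b2 * g1 a2 - g1 b2 * g0 a2) (h4 : 0 ≤ g0 a2 * g1 b1 - g1 a2 * g0 b1)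
    (h5 : 0 ≤ g0 b1 * g1 x - g1 b1 * g0 x) : StarData g0 g1 := by
  have hpi := pi_pos
  have hw : ∀ i j, 0 < φ i ∨ φ i < 0 → 0 < φ j ∨ φ j < 0 →
      0 ≤ g0 i * g1 j - g1 i * g0 j → 0 ≤ sin (φ j - φ i) := by
    intro i j hi hj h
    have hi' := hne i hi
    have hj' := hne j hj
    have : g0 i * g1 j - g1 i * g0 j =
        (√(g0 i ^ 2 + g1 i ^ 2) * √(g0 j ^ 2 + g1 j ^ 2)) * sin (φ j - φ i) := by
      have e : φ j - φ i = (φ j + lam) - (φ i + lam) := by ring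
      rw [e, sin_sub]
      rw [mul_sub]
      nth_rewrite 1 [(hφ i).1, (hφ j).2]
      nth_rewrite 2 [(hφ i).2, (hφ j).1]
      ring
    rw [this] at h
    exact nonneg_of_mul_nonneg_right h (mul_pos hi' hj')
  have s1 := hw _ _ (Or.inr hx') (Or.inl ha1) h1
  have s2 := hw _ _ (Or.inl ha1) (Or.inr hb2') h2
  have s3 := hw _ _ (Or.inr hb2') (Or.inl ha2) h3
  have s4 := hw _ _ (Or.inl ha2) (Or.inr hb1') h4
  have s5 := hw _ _ (Or.inr hb1') (Or.inr hx') h5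
  have t1 := sin_nonneg_le_pi (by linarith) (by linarith) s1
  rw [← sin_add_two_pi] at s2 s4
  have t2 := sin_nonneg_le_pi (by linarith) (by linarith) s2
  have t3 := sin_nonneg_le_pi (by linarith) (by linarith) s3
  have t4 := sin_nonneg_le_pi (by linarith) (by linarith) s4
  have t5 : 0 ≤ φ x - φ b1 := by
    by_contra h
    push Not at h
    have := sin_neg_of_neg_of_neg_pi_lt h (by linarith)
    linarith
  have c1 : ∀ y : ℝ, cos (y + 2 * π + lam) = cos (y + lam) := fun y => by
    rw [show y + 2 * π + lam = (y + lam) + 2 * π by ring, cos_add_two_pi]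
  have c2 : ∀ y : ℝ, sin (y + 2 * π + lam) = sin (y + lam) := fun y => by
    rw [show y + 2 * π + lam = (y + lam) + 2 * π by ring, sin_add_two_pi]
  have c3 : ∀ y : ℝ, cos (y + 4 * π + lam) = cos (y + lam) := fun y => by
    rw [show y + 4 * π + lam = ((y + lam) + 2 * π) + 2 * π by ring, cos_add_two_pi, cos_add_two_pi]
  have c4 : ∀ y : ℝ, sin (y + 4 * π + lam) = sin (y + lam) := fun y => by
    rw [show y + 4 * π + lam = ((y + lam) + 2 * π) + 2 * π by ring, sin_add_two_pi, sin_add_two_pi]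
  refine ⟨![x, a1, b2, a2, b1], ![φ x + lam, φ a1 + lam, φ b2 + 2 * π + lam, φ a2 + 2 * π + lam,
    φ b1 + 4 * π + lam, φ x + 4 * π + lam], hinj, ?_, ?_, ?_⟩
  · intro j
    fin_cases j
    · exact hφ x
    · exact hφ a1
    · have := hφ b2; rw [← c1, ← c2] at this; exact this
    · have := hφ a2; rw [← c1, ← c2] at this; exact this
    · have := hφ b1; rw [← c3, ← c4] at this; exact this
  · intro j
    fin_cases j
    · show 0 ≤ (φ a1 + lam) - (φ x + lam) ∧ (φ a1 + lam) - (φ x + lam) ≤ π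
      constructor <;> linarith
    · show 0 ≤ (φ b2 + 2 * π + lam) - (φ a1 + lam) ∧ (φ b2 + 2 * π + lam) - (φ a1 + lam) ≤ π
      constructor <;> linarith
    · show 0 ≤ (φ a2 + 2 * π + lam) - (φ b2 + 2 * π + lam) ∧ (φ a2 + 2 * π + lam) - (φ b2 + 2 * π + lam) ≤ π
      constructor <;> linarith
    · show 0 ≤ (φ b1 + 4 * π + lam) - (φ a2 + 2 * π + lam) ∧ (φ b1 + 4 * π + lam) - (φ a2 + 2 * π + lam) ≤ π
      constructor <;> linarith
    · show 0 ≤ (φ x + 4 * π + lam) - (φ b1 + 4 * π + lam) ∧ (φ x + 4 * π + lam) - (φ b1 + 4 * π + lam) ≤ π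
      constructor <;> linarith
  · show φ x + 4 * π + lam = φ x + lam + 4 * π
    ring

theorem choose_line {ι : Type*} [Fintype ι] (g0 g1 : ι → ℝ) (x : ι) (hx : 0 < g0 x ^ 2 + g1 x ^ 2) :
    ∃ ε > 0, ∀ i, g0 x * g1 i - g1 x * g0 i ≠ 0 →
      ε * |g0 x * g0 i + g1 x * g1 i| < |g0 x * g1 i - g1 x * g0 i| := by
  have : ∀ᶠ ε : ℝ in nhdsWithin 0 (Set.Ioi 0), ∀ i, g0 x * g1 i - g1 x * g0 i ≠ 0 →
      ε * |g0 x * g0 i + g1 x * g1 i| < |g0 x * g1 i - g1 x * g0 i| := by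
    rw [Filter.eventually_all]
    intro i
    by_cases h : g0 x * g1 i - g1 x * g0 i = 0
    · simp [h]
    · have h' := abs_pos.mpr h
      have hc : ContinuousAt (fun ε : ℝ => ε * |g0 x * g0 i + g1 x * g1 i|) 0 := by fun_prop
      have := hc.eventually_lt (continuousAt_const (y := |g0 x * g1 i - g1 x * g0 i|)) (by simpa using h)
      filter_upwards [this.filter_mono nhdsWithin_le_nhds] with ε hε _ using hε
  obtain ⟨ε, h1, h2⟩ := (this.and self_mem_nhdsWithin).exists
  exact ⟨ε, h2, h1⟩

theorem exists_angles {ι : Type*} (g0 g1 : ι → ℝ) (m0 m1 : ℝ) (hm : 0 < m0 ^ 2 + m1 ^ 2) :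
    ∃ (φ : ι → ℝ) (lam : ℝ),
      (∀ i, g0 i = √(g0 i ^ 2 + g1 i ^ 2) * cos (φ i + lam) ∧
      g1 i = √(g0 i ^ 2 + g1 i ^ 2) * sin (φ i + lam)) ∧
      (∀ i, -π < φ i ∧ φ i ≤ π) ∧
      (∀ i, 0 < m0 * g1 i - m1 * g0 i → 0 < φ i ∧ φ i < π) ∧
      (∀ i, m0 * g1 i - m1 * g0 i < 0 → φ i < 0) ∧
      (∀ i, 0 < m0 * g0 i + m1 * g1 i → -(π/2) < φ i) ∧
      (∀ i, φ i ≠ 0 → 0 < √(g0 i ^ 2 + g1 i ^ 2)) := by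
  let m : ℂ := ⟨m0, m1⟩
  let z : ι → ℂ := fun i => ⟨g0 i, g1 i⟩
  have hm0 : m ≠ 0 := by
    intro h
    have h1 := congrArg Complex.re h
    have h2 := congrArg Complex.im h
    simp [m] at h1 h2
    subst h1 h2
    simp at hm
  have hns : Complex.normSq m = m0 ^ 2 + m1 ^ 2 := by simp [Complex.normSq_apply, m]; ring
  have him : ∀ i, (z i / m).im = (m0 * g1 i - m1 * g0 i) / (m0 ^ 2 + m1 ^ 2) := by
    intro i; rw [Complex.div_im, hns]; simp [z, m]; ring
  have hre : ∀ i, (z i / m).re = (m0 * g0 i + m1 * g1 i) / (m0 ^ 2 + m1 ^ 2) := by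
    intro i; rw [Complex.div_re, hns]; simp [z, m]; ring
  have hnorm : ∀ i, ‖z i‖ = √(g0 i ^ 2 + g1 i ^ 2) := by
    intro i; rw [Complex.norm_eq_sqrt_sq_add_sq]
  refine ⟨fun i => Complex.arg (z i / m), Complex.arg m, ?_, ?_, ?_, ?_, ?_, ?_⟩
  · intro i
    have e : z i = (‖z i‖ : ℂ) * Complex.exp ((Complex.arg (z i / m) + Complex.arg m : ℝ) * Complex.I) := by
      have h1 := Complex.norm_mul_exp_arg_mul_I (z i / m)
      have h2 := Complex.norm_mul_exp_arg_mul_I m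
      calc z i = (z i / m) * m := by field_simp
        _ = (‖z i / m‖ * Complex.exp (Complex.arg (z i / m) * Complex.I)) *
            (‖m‖ * Complex.exp (Complex.arg m * Complex.I)) := by rw [h1, h2]
        _ = _ := by
          rw [norm_div]
          have : (‖m‖ : ℂ) ≠ 0 := by exact_mod_cast (norm_ne_zero_iff.mpr hm0)
          push_cast
          rw [add_mul, Complex.exp_add]
          field_simp
    have r := congrArg Complex.re e
    have s := congrArg Complex.im e
    rw [Complex.re_ofReal_mul, Complex.exp_ofReal_mul_I_re, hnorm] at r
    rw [Complex.im_ofReal_mul, Complex.exp_ofReal_mul_I_im, hnorm] at s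
    exact ⟨r, s⟩
  · intro i; exact ⟨Complex.neg_pi_lt_arg _, Complex.arg_le_pi _⟩
  · intro i h
    have hi : 0 < (z i / m).im := by rw [him]; positivity
    refine ⟨lt_of_le_of_ne (Complex.arg_nonneg_iff.mpr hi.le) ?_, ?_⟩
    · intro h0
      rw [eq_comm, Complex.arg_eq_zero_iff] at h0
      linarith [h0.2]
    · refine lt_of_le_of_ne (Complex.arg_le_pi _) ?_
      intro h0
      rw [Complex.arg_eq_pi_iff] at h0
      linarith [h0.2]
  · intro i h
    refine Complex.arg_neg_iff.mpr ?_
    rw [him]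
    exact div_neg_of_neg_of_pos h hm
  · intro i h
    refine Complex.neg_pi_div_two_lt_arg_iff.mpr (Or.inl ?_)
    rw [hre]; positivity
  · intro i h
    rw [← hnorm, norm_pos_iff]
    rintro h0
    simp [h0] at h

theorem nest_aux {A1 A2 B1 B2 pa1 pa2 pb1 pb2 : ℝ} (h1 : 0 < pa1) (k1 : 0 < pa2) (h2 : pb1 < 0)
    (k2 : pb2 < 0) (e1 : 0 < A1 * pb1 - pa1 * B1) (e2 : 0 < A2 * pb2 - pa2 * B2)
    (e3 : 0 ≤ -(A1 * pb2 - pa1 * B2)) (e4 : 0 ≤ -(A2 * pb1 - pa2 * B1)) : False := by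
  have f1 := mul_pos e1 (mul_pos k1 (neg_pos.mpr k2))
  have f2 := mul_pos e2 (mul_pos h1 (neg_pos.mpr h2))
  have f3 := mul_nonneg e3 (mul_pos k1 (neg_pos.mpr h2)).le
  have f4 := mul_nonneg e4 (mul_pos h1 (neg_pos.mpr k2)).le
  linarith

theorem dichotomy {ι : Type*} [Fintype ι] [DecidableEq ι] (g0 g1 : ι → ℝ) (x : ι)
    (hx : 0 < g0 x ^ 2 + g1 x ^ 2) :
    (∃ l0 l1 : ℝ, 0 < l0 ^ 2 + l1 ^ 2 ∧ (∀ i, g0 i * l1 - g1 i * l0 = 0 → g0 i = 0 ∧ g1 i = 0) ∧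
      ∃ A B : Finset ι, Disjoint A B ∧
        ∑ a, ∑ b, (if 0 < g0 a*l1 - g1 a*l0 ∧ 0 < l0*g1 b - l1*g0 b ∧ 0 < g0 a*g1 b - g1 a*g0 b
          then g0 a*g1 b - g1 a*g0 b else 0) = ∑ a ∈ A, ∑ b ∈ B, (g0 a*g1 b - g1 a*g0 b)) ∨
    StarData g0 g1 := by
  classical
  obtain ⟨ε, hε, hεi⟩ := choose_line g0 g1 x hx
  set X0 := g0 x with hX0
  set X1 := g1 x with hX1
  -- the vector m = -l
  set m0 := X0 - ε * X1 with hm0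
  set m1 := X1 + ε * X0 with hm1
  have hmm : m0 ^ 2 + m1 ^ 2 = (1 + ε ^ 2) * (X0 ^ 2 + X1 ^ 2) := by rw [hm0, hm1]; ring
  have hm : 0 < m0 ^ 2 + m1 ^ 2 := by rw [hmm]; positivity
  have hmi : ∀ i, m0 * g1 i - m1 * g0 i =
      (X0 * g1 i - X1 * g0 i) - ε * (X0 * g0 i + X1 * g1 i) := by
    intro i; rw [hm0, hm1]; ring
  have hpos : ∀ i, 0 < m0 * g1 i - m1 * g0 i → 0 ≤ X0 * g1 i - X1 * g0 i := by
    intro i h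
    by_contra hn
    push Not at hn
    have h1 := hεi i hn.ne
    rw [abs_of_neg hn] at h1
    rw [hmi] at h
    nlinarith [neg_abs_le (X0 * g0 i + X1 * g1 i)]
  have hneg : ∀ i, m0 * g1 i - m1 * g0 i < 0 → X0 * g1 i - X1 * g0 i ≤ 0 := by
    intro i h
    by_contra hn
    push Not at hn
    have h1 := hεi i hn.ne'
    rw [abs_of_pos hn] at h1
    rw [hmi] at h
    nlinarith [le_abs_self (X0 * g0 i + X1 * g1 i)]
  have hgen : ∀ i, m0 * g1 i - m1 * g0 i = 0 → g0 i = 0 ∧ g1 i = 0 := by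
    intro i h
    rw [hmi] at h
    have hz : X0 * g1 i - X1 * g0 i = 0 := by
      by_contra hn
      have h1 := hεi i hn
      have h2 : X0 * g1 i - X1 * g0 i = ε * (X0 * g0 i + X1 * g1 i) := by linarith
      rw [h2, abs_mul, abs_of_pos hε] at h1
      exact lt_irrefl _ h1
    have hz2 : X0 * g0 i + X1 * g1 i = 0 := by
      rw [hz] at h
      have : ε * (X0 * g0 i + X1 * g1 i) = 0 := by linarith
      exact (mul_eq_zero.mp this).resolve_left hε.ne'
    have hs : (X0 ^ 2 + X1 ^ 2) * (g0 i ^ 2 + g1 i ^ 2) = 0 := by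
      linear_combination (X0 * g1 i - X1 * g0 i) * hz + (X0 * g0 i + X1 * g1 i) * hz2
    have := (mul_eq_zero.mp hs).resolve_left hx.ne'
    constructor <;> nlinarith [sq_nonneg (g0 i), sq_nonneg (g1 i)]
  -- adjacency
  let adj : ι → ι → Prop := fun a b => 0 < m0 * g1 a - m1 * g0 a ∧ m0 * g1 b - m1 * g0 b < 0 ∧
    0 < g0 a * g1 b - g1 a * g0 b
  have hnest : ∀ a1 b1 a2 b2, adj a1 b1 → adj a2 b2 → adj a1 b2 ∨ adj a2 b1 := by
    rintro a1 b1 a2 b2 ⟨h1, h2, h3⟩ ⟨k1, k2, k3⟩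
    by_contra hcon
    push Not at hcon
    obtain ⟨c1, c2⟩ := hcon
    have c1' : g0 a1 * g1 b2 - g1 a1 * g0 b2 ≤ 0 := by
      by_contra h; push Not at h; exact c1 ⟨h1, k2, h⟩
    have c2' : g0 a2 * g1 b1 - g1 a2 * g0 b1 ≤ 0 := by
      by_contra h; push Not at h; exact c2 ⟨k1, h2, h⟩
    -- identity for the pairing
    have key : ∀ a b, (g0 a * g1 b - g1 a * g0 b) * (m0 ^ 2 + m1 ^ 2) =
        (m0 * g0 a + m1 * g1 a) * (m0 * g1 b - m1 * g0 b) -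
        (m0 * g1 a - m1 * g0 a) * (m0 * g0 b + m1 * g1 b) := by intro a b; ring
    have e1 := mul_pos h3 hm
    have e2 := mul_pos k3 hm
    have e3 := mul_nonneg_of_nonpos_of_nonpos c1' (neg_nonpos.mpr hm.le)
    have e4 := mul_nonneg_of_nonpos_of_nonpos c2' (neg_nonpos.mpr hm.le)
    rw [mul_neg] at e3 e4
    rw [key] at e1 e2 e3 e4
    exact nest_aux h1 k1 h2 k2 e1 e2 e3 e4
  by_cases hcomp : ∀ a b, (∃ b', adj a b') → (∃ a', adj a' b) → adj a b
  · left
    refine ⟨-m0, -m1, by simpa using hm, ?_, Finset.univ.filter (fun a => ∃ b, adj a b),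
      Finset.univ.filter (fun b => ∃ a, adj a b), ?_, ?_⟩
    · intro i h
      exact hgen i (by linarith)
    · rw [Finset.disjoint_left]
      rintro i hi hi'
      simp only [Finset.mem_filter, Finset.mem_univ, true_and] at hi hi'
      obtain ⟨b, hb⟩ := hi
      obtain ⟨a, ha⟩ := hi'
      linarith [hb.1, ha.2.1]
    · rw [Finset.sum_filter]
      refine Finset.sum_congr rfl fun a _ => ?_
      by_cases hA : ∃ b, adj a b
      · rw [if_pos hA, Finset.sum_filter]
        refine Finset.sum_congr rfl fun b _ => ?_
        by_cases hB : ∃ a, adj a b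
        · have := hcomp a b hA hB
          rw [if_pos hB, if_pos ⟨by linarith [this.1], by linarith [this.2.1], this.2.2⟩]
        · rw [if_neg hB, if_neg]
          rintro ⟨h1, h2, h3⟩
          exact hB ⟨a, by linarith, by linarith, h3⟩
      · rw [if_neg hA]
        refine Finset.sum_eq_zero fun b _ => ?_
        rw [if_neg]
        rintro ⟨h1, h2, h3⟩
        exact hA ⟨b, by linarith, by linarith, h3⟩
  · right
    push Not at hcomp
    obtain ⟨a2, b2, ⟨b1, h21⟩, ⟨a1, h12⟩, hn⟩ := hcomp
    have h11 : adj a1 b1 := by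
      rcases hnest a2 b1 a1 b2 h21 h12 with h | h
      · exact absurd h hn
      · exact h
    have hn' : g0 a2 * g1 b2 - g1 a2 * g0 b2 ≤ 0 := by
      by_contra h; push Not at h; exact hn ⟨h21.1, h12.2.1, h⟩
    obtain ⟨φ, lam, hφ, hr, hp, hng, hre, hnz⟩ := exists_angles g0 g1 m0 m1 hm
    have hxm : m0 * g1 x - m1 * g0 x < 0 := by
      rw [hmi, ← hX0, ← hX1]
      nlinarith [mul_pos hε hx]
    have hxr : 0 < m0 * g0 x + m1 * g1 x := by
      rw [← hX0, ← hX1, hm0, hm1]; nlinarith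
    have hxb1 : x ≠ b1 := by
      rintro rfl
      have := hpos a1 h11.1
      have := h11.2.2
      linarith
    have hxb2 : x ≠ b2 := by
      rintro rfl
      have := hpos a1 h12.1
      have := h12.2.2
      linarith
    have hLR : ∀ a b, 0 < m0 * g1 a - m1 * g0 a → m0 * g1 b - m1 * g0 b < 0 → a ≠ b := by
      rintro a b h1 h2 rfl
      linarith
    have ha12 : a1 ≠ a2 := by rintro rfl; exact hn h12
    have hb12 : b1 ≠ b2 := by rintro rfl; exact hn h21
    refine star_of_angles g0 g1 φ lam hφ (fun i hi => hnz i (hi.elim (fun h => h.ne') (fun h => h.ne))) x a1 b2 a2 b1 (hre x hxr)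
      (hng x hxm) (hp a1 h11.1).1 (hp a1 h11.1).2 (hp a2 h21.1).1 (hp a2 h21.1).2
      (hr b1).1 (hng b1 h11.2.1) (hr b2).1 (hng b2 h12.2.1) ?_ (hpos a1 h11.1) h12.2.2.le
      (by linarith) h21.2.2.le ?_
    · have q1 := hLR a1 x h11.1 hxm
      have q2 := hLR a2 x h21.1 hxm
      have q3 := hLR a1 b1 h11.1 h11.2.1
      have q4 := hLR a1 b2 h11.1 h12.2.1
      have q5 := hLR a2 b1 h21.1 h11.2.1
      have q6 := hLR a2 b2 h21.1 h12.2.1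
      intro i j hij
      fin_cases i <;> fin_cases j <;> first
        | rfl
        | exact absurd hij q1
        | exact absurd hij q1.symm
        | exact absurd hij q2
        | exact absurd hij q2.symm
        | exact absurd hij q3
        | exact absurd hij q3.symm
        | exact absurd hij q4
        | exact absurd hij q4.symm
        | exact absurd hij q5
        | exact absurd hij q5.symm
        | exact absurd hij q6
        | exact absurd hij q6.symm
        | exact absurd hij hxb1
        | exact absurd hij hxb1.symm
        | exact absurd hij hxb2
        | exact absurd hij hxb2.symm
        | exact absurd hij ha12
        | exact absurd hij ha12.symm
        | exact absurd hij hb12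
        | exact absurd hij hb12.symm
    · have := hneg b1 h11.2.1
      linarith


theorem sin_arccos_cos (x : ℝ) : sin (arccos (cos x)) = |sin x| := by
  rw [sin_arccos, ← Real.sqrt_sq_eq_abs]
  congr 1
  linarith [sin_sq_add_cos_sq x]

theorem cos_arccos_cos (x : ℝ) : cos (arccos (cos x)) = cos x :=
  cos_arccos (neg_one_le_cos x) (cos_le_one x)

/-- indicator function used in the averaging argument -/
noncomputable def secInd (p q t : ℝ) : ℝ := if 0 < sin (t - p) ∧ 0 < sin (q - t) then 1 else 0

theorem secInd_integrable (p q a b : ℝ) : IntervalIntegrable (secInd p q) volume a b := by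
  have hm : Measurable (secInd p q) := by
    unfold secInd
    refine Measurable.ite (MeasurableSet.inter ?_ ?_) measurable_const measurable_const
    · show MeasurableSet {t : ℝ | 0 < sin (t - p)}
      exact (isOpen_lt continuous_const (by fun_prop)).measurableSet
    · show MeasurableSet {t : ℝ | 0 < sin (q - t)}
      exact (isOpen_lt continuous_const (by fun_prop)).measurableSet
  refine (intervalIntegrable_const (c := (1:ℝ))).mono_fun hm.aestronglyMeasurable ?_
  filter_upwards with t
  unfold secInd
  split_ifs <;> simp

theorem secInd_integral (p q : ℝ) (h : 0 < sin (q - p)) :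
    ∫ t in (0:ℝ)..(2 * π), secInd p q t ≤ arccos (cos (q - p)) := by
  have hper : Function.Periodic (secInd p q) (2 * π) := by
    intro t
    unfold secInd
    rw [show t + 2 * π - p = (t - p) + 2 * π by ring, show q - (t + 2 * π) = (q - t) - 2 * π by ring,
      sin_add_two_pi, sin_sub_two_pi]
  have hs := hper.intervalIntegral_add_eq 0 p
  rw [zero_add] at hs
  rw [hs]
  set θ := arccos (cos (q - p)) with hθ
  have hsθ : sin θ = sin (q - p) := by rw [hθ, sin_arccos_cos, abs_of_pos h]
  have hcθ : cos θ = cos (q - p) := cos_arccos_cos _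
  have h0 : 0 ≤ θ := arccos_nonneg _
  have h1 : θ ≤ π := arccos_le_pi _
  rw [← intervalIntegral.integral_add_adjacent_intervals (secInd_integrable p q p (p + θ))
    (secInd_integrable p q (p + θ) (p + 2 * π))]
  have e1 : ∫ t in p..(p + θ), secInd p q t ≤ ∫ t in p..(p + θ), (1:ℝ) := by
    refine intervalIntegral.integral_mono_on (by linarith) (secInd_integrable _ _ _ _)
      intervalIntegrable_const ?_
    intro t _
    unfold secInd
    split_ifs <;> simp
  have e2 : ∫ t in (p + θ)..(p + 2 * π), secInd p q t ≤ ∫ t in (p + θ)..(p + 2 * π), (0:ℝ) := by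
    refine intervalIntegral.integral_mono_on (by linarith [pi_pos]) (secInd_integrable _ _ _ _)
      intervalIntegrable_const ?_
    intro t ht
    unfold secInd
    rw [if_neg]
    rintro ⟨a1, a2⟩
    have hlt : t - p < π := by
      by_contra hc
      push Not at hc
      have := sin_nonneg_of_nonneg_of_le_pi (x := t - p - π) (by linarith) (by linarith [ht.2])
      rw [sin_sub_pi] at this
      linarith
    have : sin (q - t) = sin (θ - (t - p)) := by
      rw [sin_sub θ, hsθ, hcθ, ← sin_sub]; congr 1; ring
    rw [this] at a2
    have := sin_nonpos_of_nonpos_of_neg_pi_le (x := θ - (t - p)) (by linarith [ht.1]) (by linarith)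
    linarith
  simp at e1 e2
  linarith

theorem ii_sum {ι : Type*} [Fintype ι] {f : ι → ℝ → ℝ} {a b : ℝ}
    (h : ∀ i, IntervalIntegrable (f i) volume a b) :
    IntervalIntegrable (fun t => ∑ i, f i t) volume a b := by
  have := IntervalIntegrable.sum Finset.univ (fun i _ => h i)
  rwa [Finset.sum_fn] at this

theorem averaging {ι : Type*} [Fintype ι] (g0 g1 r φ : ι → ℝ) (V κ : ℝ) (hκ : 0 ≤ κ)
    (hr : ∀ i, 0 ≤ r i) (h0 : ∀ i, g0 i = r i * cos (φ i)) (h1 : ∀ i, g1 i = r i * sin (φ i))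
    (hV : ∀ l0 l1 : ℝ, 0 < l0 ^ 2 + l1 ^ 2 →
      (∀ i, g0 i * l1 - g1 i * l0 = 0 → g0 i = 0 ∧ g1 i = 0) →
      V ≤ κ * ∑ a, ∑ b, (if 0 < g0 a*l1 - g1 a*l0 ∧ 0 < l0*g1 b - l1*g0 b ∧
        0 < g0 a*g1 b - g1 a*g0 b then g0 a*g1 b - g1 a*g0 b else 0)) :
    4 * π * V ≤ κ * ∑ a, ∑ b, r a * r b *
      (arccos (cos (φ b - φ a)) * sin (arccos (cos (φ b - φ a)))) := by
  classical
  set s : ι → ι → ℝ := fun a b => if 0 < sin (φ b - φ a) then sin (φ b - φ a) else 0 with hs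
  have hs0 : ∀ a b, 0 ≤ s a b := by
    intro a b; simp only [hs]; split_ifs with h
    · exact h.le
    · exact le_rfl
  have hw : ∀ a b, g0 a * g1 b - g1 a * g0 b = r a * r b * sin (φ b - φ a) := by
    intro a b; rw [h0, h1, h0, h1, sin_sub]; ring
  have hpt : ∀ t, (∀ i, sin (t - φ i) ≠ 0) →
      V ≤ κ * ∑ a, ∑ b, r a * r b * s a b * secInd (φ a) (φ b) t := by
    intro t ht
    have e1 : ∀ a, g0 a * sin t - g1 a * cos t = r a * sin (t - φ a) := by
      intro a; rw [h0, h1, sin_sub]; ring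
    have e2 : ∀ b, cos t * g1 b - sin t * g0 b = r b * sin (φ b - t) := by
      intro a; rw [h0, h1, sin_sub]; ring
    refine (hV (cos t) (sin t) (by rw [cos_sq_add_sin_sq]; norm_num) ?_).trans ?_
    · intro i hi
      rw [e1] at hi
      have := (mul_eq_zero.mp hi).resolve_right (ht i)
      rw [h0, h1, this]; simp
    · refine mul_le_mul_of_nonneg_left ?_ hκ
      refine Finset.sum_le_sum fun a _ => Finset.sum_le_sum fun b _ => ?_
      rw [e1, e2, hw]
      split_ifs with h
      · obtain ⟨p1, p2, p3⟩ := h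
        have q1 := pos_of_mul_pos_right p1 (hr a)
        have q2 := pos_of_mul_pos_right p2 (hr b)
        have q3 := pos_of_mul_pos_right p3 (mul_nonneg (hr a) (hr b))
        simp [secInd, hs, q1, q2, q3]
      · have : 0 ≤ secInd (φ a) (φ b) t := by unfold secInd; split_ifs <;> simp
        have := hs0 a b
        have := hr a
        have := hr b
        positivity
  have hae : ∀ᵐ t : ℝ, ∀ i, sin (t - φ i) ≠ 0 := by
    rw [ae_all_iff]
    intro i
    have hc : ({t : ℝ | sin (t - φ i) = 0}).Countable := by
      refine (Set.countable_range (fun n : ℤ => (n : ℝ) * π + φ i)).mono ?_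
      intro t ht
      obtain ⟨n, hn⟩ := Real.sin_eq_zero_iff.mp ht
      exact ⟨n, by simp only [hn]; ring⟩
    filter_upwards [hc.ae_notMem volume] with t ht using ht
  have hint : ∀ a b, IntervalIntegrable (fun t => r a * r b * s a b * secInd (φ a) (φ b) t)
      volume 0 (2 * π) := fun a b => (secInd_integrable _ _ _ _).const_mul _
  have hI : ∫ t in (0:ℝ)..(2 * π), V ≤
      ∫ t in (0:ℝ)..(2 * π), κ * ∑ a, ∑ b, r a * r b * s a b * secInd (φ a) (φ b) t := by
    refine intervalIntegral.integral_mono_ae (by linarith [pi_pos]) intervalIntegrable_const ?_ ?_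
    · refine IntervalIntegrable.const_mul ?_ _
      exact ii_sum fun a => ii_sum fun b => hint a b
    · filter_upwards [hae] with t ht using hpt t ht
  rw [intervalIntegral.integral_const_mul, intervalIntegral.integral_finsetSum] at hI
  swap
  · intro a _
    exact ii_sum fun b => hint a b
  have hI2 : ∀ a, ∫ t in (0:ℝ)..(2 * π), ∑ b, r a * r b * s a b * secInd (φ a) (φ b) t
      ≤ ∑ b, r a * r b * s a b * arccos (cos (φ b - φ a)) := by
    intro a
    rw [intervalIntegral.integral_finsetSum (fun b _ => hint a b)]
    refine Finset.sum_le_sum fun b _ => ?_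
    rw [intervalIntegral.integral_const_mul]
    by_cases h : 0 < sin (φ b - φ a)
    · exact mul_le_mul_of_nonneg_left (secInd_integral _ _ h)
        (mul_nonneg (mul_nonneg (hr a) (hr b)) (hs0 a b))
    · have : s a b = 0 := by simp [hs, h]
      simp [this]
  have hI3 := hI.trans (mul_le_mul_of_nonneg_left (Finset.sum_le_sum fun a _ => hI2 a) hκ)
  have hI4 : 2 * π * V ≤ κ * ∑ a, ∑ b, r a * r b * s a b * arccos (cos (φ b - φ a)) := by
    refine le_trans (le_of_eq ?_) hI3
    simp
  have hsym : 2 * ∑ a, ∑ b, r a * r b * s a b * arccos (cos (φ b - φ a)) =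
      ∑ a, ∑ b, r a * r b * (arccos (cos (φ b - φ a)) * sin (arccos (cos (φ b - φ a)))) := by
    rw [two_mul]
    nth_rewrite 2 [Finset.sum_comm]
    rw [← Finset.sum_add_distrib]
    refine Finset.sum_congr rfl fun a _ => ?_
    rw [← Finset.sum_add_distrib]
    refine Finset.sum_congr rfl fun b _ => ?_
    rw [sin_arccos_cos, ← neg_sub (φ b) (φ a), cos_neg]
    have : s a b + s b a = |sin (φ b - φ a)| := by
      simp only [hs]
      rw [← neg_sub (φ b) (φ a), sin_neg]
      rcases lt_trichotomy (sin (φ b - φ a)) 0 with h | h | h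
      · rw [if_neg (by linarith), if_pos (by linarith), abs_of_neg h]; ring
      · simp [h]
      · rw [if_pos h, if_neg (by linarith), abs_of_pos h]; ring
    rw [← this]; ring
  rw [← hsym]
  linarith


noncomputable def cD : ℝ := 2 * π / (3 * √3)

theorem cD_bounds : 1.2091 < cD ∧ cD < 1.2093 := by
  have h1 := pi_gt_d6
  have h2 := pi_lt_d6
  have h3 : (1.73205:ℝ) < √3 := by
    rw [Real.lt_sqrt (by norm_num)]; norm_num
  have h4 : √3 < (1.73206:ℝ) := by
    rw [Real.sqrt_lt' (by norm_num)]; norm_num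
  unfold cD
  constructor
  · rw [lt_div_iff₀ (by positivity)]; linarith
  · rw [div_lt_iff₀ (by positivity)]; linarith

/-- cubic polynomial -/
noncomputable def polB (u : ℝ) : ℝ :=
  (-659/1500 + 5/3 * cD) + (-3107/3000 + 4/3 * cD) * u + (-51/250) * u^2 + (11/50) * u^3

noncomputable def polC (u : ℝ) : ℝ :=
  (-1211/1500 + 2/3 * cD) + (-2461/1500 + 4/3 * cD) * u + (-259/500) * u^2 + (33/50) * u^3

noncomputable def hC (s : ℝ) : ℝ := (1 - s^2) / (1 + s^2)

noncomputable def hS (s : ℝ) : ℝ := s * polB (hC s) - 2 * arctan s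

theorem hC_anti {s t : ℝ} (h0 : 0 ≤ s) (h : s ≤ t) : hC t ≤ hC s := by
  unfold hC
  rw [div_le_div_iff₀ (by positivity) (by positivity)]
  nlinarith

theorem hasDerivAt_hS (s : ℝ) : HasDerivAt hS ((hC s + 1/2) * polC (hC s)) s := by
  have hp : (1 + s^2) ≠ 0 := by positivity
  have h1 : HasDerivAt hC (((-(2 * s)) * (1 + s^2) - (1 - s^2) * (2 * s)) / (1 + s^2)^2) s := by
    have a : HasDerivAt (fun s : ℝ => 1 - s^2) (-(2 * s)) s := by
      simpa using (hasDerivAt_pow 2 s).const_sub 1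
    have b : HasDerivAt (fun s : ℝ => 1 + s^2) (2 * s) s := by
      simpa using (hasDerivAt_pow 2 s).const_add 1
    exact a.div b hp
  have h2 : ∀ u, HasDerivAt polB ((-3107/3000 + 4/3 * cD) + (-51/250) * (2 * u) + (11/50) * (3 * u^2)) u := by
    intro u
    have a := (hasDerivAt_id u).const_mul (-3107/3000 + 4/3 * cD)
    have b := (hasDerivAt_pow 2 u).const_mul (-51/250 : ℝ)
    have c := (hasDerivAt_pow 3 u).const_mul (11/50 : ℝ)
    have := ((a.const_add (-659/1500 + 5/3 * cD)).add b).add c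
    exact this.congr_deriv (by norm_num)
  have h3 := ((hasDerivAt_id s).mul ((h2 (hC s)).comp s h1)).sub ((hasDerivAt_arctan s).const_mul 2)
  refine h3.congr_deriv ?_
  simp only [id, Function.comp, polB, polC, hC]
  field_simp
  ring

theorem polC_step {u v : ℝ} (hu : -(1/2) ≤ u) (h : u ≤ v) (hc : 0 ≤ polC u) : 0 ≤ polC v ∧ (0 < polC u → 0 < polC v) := by
  obtain ⟨d1, d2⟩ := cD_bounds
  have hu0 : 0 < u := by
    by_contra hn
    push Not at hn
    unfold polC at hc
    have : (33/50) * u^3 ≤ 0 := by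
      have : u^3 = u * u^2 := by ring
      nlinarith [sq_nonneg u, mul_nonneg (neg_nonneg.mpr hn) (sq_nonneg u)]
    nlinarith [sq_nonneg (u + 0.0285), mul_nonneg (neg_nonneg.mpr hn) (sub_nonneg.mpr d1.le)]
  have hv0 : 0 < v := by linarith
  -- polC v * u^2 ≥ polC u * v^2
  have key : polC v * u^2 - polC u * v^2 = (v - u) * ( (33/50) * u^2 * v^2
      + (-(-2461/1500 + 4/3 * cD)) * (u * v) + (-(-1211/1500 + 2/3 * cD)) * (u + v)) := by
    unfold polC; ring
  have e : 0 ≤ polC v * u^2 - polC u * v^2 := by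
    rw [key]
    have a1 : 0 ≤ -(-2461/1500 + 4/3 * cD) := by linarith
    have a2 : 0 ≤ -(-1211/1500 + 2/3 * cD) := by linarith
    have a3 : 0 ≤ v - u := by linarith
    positivity
  constructor
  · have : 0 ≤ polC v * u^2 := by linarith [mul_nonneg hc (sq_nonneg v)]
    exact nonneg_of_mul_nonneg_left this (by positivity)
  · intro hp
    have : 0 < polC v * u^2 := by linarith [mul_pos hp (pow_pos hv0 2)]
    exact pos_of_mul_pos_left this (by positivity)

theorem polC_neg {u : ℝ} (hu : u ≤ -(1/2)) (h1 : -1 ≤ u) : polC u ≤ 0 := by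
  obtain ⟨d1, d2⟩ := cD_bounds
  unfold polC
  have : (33/50) * u^3 ≤ 0 := by
    have : u^3 = u * u^2 := by ring
    nlinarith [sq_nonneg u, mul_nonneg (neg_nonneg.mpr (by linarith : u ≤ 0)) (sq_nonneg u)]
  nlinarith [sq_nonneg (u + 0.0285), mul_nonneg (neg_nonneg.mpr (by linarith : u ≤ 0)) (sub_nonneg.mpr d1.le)]

theorem hC_sqrt3 : hC √3 = -(1/2) := by
  unfold hC; rw [Real.sq_sqrt (by norm_num)]; norm_num

theorem hS_sqrt3 : hS √3 = 0 := by
  unfold hS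
  rw [hC_sqrt3]
  have : arctan √3 = π / 3 := by
    rw [← tan_pi_div_three]
    exact arctan_tan (by linarith [pi_pos]) (by linarith [pi_pos])
  rw [this]
  have : polB (-(1/2)) = cD := by unfold polB; ring
  rw [this]
  unfold cD
  have : √3 ≠ 0 := by positivity
  field_simp
  ring

theorem hS_nonneg {s : ℝ} (hs : 0 ≤ s) : 0 ≤ hS s := by
  have hd : ∀ x, deriv hS x = (hC x + 1/2) * polC (hC x) := fun x => (hasDerivAt_hS x).deriv
  have hdiff : Differentiable ℝ hS := fun x => (hasDerivAt_hS x).differentiableAt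
  have h30 : 0 ≤ √3 := by positivity
  rcases le_total s √3 with h | h
  · have hu : -(1/2) ≤ hC s := by rw [← hC_sqrt3]; exact hC_anti hs h
    rcases le_total 0 (polC (hC s)) with hc | hc
    · have hm : MonotoneOn hS (Set.Icc 0 s) := by
        refine monotoneOn_of_deriv_nonneg (convex_Icc _ _) hdiff.continuous.continuousOn
          hdiff.differentiableOn ?_
        intro x hx
        rw [interior_Icc] at hx
        rw [hd]
        have := hC_anti hx.1.le hx.2.le
        exact mul_nonneg (by linarith) (polC_step hu this hc).1
      have := hm (Set.left_mem_Icc.mpr hs) (Set.right_mem_Icc.mpr hs) hs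
      have h0 : hS 0 = 0 := by simp [hS]
      linarith
    · have hm : AntitoneOn hS (Set.Icc s √3) := by
        refine antitoneOn_of_deriv_nonpos (convex_Icc _ _) hdiff.continuous.continuousOn
          hdiff.differentiableOn ?_
        intro x hx
        rw [interior_Icc] at hx
        rw [hd]
        have h1 := hC_anti hs hx.1.le
        have h2 := hC_anti (hs.trans hx.1.le) hx.2.le
        rw [hC_sqrt3] at h2
        refine mul_nonpos_of_nonneg_of_nonpos (by linarith) ?_
        by_contra hn
        push Not at hn
        linarith [(polC_step h2 h1 hn.le).2 hn]
      have := hm (Set.left_mem_Icc.mpr h) (Set.right_mem_Icc.mpr h) h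
      rw [hS_sqrt3] at this
      linarith
  · have hm : MonotoneOn hS (Set.Ici √3) := by
      refine monotoneOn_of_deriv_nonneg (convex_Ici _) hdiff.continuous.continuousOn
        hdiff.differentiableOn ?_
      intro x hx
      rw [interior_Ici] at hx
      rw [hd]
      have h1 := hC_anti h30 (le_of_lt hx)
      rw [hC_sqrt3] at h1
      have h2 : -1 ≤ hC x := by
        unfold hC; rw [le_div_iff₀ (by positivity)]; linarith
      exact mul_nonneg_of_nonpos_of_nonpos (by linarith) (polC_neg h1 h2)
    have := hm (Set.mem_Ici.mpr le_rfl) h h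
    rw [hS_sqrt3] at this
    linarith

noncomputable def cP1 : ℝ := (cD + 1) / 3 - 11/200
noncomputable def cP2 : ℝ := (2 * cD - 1) / 3 + 11/400

/-- the remainder function of the trigonometric certificate -/
noncomputable def rfun (θ : ℝ) : ℝ :=
  cD - θ * sin θ - cP1 * cos θ - cP2 * cos (2 * θ) - 11/400 * cos (4 * θ)
    - 106/1000 * (1 - cos (3 * θ))

theorem cos_four_mul' (θ : ℝ) : cos (4 * θ) = 8 * cos θ ^ 4 - 8 * cos θ ^ 2 + 1 := by
  rw [show 4 * θ = 2 * (2 * θ) by ring, cos_two_mul, cos_two_mul]; ring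

theorem rfun_eq (θ : ℝ) : rfun θ = (1 - cos θ) * polB (cos θ) - θ * sin θ := by
  unfold rfun polB cP1 cP2
  rw [cos_four_mul', cos_three_mul, cos_two_mul]; ring

theorem rfun_nonneg {θ : ℝ} (h0 : 0 ≤ θ) (h1 : θ ≤ π) : 0 ≤ rfun θ := by
  obtain ⟨d1, d2⟩ := cD_bounds
  rcases eq_or_lt_of_le h1 with rfl | h1
  · rw [rfun_eq]; simp [polB]; linarith
  · have hx0 : 0 ≤ θ / 2 := by linarith
    have hx1 : θ / 2 < π / 2 := by linarith
    have hc : 0 < cos (θ / 2) := cos_pos_of_mem_Ioo ⟨by linarith, hx1⟩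
    have hs : 0 ≤ tan (θ / 2) := tan_nonneg_of_nonneg_of_le_pi_div_two hx0 hx1.le
    have key := hS_nonneg hs
    unfold hS at key
    rw [arctan_tan (by linarith) hx1] at key
    have hu : hC (tan (θ / 2)) = cos θ := by
      unfold hC
      have : cos θ = 2 * cos (θ/2)^2 - 1 := by rw [← cos_two_mul]; congr 1; ring
      rw [this, tan_eq_sin_div_cos]
      have h2 := sin_sq_add_cos_sq (θ/2)
      have : 1 + (sin (θ/2) / cos (θ/2))^2 ≠ 0 := by positivity
      rw [div_eq_iff this]
      have e : sin (θ/2)^2 = 1 - cos (θ/2)^2 := by linarith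
      rw [div_pow, e]
      field_simp
      ring
    rw [hu] at key
    have hsin : 0 ≤ sin θ := sin_nonneg_of_nonneg_of_le_pi h0 h1.le
    have h3 : sin θ * tan (θ / 2) = 1 - cos θ := by
      have a : sin θ = 2 * sin (θ/2) * cos (θ/2) := by rw [← sin_two_mul]; congr 1; ring
      have b : cos θ = 1 - 2 * sin (θ/2)^2 := by
        have : cos θ = 2 * cos (θ/2)^2 - 1 := by rw [← cos_two_mul]; congr 1; ring
        rw [this]; linarith [sin_sq_add_cos_sq (θ/2)]
      rw [a, b, tan_eq_sin_div_cos]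
      field_simp
      ring
    rw [rfun_eq, ← h3]
    have := mul_nonneg hsin key
    linarith


theorem cD_bounds' : 1.20919 < cD ∧ cD < 1.20921 := by
  have h1 := pi_gt_d6
  have h2 := pi_lt_d6
  have h3 : (1.7320508:ℝ) < √3 := by
    rw [Real.lt_sqrt (by norm_num)]; norm_num
  have h4 : √3 < (1.7320509:ℝ) := by
    rw [Real.sqrt_lt' (by norm_num)]; norm_num
  unfold cD
  constructor
  · rw [lt_div_iff₀ (by positivity)]; linarith
  · rw [div_lt_iff₀ (by positivity)]; linarith

noncomputable def rho (x : ℝ) : ℝ :=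
  cD - (π - x) * sin x + cP1 * cos x - cP2 * cos (2 * x) - 11/400 * cos (4 * x)
    - 106/1000 * (1 + cos (3 * x))

noncomputable def rho1 (x : ℝ) : ℝ :=
  sin x - (π - x) * cos x - cP1 * sin x + 2 * cP2 * sin (2 * x) + 11/100 * sin (4 * x)
    + 318/1000 * sin (3 * x)

noncomputable def rho2 (x : ℝ) : ℝ :=
  2 * cos x + (π - x) * sin x - cP1 * cos x + 4 * cP2 * cos (2 * x) + 44/100 * cos (4 * x)
    + 954/1000 * cos (3 * x)

theorem rho_eq (x : ℝ) : rho x = rfun (π - x) := by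
  unfold rho rfun
  rw [sin_pi_sub, cos_pi_sub, show 2 * (π - x) = 2 * π - 2 * x by ring,
    show 4 * (π - x) = 2 * π - 4 * x + 2 * π by ring,
    show 3 * (π - x) = π - 3 * x + 2 * π by ring, cos_add_two_pi, cos_add_two_pi,
    cos_two_pi_sub, cos_two_pi_sub, cos_pi_sub]
  ring

theorem hasDerivAt_cosk (k x : ℝ) : HasDerivAt (fun x => cos (k * x)) (-(k * sin (k * x))) x := by
  have := ((hasDerivAt_id x).const_mul k).cos
  exact this.congr_deriv (by simp; ring)

theorem hasDerivAt_sink (k x : ℝ) : HasDerivAt (fun x => sin (k * x)) (k * cos (k * x)) x := by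
  have := ((hasDerivAt_id x).const_mul k).sin
  exact this.congr_deriv (by simp; ring)

theorem hasDerivAt_rho (x : ℝ) : HasDerivAt rho (rho1 x) x := by
  have a := ((hasDerivAt_id x).const_sub π).mul (hasDerivAt_sin x)
  have := (((((a.const_sub cD).add ((hasDerivAt_cos x).const_mul cP1)).sub
    ((hasDerivAt_cosk 2 x).const_mul cP2)).sub ((hasDerivAt_cosk 4 x).const_mul (11/400))).sub
    (((hasDerivAt_cosk 3 x).const_add 1).const_mul (106/1000)))
  exact this.congr_deriv (by simp [rho1]; ring)

theorem hasDerivAt_rho1 (x : ℝ) : HasDerivAt rho1 (rho2 x) x := by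
  have a := ((hasDerivAt_id x).const_sub π).mul (hasDerivAt_cos x)
  have := (((((hasDerivAt_sin x).sub a).sub ((hasDerivAt_sin x).const_mul cP1)).add
    ((hasDerivAt_sink 2 x).const_mul (2 * cP2))).add ((hasDerivAt_sink 4 x).const_mul (11/100))).add
    ((hasDerivAt_sink 3 x).const_mul (318/1000))
  exact this.congr_deriv (by simp [rho2]; ring)

theorem rho2_nonneg {x : ℝ} (h0 : 0 ≤ x) (h1 : x ≤ 0.85) : 0 ≤ rho2 x := by
  obtain ⟨d1, d2⟩ := cD_bounds
  have hpi := pi_gt_d6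
  have hs0 : 0 ≤ sin x := sin_nonneg_of_nonneg_of_le_pi h0 (by linarith)
  have hs1 := sin_le_one x
  have hu : 0.63 ≤ cos x := by
    have := one_sub_sq_div_two_le_cos (x := x)
    nlinarith
  have hu1 := cos_le_one x
  have hq : 2 * sin x ^ 2 ≤ (π - x) * sin x := by nlinarith
  have hsq : sin x ^ 2 = 1 - cos x ^ 2 := by linarith [sin_sq_add_cos_sq x]
  unfold rho2 cP1 cP2
  rw [cos_four_mul', cos_three_mul, cos_two_mul]
  rw [hsq] at hq
  set u := cos x
  have e1 : 0 ≤ (u - 0.63) * (1 - u) := mul_nonneg (by linarith) (by linarith)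
  have hu0 : 0 ≤ u - 0.63 := by linarith
  obtain ⟨t, ht⟩ : ∃ t, u = 0.63 + t := ⟨u - 0.63, by ring⟩
  obtain ⟨D', hD'⟩ : ∃ D', cD = 1.2091 + D' := ⟨cD - 1.2091, by ring⟩
  have ht0 : 0 ≤ t := by linarith
  have ht1 : t ≤ 0.37 := by linarith
  have hD0 : 0 ≤ D' := by linarith
  have hD1 : D' ≤ 0.0002 := by linarith
  rw [ht] at hq
  rw [ht, hD']
  have f2 : 0 ≤ t^2 := by positivity
  have f3 : 0 ≤ t^3 := by positivity
  have f4 : 0 ≤ t^4 := by positivity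
  have g1 : 0 ≤ D' * t := by positivity
  have g2 : 0 ≤ D' * t^2 := by positivity
  nlinarith

theorem sqrt5_bounds : 2.236067 < √5 ∧ √5 < (2.236068:ℝ) := by
  constructor
  · rw [Real.lt_sqrt (by norm_num)]; norm_num
  · rw [Real.sqrt_lt' (by norm_num)]; norm_num

theorem sin_pi5_bounds : 0.587785 < sin (π / 5) ∧ sin (π / 5) < (0.587786:ℝ) := by
  obtain ⟨a, b⟩ := sqrt5_bounds
  have hc := cos_pi_div_five
  have hs : 0 < sin (π / 5) := sin_pos_of_pos_of_lt_pi (by positivity) (by linarith [pi_pos])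
  have h2 := sin_sq_add_cos_sq (π / 5)
  rw [hc] at h2
  have h5 : √5 ^ 2 = 5 := Real.sq_sqrt (by norm_num)
  have e : sin (π / 5) ^ 2 = (5 - √5) / 8 := by linear_combination h2 - h5 / 16
  constructor <;> nlinarith

theorem cos2_pi5 : cos (2 * (π / 5)) = (√5 - 1) / 4 := by
  rw [cos_two_mul, cos_pi_div_five]
  have h5 : √5 ^ 2 = 5 := Real.sq_sqrt (by norm_num)
  linear_combination h5 / 8

theorem cos3_pi5 : cos (3 * (π / 5)) = -((√5 - 1) / 4) := by
  rw [← cos2_pi5, ← cos_pi_sub]; congr 1; ring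

theorem cos4_pi5 : cos (4 * (π / 5)) = -((1 + √5) / 4) := by
  rw [← cos_pi_div_five, ← cos_pi_sub]; congr 1; ring

theorem rho_pi5 : 0.0775 ≤ rho (π / 5) := by
  obtain ⟨a, b⟩ := sqrt5_bounds
  obtain ⟨s1, s2⟩ := sin_pi5_bounds
  obtain ⟨d1, d2⟩ := cD_bounds'
  have h1 := pi_gt_d6
  have h2 := pi_lt_d6
  unfold rho cP1 cP2
  rw [cos2_pi5, cos3_pi5, cos4_pi5, cos_pi_div_five]
  have e : (π - π / 5) * sin (π / 5) ≤ 0.8 * 3.141593 * 0.587786 := by nlinarith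
  obtain ⟨f, hf⟩ : ∃ f, √5 = 2.236067 + f := ⟨√5 - 2.236067, by ring⟩
  obtain ⟨D', hD'⟩ : ∃ D', cD = 1.20919 + D' := ⟨cD - 1.20919, by ring⟩
  have hf0 : 0 ≤ f := by linarith
  have hf1 : f ≤ 0.000001 := by linarith
  have hD0 : 0 ≤ D' := by linarith
  have hD1 : D' ≤ 0.00002 := by linarith
  rw [hf, hD']
  have : 0 ≤ f * D' := mul_nonneg (by linarith) (by linarith)
  have : f * D' ≤ 0.000001 * D' := mul_le_mul_of_nonneg_right hf1 hD0
  nlinarith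

theorem rho1_pi5 : rho1 (π / 5) ≤ -0.36 := by
  obtain ⟨a, b⟩ := sqrt5_bounds
  obtain ⟨s1, s2⟩ := sin_pi5_bounds
  obtain ⟨d1, d2⟩ := cD_bounds'
  have h1 := pi_gt_d6
  have h2 := pi_lt_d6
  have e2 : sin (2 * (π / 5)) = 2 * sin (π / 5) * ((1 + √5) / 4) := by
    rw [sin_two_mul, cos_pi_div_five]
  have e3 : sin (3 * (π / 5)) = 2 * sin (π / 5) * ((1 + √5) / 4) := by
    rw [← e2, ← sin_pi_sub]; congr 1; ring
  have e4 : sin (4 * (π / 5)) = sin (π / 5) := by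
    rw [← sin_pi_sub]; congr 1; ring
  unfold rho1 cP1 cP2
  rw [e2, e3, e4, cos_pi_div_five]
  set s := sin (π / 5)
  set f := (1 + √5) / 4 with hf
  have f1 : 0.809 < f := by rw [hf]; linarith
  have f2 : f < 0.80902 := by rw [hf]; linarith
  have k1 : 0.8 * 3.1415 * 0.809 ≤ (π - π / 5) * f := by nlinarith
  have k2 : s * f ≤ 0.587786 * 0.80902 := by nlinarith
  have k3 : 0.587785 * 0.809 ≤ s * f := by nlinarith
  have k4 : s * f * cD ≤ 0.587786 * 0.80902 * 1.20921 := by nlinarith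
  have k5 : 0.587785 * 1.20919 ≤ s * cD := by nlinarith
  nlinarith

theorem rho_tangent {x : ℝ} (h0 : 0 ≤ x) (h1 : x ≤ π) :
    0.0775 + rho1 (π / 5) * (x - π / 5) ≤ rho x := by
  have hp1 := pi_gt_d6
  have hp2 := pi_lt_d6
  have hK := rho1_pi5
  rcases le_total x 0.85 with hx | hx
  · have hm : MonotoneOn rho1 (Set.Icc 0 0.85) := by
      refine monotoneOn_of_deriv_nonneg (convex_Icc _ _)
        (fun y _ => (hasDerivAt_rho1 y).continuousAt.continuousWithinAt)
        (fun y _ => (hasDerivAt_rho1 y).differentiableAt.differentiableWithinAt) ?_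
      intro y hy
      rw [interior_Icc] at hy
      rw [(hasDerivAt_rho1 y).deriv]
      exact rho2_nonneg hy.1.le hy.2.le
    set K := rho1 (π / 5) with hKd
    have hmem : π / 5 ∈ Set.Icc (0:ℝ) 0.85 := ⟨by linarith, by linarith⟩
    have hd : ∀ y, HasDerivAt (fun y => rho y - K * y) (rho1 y - K) y := fun y => by
      have := (hasDerivAt_rho y).sub ((hasDerivAt_id y).const_mul K)
      exact this.congr_deriv (by simp)
    have hv := rho_pi5
    rcases le_total x (π / 5) with hx5 | hx5
    · have ha : AntitoneOn (fun y => rho y - K * y) (Set.Icc 0 (π / 5)) := by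
        refine antitoneOn_of_deriv_nonpos (convex_Icc _ _)
          (fun y _ => (hd y).continuousAt.continuousWithinAt)
          (fun y _ => (hd y).differentiableAt.differentiableWithinAt) ?_
        intro y hy
        rw [interior_Icc] at hy
        rw [(hd y).deriv]
        have := hm ⟨hy.1.le, by linarith [hy.2]⟩ hmem hy.2.le
        linarith
      have := ha ⟨h0, hx5⟩ ⟨by linarith, le_rfl⟩ hx5
      simp only at this
      linarith
    · have ha : MonotoneOn (fun y => rho y - K * y) (Set.Icc (π / 5) 0.85) := by
        refine monotoneOn_of_deriv_nonneg (convex_Icc _ _)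
          (fun y _ => (hd y).continuousAt.continuousWithinAt)
          (fun y _ => (hd y).differentiableAt.differentiableWithinAt) ?_
        intro y hy
        rw [interior_Icc] at hy
        rw [(hd y).deriv]
        have := hm hmem ⟨by linarith [hy.1], hy.2.le⟩ hy.1.le
        linarith
      have := ha ⟨le_rfl, by linarith⟩ ⟨hx5, hx⟩ hx5
      simp only at this
      linarith
  · have : 0 ≤ rho x := by rw [rho_eq]; exact rfun_nonneg (by linarith) (by linarith)
    nlinarith

theorem rfun_star (Γ : Fin 5 → ℝ) (h0 : ∀ j, 0 ≤ Γ j) (h1 : ∀ j, Γ j ≤ π)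
    (hs : ∑ j, Γ j = 4 * π) : 5 * 0.0775 ≤ ∑ j, rfun (Γ j) := by
  have : ∀ j, 0.0775 + rho1 (π / 5) * ((π - Γ j) - π / 5) ≤ rfun (Γ j) := by
    intro j
    have := rho_tangent (x := π - Γ j) (by linarith [h1 j]) (by linarith [h0 j])
    rwa [rho_eq, sub_sub_cancel] at this
  refine le_trans (le_of_eq ?_) (Finset.sum_le_sum fun j _ => this j)
  rw [Finset.sum_add_distrib, ← Finset.mul_sum, Finset.sum_sub_distrib, Finset.sum_sub_distrib, hs]
  simp
  right; ring


theorem abs_sin_periodic : Function.Periodic (fun t : ℝ => |sin t|) π := by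
  intro t; simp [sin_add_pi]

theorem abs_sin_ii (a b : ℝ) : IntervalIntegrable (fun t : ℝ => |sin t|) volume a b :=
  (by fun_prop : Continuous (fun t : ℝ => |sin t|)).intervalIntegrable _ _

theorem abs_sin_int (x : ℝ) : ∫ t in x..(x + 3 * π), |sin t| = 6 := by
  have h := abs_sin_periodic.intervalIntegral_add_zsmul_eq 3 x (fun a b => abs_sin_ii a b)
  have e : x + (3:ℤ) • π = x + 3 * π := by simp
  rw [e] at h
  rw [h, abs_sin_periodic.intervalIntegral_add_eq x 0, zero_add]
  have : ∫ t in (0:ℝ)..π, |sin t| = ∫ t in (0:ℝ)..π, sin t := by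
    refine intervalIntegral.integral_congr fun t ht => ?_
    rw [Set.uIcc_of_le pi_pos.le] at ht
    exact abs_of_nonneg (sin_nonneg_of_nonneg_of_le_pi ht.1 ht.2)
  rw [this, integral_sin]
  simp; norm_num

theorem cos_diff_le {a b : ℝ} (h : a ≤ b) : |cos a - cos b| ≤ ∫ t in a..b, |sin t| := by
  rw [← integral_sin]
  exact intervalIntegral.abs_integral_le_integral_abs h

theorem alt_cos (x0 x1 x2 x3 x4 x5 : ℝ) (h0 : x0 ≤ x1) (h1 : x1 ≤ x2) (h2 : x2 ≤ x3) (h3 : x3 ≤ x4)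
    (h4 : x4 ≤ x5) (h5 : x5 = x0 + 3 * π) :
    cos x0 - cos x1 + cos x2 - cos x3 + cos x4 ≤ 3 := by
  have e := abs_sin_int x0
  rw [← h5, ← intervalIntegral.integral_add_adjacent_intervals (abs_sin_ii x0 x1) (abs_sin_ii x1 x5),
    ← intervalIntegral.integral_add_adjacent_intervals (abs_sin_ii x1 x2) (abs_sin_ii x2 x5),
    ← intervalIntegral.integral_add_adjacent_intervals (abs_sin_ii x2 x3) (abs_sin_ii x3 x5),
    ← intervalIntegral.integral_add_adjacent_intervals (abs_sin_ii x3 x4) (abs_sin_ii x4 x5)] at e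
  have a0 := (le_abs_self _).trans (cos_diff_le h0)
  have a1 := (neg_le_abs _).trans (cos_diff_le h1)
  have a2 := (le_abs_self _).trans (cos_diff_le h2)
  have a3 := (neg_le_abs _).trans (cos_diff_le h3)
  have a4 := (le_abs_self _).trans (cos_diff_le h4)
  have : cos x5 = -cos x0 := by
    rw [h5, show x0 + 3 * π = x0 + π + 2 * π by ring, cos_add_two_pi, cos_add_pi]
  linarith

theorem star_cos3 (v : Fin 6 → ℝ)
    (hΓ : ∀ j : Fin 5, v j.succ - v j.castSucc ≤ π) (h5 : v 5 = v 0 + 4 * π) (α : ℝ) :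
    ∑ j : Fin 5, cos (3 * v j.castSucc - α) ≤ 3 := by
  have g0 := hΓ 0
  have g1 := hΓ 1
  have g2 := hΓ 2
  have g3 := hΓ 3
  have g4 := hΓ 4
  simp only [Fin.succ_zero_eq_one, Fin.castSucc_zero] at g0
  change v 2 - v 1 ≤ π at g1
  change v 3 - v 2 ≤ π at g2
  change v 4 - v 3 ≤ π at g3
  change v 5 - v 4 ≤ π at g4
  have key := alt_cos ((0:ℕ) * π - (3 * v 0 - α)) ((3:ℕ) * π - (3 * v 1 - α))
    ((6:ℕ) * π - (3 * v 2 - α)) ((9:ℕ) * π - (3 * v 3 - α)) ((12:ℕ) * π - (3 * v 4 - α))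
    ((15:ℕ) * π - (3 * v 5 - α)) (by push_cast; linarith) (by push_cast; linarith)
    (by push_cast; linarith) (by push_cast; linarith) (by push_cast; linarith)
    (by push_cast; linarith)
  simp only [cos_nat_mul_pi_sub] at key
  rw [Fin.sum_univ_five]
  change cos (3 * v 0 - α) + cos (3 * v 1 - α) + cos (3 * v 2 - α) + cos (3 * v 3 - α)
    + cos (3 * v 4 - α) ≤ 3
  norm_num at key
  linarith


theorem sum_cos_sq {ι : Type*} [Fintype ι] (r φ : ι → ℝ) (k : ℝ) :
    ∑ a, ∑ b, r a * r b * cos (k * (φ b - φ a)) =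
      (∑ a, r a * cos (k * φ a)) ^ 2 + (∑ a, r a * sin (k * φ a)) ^ 2 := by
  rw [sq, sq, Finset.sum_mul_sum, Finset.sum_mul_sum, ← Finset.sum_add_distrib]
  refine Finset.sum_congr rfl fun a _ => ?_
  rw [← Finset.sum_add_distrib]
  refine Finset.sum_congr rfl fun b _ => ?_
  rw [mul_sub, cos_sub]; ring

theorem cosk_arccos (x : ℝ) : cos (2 * arccos (cos x)) = cos (2 * x) ∧
    cos (3 * arccos (cos x)) = cos (3 * x) ∧ cos (4 * arccos (cos x)) = cos (4 * x) := by
  refine ⟨?_, ?_, ?_⟩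
  · rw [cos_two_mul, cos_two_mul, cos_arccos_cos]
  · rw [cos_three_mul, cos_three_mul, cos_arccos_cos]
  · rw [cos_four_mul', cos_four_mul', cos_arccos_cos]

theorem S_bound {ι : Type*} [Fintype ι] (r φ : ι → ℝ)
    (h0 : ∑ i, r i * cos (φ i) = 0) (h1 : ∑ i, r i * sin (φ i) = 0) :
    ∑ a, ∑ b, r a * r b * (arccos (cos (φ b - φ a)) * sin (arccos (cos (φ b - φ a)))) ≤
      cD * (∑ i, r i) ^ 2 - 106/1000 * ((∑ i, r i) ^ 2 - ((∑ a, r a * cos (3 * φ a)) ^ 2 +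
        (∑ a, r a * sin (3 * φ a)) ^ 2))
      - ∑ a, ∑ b, r a * r b * rfun (arccos (cos (φ b - φ a))) := by
  obtain ⟨d1, d2⟩ := cD_bounds
  have e1 := sum_cos_sq r φ 1
  have e2 := sum_cos_sq r φ 2
  have e3 := sum_cos_sq r φ 3
  have e4 := sum_cos_sq r φ 4
  have er : (∑ i, r i) ^ 2 = ∑ a, ∑ b, r a * r b := by rw [sq, Finset.sum_mul_sum]
  simp only [one_mul] at e1
  rw [h0, h1] at e1
  have hS : ∑ a, ∑ b, r a * r b * (arccos (cos (φ b - φ a)) * sin (arccos (cos (φ b - φ a)))) =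
      (cD - 106/1000) * ∑ a, ∑ b, r a * r b
      - cP1 * ∑ a, ∑ b, r a * r b * cos (φ b - φ a)
      - cP2 * ∑ a, ∑ b, r a * r b * cos (2 * (φ b - φ a))
      - 11/400 * ∑ a, ∑ b, r a * r b * cos (4 * (φ b - φ a))
      + 106/1000 * ∑ a, ∑ b, r a * r b * cos (3 * (φ b - φ a))
      - ∑ a, ∑ b, r a * r b * rfun (arccos (cos (φ b - φ a))) := by
    simp only [Finset.mul_sum, ← Finset.sum_sub_distrib, ← Finset.sum_add_distrib]
    refine Finset.sum_congr rfl fun a _ => Finset.sum_congr rfl fun b _ => ?_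
    obtain ⟨k2, k3, k4⟩ := cosk_arccos (φ b - φ a)
    have k1 := cos_arccos_cos (φ b - φ a)
    unfold rfun
    rw [k1, k2, k3, k4]
    ring
  rw [hS, e1, e2, e3, e4, er]
  have p2 : 0 ≤ cP2 := by unfold cP2; linarith
  have q2 := mul_nonneg p2 (add_nonneg (sq_nonneg (∑ a, r a * cos (2 * φ a))) (sq_nonneg (∑ a, r a * sin (2 * φ a))))
  have q4 := add_nonneg (sq_nonneg (∑ a, r a * cos (4 * φ a))) (sq_nonneg (∑ a, r a * sin (4 * φ a)))
  linarith

/-- the length of a vector of sums as a projection -/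
theorem exists_proj {ι : Type*} [Fintype ι] (r ψ : ι → ℝ) :
    ∃ α : ℝ, (∑ a, r a * cos (ψ a)) ^ 2 + (∑ a, r a * sin (ψ a)) ^ 2 =
      (∑ a, r a * cos (ψ a - α)) ^ 2 ∧ 0 ≤ ∑ a, r a * cos (ψ a - α) := by
  set X := ∑ a, r a * cos (ψ a) with hX
  set Y := ∑ a, r a * sin (ψ a) with hY
  let z : ℂ := ⟨X, Y⟩
  refine ⟨Complex.arg z, ?_⟩
  have hx : ‖z‖ * cos (Complex.arg z) = X := Complex.norm_mul_cos_arg z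
  have hy : ‖z‖ * sin (Complex.arg z) = Y := Complex.norm_mul_sin_arg z
  have hsum : ∑ a, r a * cos (ψ a - Complex.arg z) = ‖z‖ := by
    have : ∑ a, r a * cos (ψ a - Complex.arg z) = X * cos (Complex.arg z) + Y * sin (Complex.arg z) := by
      rw [hX, hY, Finset.sum_mul, Finset.sum_mul, ← Finset.sum_add_distrib]
      refine Finset.sum_congr rfl fun a _ => ?_
      rw [cos_sub]; ring
    rw [this, ← hx, ← hy]
    linear_combination ‖z‖ * cos_sq_add_sin_sq (Complex.arg z)
  rw [hsum]
  refine ⟨?_, norm_nonneg _⟩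
  rw [← hx, ← hy]
  linear_combination ‖z‖ ^ 2 * cos_sq_add_sin_sq (Complex.arg z)

theorem sub_sum_le {ι : Type*} [Fintype ι] (f : ι → ℝ) (hf : ∀ i, 0 ≤ f i) (e : Fin 5 → ι)
    (he : Function.Injective e) : ∑ j, f (e j) ≤ ∑ i, f i := by
  classical
  rw [← Finset.sum_image (s := Finset.univ) (g := e) (f := f) (fun a _ b _ h => he h)]
  exact Finset.sum_le_sum_of_subset_of_nonneg (Finset.subset_univ _) (fun i _ _ => hf i)

theorem S_nostar {ι : Type*} [Fintype ι] (r φ : ι → ℝ) (hr : ∀ i, 0 ≤ r i)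
    (h0 : ∑ i, r i * cos (φ i) = 0) (h1 : ∑ i, r i * sin (φ i) = 0) :
    ∑ a, ∑ b, r a * r b * (arccos (cos (φ b - φ a)) * sin (arccos (cos (φ b - φ a)))) ≤
      cD * (∑ i, r i) ^ 2 := by
  refine (S_bound r φ h0 h1).trans ?_
  obtain ⟨α, hα, hα0⟩ := exists_proj r (fun a => 3 * φ a)
  rw [hα]
  have h2 : ∑ a, r a * cos (3 * φ a - α) ≤ ∑ i, r i :=
    Finset.sum_le_sum fun i _ => mul_le_of_le_one_right (hr i) (cos_le_one _)
  have h3 : 0 ≤ ∑ a, ∑ b, r a * r b * rfun (arccos (cos (φ b - φ a))) :=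
    Finset.sum_nonneg fun a _ => Finset.sum_nonneg fun b _ =>
      mul_nonneg (mul_nonneg (hr a) (hr b)) (rfun_nonneg (arccos_nonneg _) (arccos_le_pi _))
  have h4 := pow_le_pow_left₀ hα0 h2 2
  linarith

theorem sum25 (F : Fin 5 → Fin 5 → ℝ) (hF : ∀ i j, 0 ≤ F i j) :
    (F 0 1 + F 1 2 + F 2 3 + F 3 4 + F 4 0) + (F 1 0 + F 2 1 + F 3 2 + F 4 3 + F 0 4) ≤
      ∑ i, ∑ j, F i j := by
  simp only [Fin.sum_univ_five]
  have := hF 0 0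
  have := hF 0 2
  have := hF 0 3
  have := hF 1 1
  have := hF 1 3
  have := hF 1 4
  have := hF 2 0
  have := hF 2 2
  have := hF 2 4
  have := hF 3 0
  have := hF 3 1
  have := hF 3 3
  have := hF 4 1
  have := hF 4 2
  have := hF 4 4
  linarith

theorem S_star {ι : Type*} [Fintype ι] (r φ : ι → ℝ) (hr : ∀ i, 0 ≤ r i)
    (h0 : ∑ i, r i * cos (φ i) = 0) (h1 : ∑ i, r i * sin (φ i) = 0)
    (e : Fin 5 → ι) (he : Function.Injective e) (v : Fin 6 → ℝ)
    (hv : ∀ j : Fin 5, cos (φ (e j)) = cos (v j.castSucc) ∧ sin (φ (e j)) = sin (v j.castSucc))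
    (hΓ : ∀ j : Fin 5, 0 ≤ v j.succ - v j.castSucc ∧ v j.succ - v j.castSucc ≤ π)
    (h5 : v 5 = v 0 + 4 * π) (τ : ℝ) (hτ : 0 ≤ τ) (hτr : ∀ j, τ ≤ r (e j)) :
    ∑ a, ∑ b, r a * r b * (arccos (cos (φ b - φ a)) * sin (arccos (cos (φ b - φ a)))) ≤
      cD * (∑ i, r i) ^ 2 - 424/1000 * τ * (∑ i, r i - τ) - 0.775 * τ ^ 2 := by
  refine (S_bound r φ h0 h1).trans ?_
  obtain ⟨α, hα, hα0⟩ := exists_proj r (fun a => 3 * φ a)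
  rw [hα]
  have h2 : ∑ a, r a * cos (3 * φ a - α) ≤ ∑ i, r i - 2 * τ := by
    have k1 := sub_sum_le (fun i => r i * (1 - cos (3 * φ i - α)))
      (fun i => mul_nonneg (hr i) (by linarith [cos_le_one (3 * φ i - α)])) e he
    have k2 : ∀ j : Fin 5, τ * (1 - cos (3 * v j.castSucc - α)) ≤
        r (e j) * (1 - cos (3 * φ (e j) - α)) := by
      intro j
      have : cos (3 * φ (e j) - α) = cos (3 * v j.castSucc - α) := by
        rw [cos_sub, cos_sub, cos_three_mul, cos_three_mul, sin_three_mul, sin_three_mul,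
          (hv j).1, (hv j).2]
      rw [this]
      exact mul_le_mul_of_nonneg_right (hτr j) (by linarith [cos_le_one (3 * v j.castSucc - α)])
    have k3 := Finset.sum_le_sum (s := Finset.univ) fun j _ => k2 j
    have k4 := star_cos3 v (fun j => (hΓ j).2) h5 α
    rw [← Finset.mul_sum, Finset.sum_sub_distrib] at k3
    simp only [Finset.sum_const, Finset.card_univ, Fintype.card_fin, nsmul_eq_mul] at k3
    have k5 : ∑ i, r i * (1 - cos (3 * φ i - α)) = ∑ i, r i - ∑ a, r a * cos (3 * φ a - α) := by
      rw [← Finset.sum_sub_distrib]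
      exact Finset.sum_congr rfl fun i _ => by ring
    rw [k5] at k1
    push_cast at k3
    have k6 := mul_le_mul_of_nonneg_left k4 hτ
    linarith
  have hF0 : ∀ a b, 0 ≤ r a * r b * rfun (arccos (cos (φ b - φ a))) := fun a b =>
      mul_nonneg (mul_nonneg (hr a) (hr b)) (rfun_nonneg (arccos_nonneg _) (arccos_le_pi _))
  have h3 : τ ^ 2 * (10 * 0.0775) ≤ ∑ a, ∑ b, r a * r b * rfun (arccos (cos (φ b - φ a))) := by
    set F : ι → ι → ℝ := fun a b => r a * r b * rfun (arccos (cos (φ b - φ a))) with hF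
    have m1 : ∑ i, ∑ j, F (e i) (e j) ≤ ∑ a, ∑ b, F a b :=
      (Finset.sum_le_sum fun i _ => sub_sum_le (F (e i)) (hF0 (e i)) e he).trans
        (sub_sum_le (fun a => ∑ b, F a b) (fun a => Finset.sum_nonneg fun b _ => hF0 a b) e he)
    have m2 := sum25 (fun i j => F (e i) (e j)) (fun i j => hF0 _ _)
    have m3 := rfun_star (fun j => v j.succ - v j.castSucc) (fun j => (hΓ j).1) (fun j => (hΓ j).2)
      (by
        rw [Fin.sum_univ_five]
        change (v 1 - v 0) + (v 2 - v 1) + (v 3 - v 2) + (v 4 - v 3) + (v 5 - v 4) = 4 * π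
        linarith)
    -- comparison of angles
    have hc : ∀ (j : Fin 5) (a b : ι), cos (φ b - φ a) = cos (v j.succ - v j.castSucc) →
        τ ≤ r a → τ ≤ r b → τ ^ 2 * rfun (v j.succ - v j.castSucc) ≤ F a b := by
      intro j a b h ha hb
      simp only [hF]
      rw [h, arccos_cos (hΓ j).1 (hΓ j).2]
      refine mul_le_mul_of_nonneg_right ?_ (rfun_nonneg (hΓ j).1 (hΓ j).2)
      rw [sq]
      exact mul_le_mul ha hb hτ (hτ.trans ha)
    have hcs : ∀ (i j : Fin 5), cos (φ (e j) - φ (e i)) = cos (v j.castSucc - v i.castSucc) := by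
      intro i j
      rw [cos_sub, cos_sub, (hv i).1, (hv i).2, (hv j).1, (hv j).2]
    have hcs' : ∀ (i j : Fin 5), cos (φ (e i) - φ (e j)) = cos (v j.castSucc - v i.castSucc) := by
      intro i j
      rw [← hcs, ← cos_neg, neg_sub]
    have hlast : cos (v 0 - v 4) = cos (v 5 - v 4) := by
      rw [h5, show v 0 + 4 * π - v 4 = v 0 - v 4 + 2 * π + 2 * π by ring, cos_add_two_pi,
        cos_add_two_pi]
    have n0 := hc 0 (e 0) (e 1) (hcs 0 1) (hτr 0) (hτr 1)
    have n1 := hc 1 (e 1) (e 2) (hcs 1 2) (hτr 1) (hτr 2)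
    have n2 := hc 2 (e 2) (e 3) (hcs 2 3) (hτr 2) (hτr 3)
    have n3 := hc 3 (e 3) (e 4) (hcs 3 4) (hτr 3) (hτr 4)
    have n4 := hc 4 (e 4) (e 0) ((hcs 4 0).trans hlast) (hτr 4) (hτr 0)
    have n0' := hc 0 (e 1) (e 0) (hcs' 0 1) (hτr 1) (hτr 0)
    have n1' := hc 1 (e 2) (e 1) (hcs' 1 2) (hτr 2) (hτr 1)
    have n2' := hc 2 (e 3) (e 2) (hcs' 2 3) (hτr 3) (hτr 2)
    have n3' := hc 3 (e 4) (e 3) (hcs' 3 4) (hτr 4) (hτr 3)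
    have n4' := hc 4 (e 0) (e 4) ((hcs' 4 0).trans hlast) (hτr 0) (hτr 4)
    rw [Fin.sum_univ_five] at m3
    have m4 := mul_le_mul_of_nonneg_left m3 (sq_nonneg τ)
    linarith
  have h4 := pow_le_pow_left₀ hα0 h2 2
  nlinarith

theorem S_final_nostar {ι : Type*} [Fintype ι] (r φ : ι → ℝ) (hr : ∀ i, 0 ≤ r i)
    (h0 : ∑ i, r i * cos (φ i) = 0) (h1 : ∑ i, r i * sin (φ i) = 0) (h2 : ∑ i, r i ^ 2 = 2) :
    ∑ a, ∑ b, r a * r b * (arccos (cos (φ b - φ a)) * sin (arccos (cos (φ b - φ a)))) ≤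
      2 * cD * (Fintype.card ι) := by
  refine (S_nostar r φ hr h0 h1).trans ?_
  have := sq_sum_le_card_mul_sum_sq (s := (Finset.univ : Finset ι)) (f := r)
  rw [h2, Finset.card_univ] at this
  have hD : 0 ≤ cD := by linarith [cD_bounds.1]
  nlinarith

theorem quad_psd {N D δ τ y : ℝ} (hN : 0 < N) (hD : 0 < D) (hδ : δ < 1)
    (hq : N * (D - 0.212) ^ 2 ≤ (N * D + 0.775 - δ * D) * (D * (1 - δ))) :
    δ * D * (τ ^ 2 + N * y ^ 2) ≤ N * (0.424 * τ * y + D * (τ - y) ^ 2) + 0.775 * τ ^ 2 := by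
  have hc : 0 < D * (1 - δ) := mul_pos hD (by linarith)
  have key : D * (1 - δ) * (N * (0.424 * τ * y + D * (τ - y) ^ 2) + 0.775 * τ ^ 2
      - δ * D * (τ ^ 2 + N * y ^ 2)) =
      N * (D * (1 - δ) * y - (D - 0.212) * τ) ^ 2 +
      τ ^ 2 * ((N * D + 0.775 - δ * D) * (D * (1 - δ)) - N * (D - 0.212) ^ 2) := by ring
  have h2 : 0 ≤ D * (1 - δ) * (N * (0.424 * τ * y + D * (τ - y) ^ 2) + 0.775 * τ ^ 2
      - δ * D * (τ ^ 2 + N * y ^ 2)) := by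
    rw [key]
    have := mul_nonneg (sq_nonneg τ) (sub_nonneg.mpr hq)
    positivity
  have := nonneg_of_mul_nonneg_right h2 hc
  linarith

theorem S_final_star {ι : Type*} [Fintype ι] (g0 g1 r φ : ι → ℝ)
    (hrd : ∀ i, r i = √(g0 i ^ 2 + g1 i ^ 2))
    (hg0 : ∀ i, g0 i = r i * cos (φ i)) (hg1 : ∀ i, g1 i = r i * sin (φ i))
    (h0 : ∑ i, g0 i = 0) (h1 : ∑ i, g1 i = 0) (h2 : ∑ i, r i ^ 2 = 2)
    (hst : StarData g0 g1) (δ : ℝ) (hδ0 : 0 ≤ δ) (hδ : δ < 1)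
    (hq : ((Fintype.card ι : ℝ) - 1) * (cD - 0.212) ^ 2 ≤
      (((Fintype.card ι : ℝ) - 1) * cD + 0.775 - δ * cD) * (cD * (1 - δ))) :
    ∑ a, ∑ b, r a * r b * (arccos (cos (φ b - φ a)) * sin (arccos (cos (φ b - φ a)))) ≤
      2 * cD * (Fintype.card ι - δ) := by
  classical
  have hr : ∀ i, 0 ≤ r i := fun i => by rw [hrd]; positivity
  have h0' : ∑ i, r i * cos (φ i) = 0 := by rw [← h0]; exact Finset.sum_congr rfl fun i _ => (hg0 i).symm
  have h1' : ∑ i, r i * sin (φ i) = 0 := by rw [← h1]; exact Finset.sum_congr rfl fun i _ => (hg1 i).symm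
  obtain ⟨e, v, he, hv, hΓ, h5⟩ := hst
  obtain ⟨j0, hj0⟩ := Finite.exists_min (fun j => r (e j))
  set τ := r (e j0) with hτ
  have hτ0 : 0 ≤ τ := hr _
  have hD : 0 < cD := by linarith [cD_bounds.1]
  have hS : ∑ a, ∑ b, r a * r b * (arccos (cos (φ b - φ a)) * sin (arccos (cos (φ b - φ a)))) ≤
      cD * (∑ i, r i) ^ 2 - 424/1000 * τ * (∑ i, r i - τ) - 0.775 * τ ^ 2 := by
    rcases eq_or_lt_of_le hτ0 with hz | hz
    · rw [← hz]
      have := S_nostar r φ hr h0' h1'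
      simpa using this
    · refine S_star r φ hr h0' h1' e he v ?_ hΓ h5 τ hτ0 hj0
      intro j
      have hp : 0 < r (e j) := lt_of_lt_of_le hz (hj0 j)
      have := hv j
      rw [← hrd] at this
      constructor
      · exact mul_left_cancel₀ hp.ne' ((hg0 (e j)).symm.trans this.1)
      · exact mul_left_cancel₀ hp.ne' ((hg1 (e j)).symm.trans this.2)
  refine hS.trans ?_
  have hcard : 5 ≤ Fintype.card ι := by simpa using Fintype.card_le_of_injective e he
  have hcR : (5:ℝ) ≤ Fintype.card ι := by exact_mod_cast hcard
  set N : ℝ := (Fintype.card ι : ℝ) - 1 with hN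
  have hNp : 0 < N := by rw [hN]; linarith
  have hsp := Finset.add_sum_erase Finset.univ r (Finset.mem_univ (e j0))
  have hsp2 := Finset.add_sum_erase Finset.univ (fun i => r i ^ 2) (Finset.mem_univ (e j0))
  have hcs := sq_sum_le_card_mul_sum_sq (s := (Finset.univ : Finset ι).erase (e j0)) (f := r)
  rw [Finset.card_erase_of_mem (Finset.mem_univ _), Finset.card_univ, Nat.cast_sub (by omega),
    Nat.cast_one, ← hN] at hcs
  rw [h2] at hsp2
  rw [← hsp]
  set T := ∑ x ∈ Finset.univ.erase (e j0), r x with hT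
  set Q := ∑ x ∈ Finset.univ.erase (e j0), r x ^ 2 with hQ
  obtain ⟨y, hy⟩ : ∃ y, T = N * y := ⟨T / N, by field_simp⟩
  have hy2 : N * y ^ 2 ≤ Q := by
    rw [hy] at hcs
    have : N * (N * y ^ 2) ≤ N * Q := by linarith
    exact le_of_mul_le_mul_left this hNp
  have hpsd := quad_psd (τ := τ) (y := y) hNp hD hδ hq
  have hn : (Fintype.card ι : ℝ) = N + 1 := by rw [hN]; ring
  rw [← hτ] at hsp2 ⊢
  rw [hn, hy]
  have hQ2 : τ ^ 2 + N * y ^ 2 ≤ 2 := by linarith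
  have hfin : cD * (N + 1 - δ) * (τ ^ 2 + N * y ^ 2) ≤ cD * (N + 1 - δ) * 2 :=
    mul_le_mul_of_nonneg_left hQ2 (mul_nonneg hD.le (by linarith))
  nlinarith


/-- The square of the (rescaled) volume of a regular simplex inscribed in the unit sphere. -/
noncomputable def Qf (k : ℕ) : ℝ := ((k:ℝ) + 1) ^ (k + 1) / (k:ℝ) ^ k

theorem Qf_pos (k : ℕ) : 0 < Qf k := by
  unfold Qf
  rcases Nat.eq_zero_or_pos k with rfl | h
  · norm_num
  · have : (0:ℝ) < k := by exact_mod_cast h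
    positivity

theorem Qf_ratio_lower (m : ℕ) (hm : 1 ≤ m) : ((m:ℝ) + 2) / (m + 1) * Qf m ≤ Qf (m + 1) := by
  have hm0 : (0:ℝ) < m := by exact_mod_cast hm
  have hb := one_add_mul_le_pow (a := -(1 / ((m:ℝ) + 1) ^ 2)) (by
    have : 1 / ((m:ℝ) + 1) ^ 2 ≤ 1 := by
      rw [div_le_one (by positivity)]; nlinarith
    linarith) m
  have e : 1 + -(1 / ((m:ℝ) + 1) ^ 2) = m * (m + 2) / (m + 1) ^ 2 := by field_simp; ring
  rw [e, div_pow, mul_pow] at hb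
  unfold Qf
  push_cast
  have h1 : ((m:ℝ) + 1) ≤ (m + 2) * (1 + m * -(1 / ((m:ℝ) + 1) ^ 2)) := by
    have : (m + 2) * (1 + m * -(1 / ((m:ℝ) + 1) ^ 2)) - (m + 1) = 1 / (m + 1) ^ 2 := by
      field_simp; ring
    have : 0 < 1 / ((m:ℝ) + 1) ^ 2 := by positivity
    linarith
  have h2 : ((m:ℝ) + 1) ≤ (m + 2) * ((m:ℝ) ^ m * (m + 2) ^ m / ((m + 1) ^ 2) ^ m) :=
    h1.trans (mul_le_mul_of_nonneg_left hb (by positivity))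
  rw [← mul_div_assoc, le_div_iff₀ (by positivity)] at h2
  rw [div_mul_div_comm, div_le_div_iff₀ (by positivity) (by positivity)]
  have h3 := mul_le_mul_of_nonneg_left h2 (show (0:ℝ) ≤ (m + 2) * (m + 1) by positivity)
  have e1 : ((m:ℝ) + 1 + 1) = m + 2 := by ring
  rw [e1]
  calc _ = ((m:ℝ) + 2) * (m + 1) * ((m + 1) * ((m + 1) ^ 2) ^ m) := by rw [← pow_mul]; ring
    _ ≤ _ := h3
    _ = _ := by ring

theorem Qf_ratio_upper (m : ℕ) (hm : 1 ≤ m) : Qf (m + 1) ≤ ((m:ℝ) + 1) / m * Qf m := by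
  have hm0 : (0:ℝ) < m := by exact_mod_cast hm
  have hb := one_add_mul_le_pow (a := 1 / ((m:ℝ) * (m + 2))) (by
    have : 0 < 1 / ((m:ℝ) * (m + 2)) := by positivity
    linarith) (m + 1)
  have e : 1 + (1 / ((m:ℝ) * (m + 2))) = (m + 1) ^ 2 / (m * (m + 2)) := by field_simp; ring
  rw [e, div_pow, mul_pow] at hb
  unfold Qf
  push_cast at hb ⊢
  have h1 : ((m:ℝ) + 2) / (m + 1) ≤ (1 + (m + 1) * (1 / ((m:ℝ) * (m + 2)))) := by
    have : (1 + (m + 1) * (1 / ((m:ℝ) * (m + 2)))) - ((m:ℝ) + 2) / (m + 1) =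
      1 / (m * (m + 1) * (m + 2)) := by
      field_simp; ring
    have : 0 < 1 / ((m:ℝ) * (m + 1) * (m + 2)) := by positivity
    linarith
  have h2 := h1.trans hb
  rw [div_le_div_iff₀ (by positivity) (by positivity)] at h2
  rw [div_mul_div_comm, div_le_div_iff₀ (by positivity) (by positivity)]
  have e1 : ((m:ℝ) + 1 + 1) = m + 2 := by ring
  rw [e1]
  calc _ = ((m:ℝ) + 2) * ((m:ℝ) ^ (m + 1) * (m + 2) ^ (m + 1)) := by ring
    _ ≤ _ := h2
    _ = _ := by rw [← pow_mul]; ring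

/-- Best of the two rational parameters for a class of size `K + 1`. -/
noncomputable def aPar (m K : ℕ) : ℝ := if m + 1 ≤ K then (m:ℝ) + 1 else m

theorem aPar_pos (m K : ℕ) (hm : 1 ≤ m) : 0 < aPar m K := by
  have hm0 : (0:ℝ) < m := by exact_mod_cast hm
  unfold aPar; split_ifs <;> positivity

theorem class_factor (m K : ℕ) (hm : 1 ≤ m) :
    ((aPar m K + 1) / aPar m K) ^ K * (aPar m K + 1) ≤
      Qf m * (Qf (m + 1) / Qf m) ^ ((K:ℤ) - m) := by
  have hm0 : (0:ℝ) < m := by exact_mod_cast hm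
  have hQ := Qf_pos m
  have hQ1 := Qf_pos (m + 1)
  unfold aPar
  split_ifs with h
  · obtain ⟨s, rfl⟩ := Nat.exists_eq_add_of_le h
    have e : (((m + 1 + s : ℕ) : ℤ) - m) = ((s + 1 : ℕ) : ℤ) := by push_cast; ring
    rw [e, zpow_natCast, pow_succ]
    have h1 : ((m:ℝ) + 1 + 1) / (m + 1) ≤ Qf (m + 1) / Qf m := by
      rw [le_div_iff₀ hQ]
      have := Qf_ratio_lower m hm
      rwa [show (m:ℝ) + 1 + 1 = m + 2 by ring]
    have h2 := pow_le_pow_left₀ (by positivity) h1 s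
    calc _ = Qf (m + 1) * (((m:ℝ) + 1 + 1) / (m + 1)) ^ s := by
          rw [pow_add, Qf]; push_cast; rw [div_pow]; field_simp; ring
      _ ≤ Qf (m + 1) * (Qf (m + 1) / Qf m) ^ s := by gcongr
      _ = _ := by field_simp
  · obtain ⟨s, hs⟩ := Nat.exists_eq_add_of_le (show K ≤ m by omega)
    have e : ((K : ℤ) - m) = -(s : ℤ) := by rw [hs]; push_cast; ring
    rw [e, zpow_neg, zpow_natCast, ← div_eq_mul_inv, le_div_iff₀ (by positivity)]
    have h1 : Qf (m + 1) / Qf m ≤ ((m:ℝ) + 1) / m := by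
      rw [div_le_iff₀ hQ]
      exact Qf_ratio_upper m hm
    have h2 := pow_le_pow_left₀ (by positivity) h1 s
    calc _ ≤ (((m:ℝ) + 1) / m) ^ K * (m + 1) * (((m:ℝ) + 1) / m) ^ s := by gcongr
      _ = (((m:ℝ) + 1) / m) ^ (K + s) * (m + 1) := by ring
      _ = Qf m := by rw [← hs, Qf, div_pow]; field_simp; ring

theorem Qf_zpow (m k : ℕ) (hk : k = m ∨ k = m + 1) :
    Qf k = Qf m * (Qf (m + 1) / Qf m) ^ ((k:ℤ) - m) := by
  have hQ := Qf_pos m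
  rcases hk with rfl | rfl
  · simp
  · push_cast
    rw [show (m:ℤ) + 1 - m = 1 by ring, zpow_one]; field_simp

theorem prod_zpow {d : ℕ} (m : ℕ) (K : Fin 3 → ℕ) (h : ∑ i, K i = d) :
    ∏ i, (Qf m * (Qf (m + 1) / Qf m) ^ ((K i:ℤ) - m)) =
      Qf m ^ 3 * (Qf (m + 1) / Qf m) ^ ((d:ℤ) - 3 * m) := by
  have hr : Qf (m + 1) / Qf m ≠ 0 := (div_pos (Qf_pos _) (Qf_pos _)).ne'
  rw [Fin.prod_univ_three]
  rw [Fin.sum_univ_three] at h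
  have : ((d:ℤ) - 3 * m) = ((K 0:ℤ) - m) + ((K 1:ℤ) - m) + ((K 2:ℤ) - m) := by
    rw [← h]; push_cast; ring
  rw [this, zpow_add₀ hr, zpow_add₀ hr]
  ring

theorem three_class {d : ℕ} (q : Fin (d + 3) → Fin d → ℝ)
    (hq : ∀ i, ∑ j, q i j ^ 2 = 1) (m : ℕ) (hm : 1 ≤ m) (k : Fin 3 → ℕ)
    (hk : ∀ i, k i = m ∨ k i = m + 1) (hks : ∑ i, k i = d)
    (A B : Finset (Fin (d + 3))) (hAB : Disjoint A B) :
    bigDet q (fun i => if i ∈ A then 1 else 0) (fun i => if i ∈ B then 1 else 0) ^ 2 ≤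
      ∏ i, Qf (k i) := by
  classical
  have hT : ∏ i, Qf (k i) = Qf m ^ 3 * (Qf (m + 1) / Qf m) ^ ((d:ℤ) - 3 * m) := by
    rw [← prod_zpow m k hks]
    exact Finset.prod_congr rfl fun i _ => Qf_zpow m _ (hk i)
  have hT0 : 0 ≤ ∏ i, Qf (k i) := Finset.prod_nonneg fun i _ => (Qf_pos _).le
  set cls : Fin (d + 3) → Fin 3 := fun i => if i ∈ A then 1 else if i ∈ B then 2 else 0 with hcls
  have hA : (fun i => if i ∈ A then (1:ℝ) else 0) = fun i => if cls i = 1 then (1:ℝ) else 0 := by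
    funext i
    by_cases h : i ∈ A
    · simp [hcls, h]
    · by_cases h' : i ∈ B <;> simp [hcls, h, h']
  have hB : (fun i => if i ∈ B then (1:ℝ) else 0) = fun i => if cls i = 2 then (1:ℝ) else 0 := by
    funext i
    by_cases h : i ∈ A
    · have h' := Finset.disjoint_left.1 hAB h
      simp [hcls, h, h']
    · by_cases h' : i ∈ B <;> simp [hcls, h, h']
  rw [hA, hB]
  by_cases hne : ∀ k, 0 < (Finset.univ.filter fun i => cls i = k).card
  swap
  · push Not at hne
    obtain ⟨k0, hk0⟩ := hne
    have hemp : ∀ i, cls i ≠ k0 := by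
      intro i hi
      have : (Finset.univ.filter fun i => cls i = k0) = ∅ := Finset.card_eq_zero.1 (by omega)
      have h' : i ∈ (Finset.univ.filter fun i => cls i = k0) := by simp [hi]
      rw [this] at h'; simp at h'
    have hz : bigDet q (fun i => if cls i = 1 then (1:ℝ) else 0)
        (fun i => if cls i = 2 then (1:ℝ) else 0) = 0 := by
      fin_cases k0
      · have hv : (fun i => if cls i = 2 then (1:ℝ) else 0) =
            colComb q 0 1 - (fun i => if cls i = 1 then (1:ℝ) else 0) := by
          funext i
          have h0 : cls i ≠ 0 := hemp i
          have : cls i = 1 ∨ cls i = 2 := by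
            revert h0; generalize cls i = z; revert z; decide
          rcases this with h | h <;> simp [h, colComb]
        rw [hv, map_sub, bigDet_self, sub_zero, bigDet_swap, bigDet_colComb, neg_zero]
      · have hv : (fun i => if cls i = 1 then (1:ℝ) else 0) = 0 := by
          funext i; exact if_neg (hemp i)
        rw [hv]; simp
      · have hv : (fun i => if cls i = 2 then (1:ℝ) else 0) = 0 := by
          funext i; exact if_neg (hemp i)
        rw [hv]; simp
    rw [hz]; simpa using hT0
  set K : Fin 3 → ℕ := fun k => (Finset.univ.filter fun i => cls i = k).card - 1 with hK
  have hKc : ∀ k, (Finset.univ.filter fun i => cls i = k).card = K k + 1 := by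
    intro k; have := hne k; simp only [hK]; omega
  have hKs : ∑ k, K k = d := by
    have h1 := Finset.card_eq_sum_card_fiberwise (s := (Finset.univ : Finset (Fin (d+3))))
      (t := (Finset.univ : Finset (Fin 3))) (f := cls) (fun _ _ => Finset.mem_coe.2 (Finset.mem_univ _))
    simp only [hKc, Finset.card_univ, Fintype.card_fin, Finset.sum_add_distrib] at h1
    simp at h1
    omega
  set a : Fin 3 → ℝ := fun k => aPar m (K k) with ha
  have ha0 : ∀ k, 0 < a k := fun k => aPar_pos m _ hm
  have key := class_bound q hq cls (fun k => √(a k / (a k + 1))) (fun k => √(1 / (a k + 1)))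
    (fun k => Real.sqrt_pos.2 (by have := ha0 k; positivity))
    (fun k => Real.sqrt_pos.2 (by have := ha0 k; positivity))
    (fun k => by
      have := ha0 k
      rw [Real.sq_sqrt (by positivity), Real.sq_sqrt (by positivity)]; field_simp) K hKc
  set D := bigDet q (fun i => if cls i = 1 then (1:ℝ) else 0)
        (fun i => if cls i = 2 then (1:ℝ) else 0) with hD
  have hP : (∏ k, (√(a k / (a k + 1)) ^ K k * √(1 / (a k + 1)))) ^ 2 *
      ∏ k, (((a k + 1) / a k) ^ K k * (a k + 1)) = 1 := by
    rw [← Finset.prod_pow, ← Finset.prod_mul_distrib]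
    apply Finset.prod_eq_one
    intro k _
    have := ha0 k
    rw [mul_pow, ← pow_mul, mul_comm (K k), pow_mul, Real.sq_sqrt (by positivity),
      Real.sq_sqrt (by positivity)]
    have : (a k / (a k + 1)) ^ K k * ((a k + 1) / a k) ^ K k = 1 := by
      rw [← mul_pow]; field_simp; simp
    calc _ = ((a k / (a k + 1)) ^ K k * ((a k + 1) / a k) ^ K k) * (1 / (a k + 1) * (a k + 1)) := by
          ring
      _ = 1 := by rw [this]; field_simp
  set P := ∏ k, (√(a k / (a k + 1)) ^ K k * √(1 / (a k + 1))) with hPd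
  set F := ∏ k, (((a k + 1) / a k) ^ K k * (a k + 1)) with hF
  have hP0 : 0 ≤ P := Finset.prod_nonneg fun k _ => by positivity
  have hF0 : 0 ≤ F := Finset.prod_nonneg fun k _ => by have := ha0 k; positivity
  have h1 : D ^ 2 * P ^ 2 ≤ 1 := by
    have := pow_le_pow_left₀ (by positivity) key 2
    rw [mul_pow, sq_abs, one_pow] at this
    exact this
  have h2 : D ^ 2 ≤ F := by
    calc D ^ 2 = D ^ 2 * (P ^ 2 * F) := by rw [hP, mul_one]
      _ = (D ^ 2 * P ^ 2) * F := by ring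
      _ ≤ 1 * F := by gcongr
      _ = F := one_mul _
  refine h2.trans ?_
  rw [hT, ← prod_zpow m K hKs]
  exact Finset.prod_le_prod (fun k _ => by have := ha0 k; positivity)
    fun k _ => class_factor m (K k) hm


theorem num_A (d : ℕ) (hd : 0 < d) (V κ δ : ℝ) (hV : 0 ≤ V)
    (hκ : κ ^ 2 * ((1 / d) * (((d:ℝ) + 3) / d) ^ 2) ≤ (((d:ℝ) + 3) / d) ^ (d + 3))
    (h : 4 * π * V ≤ κ * (2 * cD * ((d:ℝ) + 3 - δ))) :
    27 * V ^ 2 ≤ (((d:ℝ) + 3) / d) ^ d * ((d:ℝ) + 3) * ((d:ℝ) + 3 - δ) ^ 2 := by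
  have hd' : (0:ℝ) < d := by exact_mod_cast hd
  have hs : 0 < √(3:ℝ) := Real.sqrt_pos.2 (by norm_num)
  have hs2 : √(3:ℝ) ^ 2 = 3 := Real.sq_sqrt (by norm_num)
  have h1 : 3 * √3 * V ≤ κ * ((d:ℝ) + 3 - δ) := by
    have e : κ * (2 * cD * ((d:ℝ) + 3 - δ)) = (4 * π) * (κ * ((d:ℝ) + 3 - δ) / (3 * √3)) := by
      unfold cD; field_simp; ring
    rw [e] at h
    have := le_of_mul_le_mul_left h (by positivity)
    rw [le_div_iff₀ (by positivity)] at this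
    linarith
  have h2 := pow_le_pow_left₀ (by positivity) h1 2
  have h3 : κ ^ 2 ≤ (((d:ℝ) + 3) / d) ^ d * ((d:ℝ) + 3) := by
    have e : (((d:ℝ) + 3) / d) ^ (d + 3) =
        ((((d:ℝ) + 3) / d) ^ d * ((d:ℝ) + 3)) * ((1 / d) * (((d:ℝ) + 3) / d) ^ 2) := by
      rw [pow_add]; field_simp
    rw [e] at hκ
    exact le_of_mul_le_mul_right hκ (by positivity)
  calc 27 * V ^ 2 = (3 * √3 * V) ^ 2 := by rw [mul_pow, mul_pow, hs2]; ring
    _ ≤ _ := h2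
    _ = κ ^ 2 * ((d:ℝ) + 3 - δ) ^ 2 := by ring
    _ ≤ _ := by gcongr

/-- weighted AM-GM -/
theorem num_amgm (d : ℕ) (hd : 0 < d) (a : ℝ) (ha : 0 < a) :
    (((d:ℝ) + 3) / d) ^ d * (((d:ℝ) + 3) / 3) ^ 3 ≤ ((a + 1) / a) ^ d * (a + 1) ^ 3 := by
  have hd' : (0:ℝ) < d := by exact_mod_cast hd
  have h := Real.geom_mean_le_arith_mean2_weighted (w₁ := d / ((d:ℝ) + 3)) (w₂ := 3 / ((d:ℝ) + 3))
    (p₁ := a / d) (p₂ := 1 / 3) (by positivity) (by positivity) (by positivity) (by positivity)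
    (by field_simp)
  have h2 := pow_le_pow_left₀ (by positivity) h (d + 3)
  rw [mul_pow, ← Real.rpow_natCast, ← Real.rpow_natCast, ← Real.rpow_mul (by positivity),
    ← Real.rpow_mul (by positivity)] at h2
  have e1 : (d:ℝ) / ((d:ℝ) + 3) * ((d + 3 : ℕ) : ℝ) = (d : ℕ) := by push_cast; field_simp
  have e2 : (3:ℝ) / ((d:ℝ) + 3) * ((d + 3 : ℕ) : ℝ) = (3 : ℕ) := by push_cast; field_simp
  have e3 : (d:ℝ) / ((d:ℝ) + 3) * (a / d) + 3 / ((d:ℝ) + 3) * (1 / 3) = (a + 1) / (d + 3) := by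
    field_simp
  rw [e1, e2, e3, Real.rpow_natCast, Real.rpow_natCast] at h2
  have h3 := mul_le_mul_of_nonneg_right h2
    (show (0:ℝ) ≤ ((d:ℝ) + 3) ^ (d + 3) / a ^ d by positivity)
  calc _ = (a / d) ^ d * (1 / 3) ^ 3 * (((d:ℝ) + 3) ^ (d + 3) / a ^ d) := by
        rw [div_pow, div_pow, div_pow, pow_add]; field_simp
    _ ≤ _ := h3
    _ = _ := by rw [div_pow, div_pow, pow_add]; field_simp

theorem num_T {d : ℕ} (m j : ℕ) (hd : d = 3 * m + j) (hj : j ≤ 3) (k : Fin 3 → ℕ)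
    (hk : ∀ i, k i = m ∨ k i = m + 1) (hks : ∑ i, k i = d) :
    ∏ i, Qf (k i) = Qf m ^ (3 - j) * Qf (m + 1) ^ j := by
  have hQ := Qf_pos m
  calc ∏ i, Qf (k i) = Qf m ^ 3 * (Qf (m + 1) / Qf m) ^ ((d:ℤ) - 3 * m) := by
        rw [← prod_zpow m k hks]
        exact Finset.prod_congr rfl fun i _ => Qf_zpow m _ (hk i)
    _ = Qf m ^ 3 * (Qf (m + 1) / Qf m) ^ j := by
        rw [show (d:ℤ) - 3 * m = (j:ℤ) by rw [hd]; push_cast; ring, zpow_natCast]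
    _ = _ := by
        obtain ⟨i, hi⟩ := Nat.exists_eq_add_of_le hj
        rw [hi, Nat.add_sub_cancel_left, div_pow, pow_add]; field_simp

theorem num_gen (d m j : ℕ) (hm : 3 ≤ m) (hj : j = 1 ∨ j = 2) (hd : d = 3 * m + j) (V : ℝ)
    (h : 27 * V ^ 2 ≤ (((d:ℝ) + 3) / d) ^ d * ((d:ℝ) + 3) * ((d:ℝ) + 3 - 0.312) ^ 2) :
    V ^ 2 ≤ Qf m ^ (3 - j) * Qf (m + 1) ^ j := by
  have hm0 : (3:ℝ) ≤ m := by exact_mod_cast hm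
  have hm1 : (0:ℝ) < m := by linarith
  have hd0 : 0 < d := by omega
  have hd' : (0:ℝ) < d := by exact_mod_cast hd0
  have hQ := Qf_pos m
  have hQ1 := Qf_pos (m + 1)
  set A := (((d:ℝ) + 3) / d) ^ d * (((d:ℝ) + 3) / 3) ^ 3 with hA
  set w := 1 - 0.312 / ((d:ℝ) + 3) with hw
  set c := ((m:ℝ) + 1) ^ 2 / (m * (m + 2)) with hc
  have hV : V ^ 2 ≤ A * w ^ 2 := by
    have : 27 * (A * w ^ 2) = (((d:ℝ) + 3) / d) ^ d * ((d:ℝ) + 3) * ((d:ℝ) + 3 - 0.312) ^ 2 := by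
      rw [hA, hw]; field_simp; ring
    linarith
  have hA0 : 0 < A := by positivity
  have ha := num_amgm d hd0 m hm1
  have hb := num_amgm d hd0 (m + 1) (by positivity)
  rw [← hA] at ha hb
  have hcw : c ^ 2 * w ^ 6 ≤ 1 := by
    have hw0 : 0 < w := by
      rw [hw, sub_pos, div_lt_one (by positivity)]; linarith
    have hc0 : 0 < c := by positivity
    have hn : (d:ℝ) + 3 ≤ 3 * m + 5 := by
      have : d + 3 ≤ 3 * m + 5 := by omega
      exact_mod_cast this
    set z := 0.312 / ((d:ℝ) + 3) with hz
    have hz0 : 0 < z := by positivity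
    have h1 : c ≤ (1 + z) ^ 3 := by
      have e : c = 1 + 1 / (m * (m + 2)) := by rw [hc]; field_simp; ring
      have : 1 / ((m:ℝ) * (m + 2)) ≤ 3 * z := by
        rw [hz, ← mul_div_assoc, div_le_div_iff₀ (by positivity) (by positivity)]
        nlinarith
      rw [e]
      nlinarith [sq_nonneg z, pow_pos hz0 3]
    have h2 : c * w ^ 3 ≤ 1 := by
      calc c * w ^ 3 ≤ (1 + z) ^ 3 * w ^ 3 := by gcongr
        _ = (1 - z ^ 2) ^ 3 := by rw [hw]; ring
        _ ≤ 1 := by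
          apply pow_le_one₀ _ (by nlinarith)
          have : 1 - z ^ 2 = (1 + z) * w := by rw [hw]; ring
          rw [this]; positivity
    calc c ^ 2 * w ^ 6 = (c * w ^ 3) ^ 2 := by ring
      _ ≤ 1 := pow_le_one₀ (by positivity) h2
  have hA3 : A ^ 3 ≤ (Qf m ^ (3 - j) * Qf (m + 1) ^ j) ^ 3 * c ^ 2 := by
    have e1 : (Qf m : ℝ) = ((m + 1) / m) ^ m * (m + 1) := by
      rw [Qf, div_pow]; field_simp; ring
    have e2 : (Qf (m + 1) : ℝ) = ((m + 1 + 1) / (m + 1)) ^ (m + 1) * (m + 1 + 1) := by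
      rw [Qf]; push_cast; rw [div_pow]; field_simp; ring
    have e3 : c = ((m + 1) / m) / ((m + 1 + 1) / (m + 1)) := by
      rw [hc]; field_simp; ring
    rw [e1, e2, e3]
    set α := ((m:ℝ) + 1) / m with hα
    set β := ((m:ℝ) + 1 + 1) / (m + 1) with hβ
    have hα0 : 0 < α := by positivity
    have hβ0 : 0 < β := by positivity
    clear_value α β
    rcases hj with rfl | rfl
    · calc A ^ 3 = A * A * A := by ring
        _ ≤ (α ^ d * (m + 1) ^ 3) * (α ^ d * (m + 1) ^ 3) * (β ^ d * (m + 1 + 1) ^ 3) := by gcongr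
        _ = _ := by
          rw [hd]; norm_num
          rw [div_pow]; field_simp; ring
    · calc A ^ 3 = A * A * A := by ring
        _ ≤ (α ^ d * (m + 1) ^ 3) * (β ^ d * (m + 1 + 1) ^ 3) * (β ^ d * (m + 1 + 1) ^ 3) := by gcongr
        _ = _ := by
          rw [hd]; norm_num
          rw [div_pow]; field_simp; ring
  set T := Qf m ^ (3 - j) * Qf (m + 1) ^ j with hT
  have hT0 : 0 < T := by positivity
  have : (V ^ 2) ^ 3 ≤ T ^ 3 := by
    calc (V ^ 2) ^ 3 ≤ (A * w ^ 2) ^ 3 := by gcongr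
      _ = A ^ 3 * w ^ 6 := by ring
      _ ≤ T ^ 3 * c ^ 2 * w ^ 6 := by gcongr
      _ = T ^ 3 * (c ^ 2 * w ^ 6) := by ring
      _ ≤ T ^ 3 * 1 := by gcongr
      _ = T ^ 3 := mul_one _
  exact le_of_pow_le_pow_left₀ (by norm_num) hT0.le this

/-- the gain obtained from a pentagram -/
noncomputable def dlt (d : ℕ) : ℝ := if d = 5 then 0.3411 else 0.312

theorem num_star (d m j : ℕ) (hm : 1 ≤ m) (hodd : Odd d) (hj : j = 1 ∨ j = 2) (hd : d = 3 * m + j)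
    (V : ℝ)
    (h : 27 * V ^ 2 ≤ (((d:ℝ) + 3) / d) ^ d * ((d:ℝ) + 3) * ((d:ℝ) + 3 - dlt d) ^ 2) :
    V ^ 2 ≤ Qf m ^ (3 - j) * Qf (m + 1) ^ j := by
  by_cases h3 : 3 ≤ m
  · apply num_gen d m j h3 hj hd
    rwa [dlt, if_neg (by omega)] at h
  · obtain ⟨t, ht⟩ := hodd
    have : (d = 5 ∧ m = 1 ∧ j = 2) ∨ (d = 7 ∧ m = 2 ∧ j = 1) := by omega
    rcases this with ⟨rfl, rfl, rfl⟩ | ⟨rfl, rfl, rfl⟩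
    · norm_num [dlt, Qf] at h ⊢; linarith
    · norm_num [dlt, Qf] at h ⊢; linarith

theorem num_zero (d m : ℕ) (hm : 1 ≤ m) (hd : d = 3 * m) (V : ℝ)
    (h : 27 * V ^ 2 ≤ (((d:ℝ) + 3) / d) ^ d * ((d:ℝ) + 3) * ((d:ℝ) + 3 - 0) ^ 2) :
    V ^ 2 ≤ Qf m ^ 3 := by
  have hm0 : (0:ℝ) < m := by exact_mod_cast hm
  have e : ((d:ℝ) + 3) / d = (m + 1) / m := by rw [hd]; push_cast; field_simp
  have e2 : (((m:ℝ) + 1) / m) ^ d = (((m:ℝ) + 1) / m) ^ m * (((m:ℝ) + 1) / m) ^ m *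
      (((m:ℝ) + 1) / m) ^ m := by rw [hd]; ring
  have e3 : (d:ℝ) + 3 = 3 * (m + 1) := by rw [hd]; push_cast; ring
  rw [e, e2, e3] at h
  have e1 : (Qf m : ℝ) = ((m + 1) / m) ^ m * (m + 1) := by
    rw [Qf, div_pow]; field_simp; ring
  rw [e1]
  nlinarith

theorem num_hq (d : ℕ) (hd : 5 ≤ d) (hodd : Odd d) :
    ((Fintype.card (Fin (d + 3)) : ℝ) - 1) * (cD - 0.212) ^ 2 ≤
      (((Fintype.card (Fin (d + 3)) : ℝ) - 1) * cD + 0.775 - dlt d * cD) * (cD * (1 - dlt d)) := by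
  obtain ⟨h1, h2⟩ := cD_bounds'
  rw [Fintype.card_fin]
  push_cast
  by_cases h5 : d = 5
  · subst h5
    norm_num [dlt]
    nlinarith
  · have : 7 ≤ d := by obtain ⟨t, ht⟩ := hodd; omega
    have h7 : (7:ℝ) ≤ d := by exact_mod_cast this
    rw [dlt, if_neg h5]
    obtain ⟨s, hs⟩ : ∃ s : ℝ, (d:ℝ) = 7 + s := ⟨d - 7, by ring⟩
    have hs0 : 0 ≤ s := by linarith
    rw [hs]
    have k1 : (cD - 0.212) ^ 2 ≤ cD * (cD * (1 - 0.312)) := by nlinarith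
    have k2 := mul_nonneg hs0 (sub_nonneg.2 k1)
    have k3 : 9 * (cD - 0.212) ^ 2 ≤ (9 * cD + 0.775 - 0.312 * cD) * (cD * (1 - 0.312)) := by
      nlinarith
    nlinarith


theorem main_sq (d : ℕ) (hd : 3 ≤ d) (hodd : Odd d) (m : ℕ) (hm : m = d / 3)
    (k : Fin 3 → ℕ) (hks : ∑ i, k i = d) (hk : ∀ i, k i = m ∨ k i = m + 1)
    (q : Fin (d + 3) → Fin d → ℝ) (hq : ∀ i, ∑ j, q i j ^ 2 = 1) :
    ((volume (convexHull ℝ (Set.range q))).toReal * d.factorial) ^ 2 ≤ ∏ i, Qf (k i) := by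
  classical
  have hm1 : 1 ≤ m := by omega
  have hd0 : 0 < d := by omega
  by_cases hnd : ∀ c c0, colComb q c c0 = 0 → c = 0 ∧ c0 = 0
  swap
  · push Not at hnd
    obtain ⟨c, c0, h, hc⟩ := hnd
    rw [degenerate_volume q c c0 (by tauto) h]
    simpa using Finset.prod_nonneg fun i _ => (Qf_pos (k i)).le
  obtain ⟨g0, g1, hdec, hs0, hs1, hq0, hq1, hn0, hn1, hn01⟩ := exists_gale q hnd
  have hg : ∀ x0 x1 : ℝ, x0 ^ 2 + x1 ^ 2 ≤ ∑ i, (g0 i * x0 + g1 i * x1) ^ 2 := by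
    intro x0 x1
    have : ∑ i, (g0 i * x0 + g1 i * x1) ^ 2 =
        (∑ i, g0 i ^ 2) * x0 ^ 2 + (∑ i, g1 i ^ 2) * x1 ^ 2 + (∑ i, g0 i * g1 i) * (2 * x0 * x1) := by
      rw [Finset.sum_mul, Finset.sum_mul, Finset.sum_mul, ← Finset.sum_add_distrib,
        ← Finset.sum_add_distrib]
      exact Finset.sum_congr rfl fun i _ => by ring
    rw [this, hn0, hn1, hn01]; linarith
  have hvb := volume_bound hd0 q g0 g1 hdec hs0 hs1 hq0 hq1 hg
  set V := (volume (convexHull ℝ (Set.range q))).toReal * d.factorial with hVd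
  have hV0 : 0 ≤ V := by positivity
  clear_value V
  obtain ⟨x, hx⟩ : ∃ x, 0 < g0 x ^ 2 + g1 x ^ 2 := by
    by_contra hcon
    push Not at hcon
    have : ∑ i, g0 i ^ 2 ≤ 0 := Finset.sum_nonpos fun i _ => by
      have := hcon i
      nlinarith [sq_nonneg (g1 i)]
    linarith
  have hcomplete : ∀ l0 l1 : ℝ, 0 < l0 ^ 2 + l1 ^ 2 →
      (∀ i, g0 i * l1 - g1 i * l0 = 0 → g0 i = 0 ∧ g1 i = 0) →
      ∀ A B : Finset (Fin (d + 3)), Disjoint A B →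
        ∑ a, ∑ b, (if 0 < g0 a*l1 - g1 a*l0 ∧ 0 < l0*g1 b - l1*g0 b ∧ 0 < g0 a*g1 b - g1 a*g0 b
          then g0 a*g1 b - g1 a*g0 b else 0) = ∑ a ∈ A, ∑ b ∈ B, (g0 a*g1 b - g1 a*g0 b) →
      V ^ 2 ≤ ∏ i, Qf (k i) := by
    intro l0 l1 hl hgen A B hAB hsum
    have h1 := hvb l0 l1 hl hgen
    rw [hsum] at h1
    have h2 := bigDet_gale q g0 g1 hdec (fun i => if i ∈ A then 1 else 0)
      (fun i => if i ∈ B then 1 else 0)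
    have h3 : ∑ a ∈ A, ∑ b ∈ B, (g0 a*g1 b - g1 a*g0 b) =
        (∑ a ∈ A, g0 a) * (∑ b ∈ B, g1 b) - (∑ a ∈ A, g1 a) * (∑ b ∈ B, g0 b) := by
      simp only [Finset.sum_sub_distrib, Finset.sum_mul_sum]
    simp only [mul_ite, mul_one, mul_zero, Finset.sum_ite_mem, Finset.univ_inter] at h2
    rw [← h3] at h2
    refine le_trans ?_ (three_class q hq m hm1 k hk hks A B hAB)
    rw [h2, mul_pow, ← sq_abs (bigDet q g0 g1), ← mul_pow]
    exact pow_le_pow_left₀ hV0 h1 2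
  obtain ⟨φ', lam, hφ, -⟩ := exists_angles g0 g1 1 0 (by norm_num)
  set r : Fin (d + 3) → ℝ := fun i => √(g0 i ^ 2 + g1 i ^ 2) with hr
  set φ : Fin (d + 3) → ℝ := fun i => φ' i + lam with hφd
  have hr0 : ∀ i, 0 ≤ r i := fun i => Real.sqrt_nonneg _
  have e0 : ∀ i, g0 i = r i * cos (φ i) := fun i => (hφ i).1
  have e1 : ∀ i, g1 i = r i * sin (φ i) := fun i => (hφ i).2
  have hr2 : ∑ i, r i ^ 2 = 2 := by
    have : ∀ i, r i ^ 2 = g0 i ^ 2 + g1 i ^ 2 := fun i => Real.sq_sqrt (by positivity)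
    simp only [this, Finset.sum_add_distrib, hn0, hn1]; norm_num
  have hav := averaging g0 g1 r φ V |bigDet q g0 g1| (abs_nonneg _) hr0 e0 e1 hvb
  have hκ := kappa_bound hd0 q hq g0 g1 hn0 hn1
  rw [← sq_abs] at hκ
  obtain ⟨j, hj⟩ : ∃ j, d = 3 * m + j := ⟨d % 3, by omega⟩
  have hj3 : j ≤ 2 := by omega
  rw [num_T m j hj (by omega) k hk hks]
  have hcard : ((Fintype.card (Fin (d + 3)) : ℕ) : ℝ) = (d:ℝ) + 3 := by simp
  rcases Nat.eq_zero_or_pos j with rfl | hjp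
  · have hS := S_final_nostar r φ hr0 (by simpa only [← e0] using hs0)
      (by simpa only [← e1] using hs1) hr2
    have h4 := hav.trans (mul_le_mul_of_nonneg_left hS (abs_nonneg _))
    rw [hcard] at h4
    have h5 := num_A d hd0 V _ 0 hV0 hκ (by simpa using h4)
    have := num_zero d m hm1 (by omega) V h5
    simpa using this
  · rcases dichotomy g0 g1 x hx with ⟨l0, l1, hl, hgen, A, B, hAB, hsum⟩ | hst
    · rw [← num_T m j hj (by omega) k hk hks]
      exact hcomplete l0 l1 hl hgen A B hAB hsum
    · have hd5 : 5 ≤ d := by obtain ⟨t, ht⟩ := hodd; omega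
      have hδ : 0 ≤ dlt d ∧ dlt d < 1 := by
        unfold dlt; split_ifs <;> norm_num
      have hS := S_final_star g0 g1 r φ (fun _ => rfl) e0 e1 hs0 hs1 hr2 hst (dlt d) hδ.1 hδ.2
        (num_hq d hd5 hodd)
      have h4 := hav.trans (mul_le_mul_of_nonneg_left hS (abs_nonneg _))
      rw [hcard] at h4
      have h5 := num_A d hd0 V _ (dlt d) hV0 hκ h4
      exact num_star d m j hm1 hodd (by omega) hj V h5

theorem volume_transfer {d n : ℕ} (p : Fin n → EuclideanSpace ℝ (Fin d)) :
    volume (convexHull ℝ (Set.range p)) =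
      volume (convexHull ℝ (Set.range fun i => (fun j => p i j : Fin d → ℝ))) := by
  have h := (PiLp.volume_preserving_ofLp (Fin d)).measure_preimage_equiv
    (f := (MeasurableEquiv.toLp 2 (Fin d → ℝ)).symm)
    (convexHull ℝ (Set.range fun i => (fun j => p i j : Fin d → ℝ)))
  rw [← h]
  congr 1
  let L : EuclideanSpace ℝ (Fin d) →ₗ[ℝ] (Fin d → ℝ) :=
    (WithLp.linearEquiv 2 ℝ (Fin d → ℝ)).toLinearMap
  have hinj : Function.Injective L := (WithLp.linearEquiv 2 ℝ (Fin d → ℝ)).injective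
  have h1 : (Set.range fun i => (fun j => p i j : Fin d → ℝ)) = L '' Set.range p := by
    rw [← Set.range_comp]; rfl
  rw [h1, ← L.image_convexHull]
  exact (Set.preimage_image_eq _ hinj).symm

theorem max_volume_d_plus_three_vertices (d : ℕ) (hd : 3 ≤ d) (hodd : Odd d)
    (k : Fin 3 → ℕ) (hsum : ∑ i, k i = d)
    (hk : ∀ i, (k i : ℤ) = ⌊(d : ℝ) / 3⌋ ∨ (k i : ℤ) = ⌈(d : ℝ) / 3⌉)
    (p : Fin (d + 3) → EuclideanSpace ℝ (Fin d)) (hp : ∀ i, ‖p i‖ = 1) :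
    (volume (convexHull ℝ (Set.range p))).toReal ≤
      (1 / (d.factorial : ℝ)) *
        ∏ i, ((k i : ℝ) + 1) ^ (((k i : ℝ) + 1) / 2) / (k i : ℝ) ^ ((k i : ℝ) / 2) := by
  have hfl : ⌊(d : ℝ) / 3⌋ = ((d / 3 : ℕ) : ℤ) := by
    rw [Int.floor_eq_iff]
    have h1 : 3 * (d / 3) ≤ d := by omega
    have h2 : d < 3 * (d / 3) + 3 := by omega
    have h1' : (3:ℝ) * ((d / 3 : ℕ) : ℝ) ≤ d := by exact_mod_cast h1
    have h2' : (d:ℝ) < 3 * ((d / 3 : ℕ) : ℝ) + 3 := by exact_mod_cast h2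
    rw [Int.cast_natCast]
    constructor <;> linarith
  have hk' : ∀ i, k i = d / 3 ∨ k i = d / 3 + 1 := by
    intro i
    rcases hk i with h | h
    · left; rw [hfl] at h; exact_mod_cast h
    · have h1 := Int.ceil_le_floor_add_one ((d:ℝ) / 3)
      have h2 := Int.floor_le_ceil ((d:ℝ) / 3)
      rw [hfl, ← h] at h1 h2
      omega
  have hq : ∀ i, ∑ j, (p i j) ^ 2 = 1 := by
    intro i
    have h := EuclideanSpace.norm_sq_eq (p i)
    rw [hp i] at h
    simp only [Real.norm_eq_abs, sq_abs] at h
    linarith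
  have hmain := main_sq d hd hodd (d / 3) rfl k hsum hk' (fun i j => p i j) hq
  rw [← volume_transfer] at hmain
  have hR : ∀ i, (((k i : ℝ) + 1) ^ (((k i : ℝ) + 1) / 2) / (k i : ℝ) ^ ((k i : ℝ) / 2)) ^ 2 =
      Qf (k i) := by
    intro i
    have hz : (0:ℝ) ≤ k i := Nat.cast_nonneg _
    rw [div_pow, ← Real.rpow_mul_natCast (by positivity), ← Real.rpow_mul_natCast hz, Qf]
    congr 1
    · rw [← Real.rpow_natCast]; congr 1; push_cast; ring
    · rw [← Real.rpow_natCast]; congr 1; push_cast; ring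
  have hf : (0:ℝ) < d.factorial := by exact_mod_cast Nat.factorial_pos d
  rw [one_div, ← div_eq_inv_mul, le_div_iff₀ hf]
  refine le_of_pow_le_pow_left₀ two_ne_zero ?_ ?_
  swap
  · rw [← Finset.prod_pow]
    simpa only [hR] using hmain
  · exact Finset.prod_nonneg fun i _ => by positivity
end
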